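/- arXiv:math/0606151 — 6 statements merged into one kernel-verified Lean document; each statement's English description precedes it below -/
import Mathlib

section
/- Let N ≥ 2 and λ ∈ (−N, 0]. Then there exists a positive constant C_P (depending only on N and λ) such that for every x ∈ ℝ^N, every r > 0, and every f ∈ C¹ on the closure of B(x,r), one has inf_{ξ ∈ ℝ} ∫_{B(x,r)} |y|^λ · |f(y) − ξ|² dy ≤ C_P · r² · ∫_{B(x,r)} |y|^λ · |∇f(y)|² dy. -/
open MeasureTheory Real

noncomputable section

theorem lint_smul {N : ℕ} {F : EuclideanSpace ℝ (Fin N) → ENNReal} (hF : Measurable F)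
    {t : ℝ} (ht : 0 < t) :
    ENNReal.ofReal (t ^ N) * ∫⁻ z, F (t • z) = ∫⁻ z, F z := by
  have h := Measure.map_addHaar_smul (volume : Measure (EuclideanSpace ℝ (Fin N))) ht.ne'
  have h2 : ∫⁻ z, F (t • z) = ENNReal.ofReal (t ^ N)⁻¹ * ∫⁻ z, F z := by
    rw [← lintegral_map (f := F) (g := fun z => t • z) hF (measurable_const_smul t), h,
      lintegral_smul_measure]
    simp [abs_of_pos ht]
  have hp : 0 < t ^ N := by positivity
  rw [h2, ← mul_assoc, ← ENNReal.ofReal_mul hp.le, mul_inv_cancel₀ hp.ne']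
  simp

theorem lint_affine {N : ℕ} {F : EuclideanSpace ℝ (Fin N) → ENNReal} (hF : Measurable F)
    {t : ℝ} (ht : 0 < t) (y : EuclideanSpace ℝ (Fin N)) :
    ENNReal.ofReal (t ^ N) * ∫⁻ z, F (y + t • (z - y)) = ∫⁻ z, F z := by
  have h1 : ∀ z, y + t • (z - y) = t • z + (y - t • y) := by
    intro z; rw [smul_sub]; abel
  simp_rw [h1]
  rw [lint_smul (F := fun z => F (z + (y - t • y))) (by fun_prop) ht]
  exact lintegral_add_right_eq_self F _

def wt {N : ℕ} (lam : ℝ) (y : EuclideanSpace ℝ (Fin N)) : ENNReal := ENNReal.ofReal (‖y‖ ^ lam)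

theorem wt_meas {N : ℕ} (lam : ℝ) : Measurable (wt (N := N) lam) := by
  unfold wt; fun_prop

theorem wt_integrable {N : ℕ} (hN : 2 ≤ N) {lam : ℝ} (h1 : -(N : ℝ) < lam) :
    LocallyIntegrable (fun y : EuclideanSpace ℝ (Fin N) => ‖y‖ ^ lam) := by
  refine locallyIntegrable_of_norm_le_rpow (C := 1) (α := -lam) ?_ ?_ ?_ ?_
  · rw [finrank_euclideanSpace_fin]; omega
  · rw [finrank_euclideanSpace_fin]; linarith
  · filter_upwards with x
    rw [one_mul, neg_neg, Real.norm_of_nonneg (by positivity)]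
  · exact (by fun_prop : Measurable (fun y : EuclideanSpace ℝ (Fin N) => ‖y‖ ^ lam)).aestronglyMeasurable

theorem wt_ball {N : ℕ} (lam : ℝ) {s : ℝ} (hs : 0 < s) :
    ∫⁻ y in Metric.ball (0 : EuclideanSpace ℝ (Fin N)) s, wt lam y
      = ENNReal.ofReal (s ^ N) * (ENNReal.ofReal (s ^ lam) *
        ∫⁻ y in Metric.ball (0 : EuclideanSpace ℝ (Fin N)) 1, wt lam y) := by
  rw [← lintegral_indicator measurableSet_ball, ← lintegral_indicator measurableSet_ball,
    ← lint_smul ((wt_meas lam).indicator measurableSet_ball) hs,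
    ← lintegral_const_mul _ ((wt_meas lam).indicator measurableSet_ball)]
  congr 2
  ext z
  by_cases hz : ‖z‖ < 1
  · rw [Set.indicator_of_mem, Set.indicator_of_mem]
    · simp only [wt]
      rw [← ENNReal.ofReal_mul (by positivity), norm_smul, Real.norm_of_nonneg hs.le,
        Real.mul_rpow hs.le (norm_nonneg _)]
    · simpa using hz
    · simpa [norm_smul, abs_of_pos hs] using mul_lt_mul_of_pos_left hz hs
  · rw [Set.indicator_of_notMem, Set.indicator_of_notMem]
    · simp
    · simpa using hz
    · simp only [mem_ball_zero_iff, norm_smul, Real.norm_of_nonneg hs.le]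
      push Not at hz ⊢
      nlinarith

abbrev EE (N : ℕ) := EuclideanSpace ℝ (Fin N)

theorem wt_A1 {N : ℕ} (hN : 2 ≤ N) {lam : ℝ} (h1 : -(N : ℝ) < lam) (h2 : lam ≤ 0) :
    ∃ C : ℝ, 0 < C ∧ ∀ (u : EE N), u ≠ 0 → ∀ s : ℝ, 0 < s →
      ∫⁻ y in Metric.ball u s, wt lam y ≤ ENNReal.ofReal (C * s ^ N) * wt lam u := by
  set K := ∫⁻ y in Metric.ball (0 : EE N) 1, wt lam y with hK
  have hKfin : K ≠ ⊤ := by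
    have := ((wt_integrable hN h1).integrableOn_isCompact
      (isCompact_closedBall (0 : EE N) 1)).mono_set Metric.ball_subset_closedBall
    have h3 := this.lintegral_lt_top
    exact h3.ne
  set V := volume (Metric.ball (0 : EE N) 1) with hV
  have hnt : Nontrivial (EE N) := by
    have : Nonempty (Fin N) := ⟨⟨0, by omega⟩⟩
    infer_instance
  have hVfin : V ≠ ⊤ := measure_ball_lt_top.ne
  refine ⟨V.toReal * 2 ^ (-lam) + 3 ^ N * K.toReal + 1, by positivity, ?_⟩
  intro u hu s hs
  have hun : 0 < ‖u‖ := norm_pos_iff.mpr hu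
  rcases le_or_gt s (‖u‖ / 2) with hsu | hsu
  · calc ∫⁻ y in Metric.ball u s, wt lam y
        ≤ ∫⁻ y in Metric.ball u s, ENNReal.ofReal (2 ^ (-lam) * ‖u‖ ^ lam) := by
          apply setLIntegral_mono measurable_const
          intro y hy
          apply ENNReal.ofReal_le_ofReal
          have h3 : ‖u‖ / 2 ≤ ‖y‖ := by
            have := norm_sub_norm_le u y
            rw [Metric.mem_ball, dist_comm, dist_eq_norm] at hy
            linarith
          calc ‖y‖ ^ lam ≤ (‖u‖ / 2) ^ lam :=
                Real.rpow_le_rpow_of_nonpos (by positivity) h3 h2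
            _ = _ := by
              rw [Real.div_rpow hun.le (by norm_num), Real.rpow_neg (by norm_num)]
              field_simp
      _ = ENNReal.ofReal (2 ^ (-lam) * ‖u‖ ^ lam) * (ENNReal.ofReal (s ^ N) * V) := by
          rw [setLIntegral_const, Measure.addHaar_ball _ _ hs.le]
          simp [hV]
      _ = ENNReal.ofReal (V.toReal * 2 ^ (-lam) * s ^ N) * wt lam u := by
          rw [← ENNReal.ofReal_toReal hVfin, wt, ← ENNReal.ofReal_mul (by positivity),
            ← ENNReal.ofReal_mul (by positivity), ← ENNReal.ofReal_mul (by positivity)]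
          rw [ENNReal.toReal_ofReal (by positivity)]
          congr 1; ring
      _ ≤ _ := by
          gcongr
          have : 0 ≤ 3 ^ N * K.toReal := by positivity
          linarith
  · calc ∫⁻ y in Metric.ball u s, wt lam y
        ≤ ∫⁻ y in Metric.ball (0 : EE N) (3 * s), wt lam y := by
          apply lintegral_mono_set
          apply Metric.ball_subset_ball'
          rw [dist_zero_right]; linarith
      _ = ENNReal.ofReal ((3 * s) ^ N) * (ENNReal.ofReal ((3 * s) ^ lam) * K) :=
          wt_ball lam (by positivity)
      _ ≤ ENNReal.ofReal ((3 * s) ^ N) * (wt lam u * K) := by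
          gcongr
          exact ENNReal.ofReal_le_ofReal
            (Real.rpow_le_rpow_of_nonpos (by positivity) (by linarith) h2)
      _ = ENNReal.ofReal (3 ^ N * K.toReal * s ^ N) * wt lam u := by
          rw [← ENNReal.ofReal_toReal hKfin, wt, ← ENNReal.ofReal_mul (by positivity),
            ← ENNReal.ofReal_mul (by positivity), ← ENNReal.ofReal_mul (by positivity)]
          rw [ENNReal.toReal_ofReal (by positivity)]
          congr 1; ring
      _ ≤ _ := by
          gcongr
          have : 0 ≤ V.toReal * 2 ^ (-lam) := by positivity
          linarith

/-- Key averaged estimate for a fixed `t`. -/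
theorem key_t {N : ℕ} (hN : 2 ≤ N) {lam C : ℝ}
    (hC : ∀ (u : EE N), u ≠ 0 → ∀ s : ℝ, 0 < s →
      ∫⁻ y in Metric.ball u s, wt lam y ≤ ENNReal.ofReal (C * s ^ N) * wt lam u)
    (x : EE N) {r : ℝ} (hr : 0 < r)
    {G : EE N → ENNReal} (hG : Measurable G) {t : ℝ} (ht : 0 < t) :
    ∫⁻ y in Metric.ball x r, ∫⁻ z in Metric.ball x r, wt lam y * G (y + t • (z - y))
      ≤ ENNReal.ofReal (C * (2 * r) ^ N) * ∫⁻ u, G u * wt lam u := by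
  have htN : 0 < t ^ N := by positivity
  have hs : 0 < 2 * r * t := by positivity
  have hw := wt_meas (N := N) lam
  have h1 : Measurable ((Metric.ball (0:EE N) (2*r*t)).indicator (1 : EE N → ENNReal)) :=
      measurable_one.indicator measurableSet_ball
  have hJ : Measurable (fun p : EE N × EE N => (Metric.ball (0:EE N) (2*r*t)).indicator 1 (p.2 - p.1) * G p.2 * wt lam p.1) := by
    exact ((h1.comp (measurable_snd.sub measurable_fst)).mul (hG.comp measurable_snd)).mul
      (hw.comp measurable_fst)
  have step1 : ∀ y ∈ Metric.ball x r,
      ∫⁻ z in Metric.ball x r, wt lam y * G (y + t • (z - y)) ≤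
      ENNReal.ofReal (t ^ N)⁻¹ *
        ∫⁻ u, (Metric.ball (0:EE N) (2*r*t)).indicator 1 (u - y) * G u * wt lam y := by
    intro y hy
    have hJy : Measurable (fun u : EE N =>
        (Metric.ball (0:EE N) (2*r*t)).indicator 1 (u - y) * G u * wt lam y) :=
      ((h1.comp (measurable_id.sub_const y)).mul hG).mul_const _
    have hA := lint_affine hJy ht y
    rw [← hA, ← mul_assoc,
      ← ENNReal.ofReal_mul (by positivity), inv_mul_cancel₀ htN.ne', ENNReal.ofReal_one, one_mul]
    rw [← lintegral_indicator measurableSet_ball]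
    apply lintegral_mono
    intro z
    by_cases hz : z ∈ Metric.ball x r
    · have : y + t • (z - y) - y ∈ Metric.ball (0:EE N) (2*r*t) := by
        rw [mem_ball_zero_iff, add_sub_cancel_left, norm_smul, Real.norm_of_nonneg ht.le]
        have h3 : ‖z - y‖ < 2 * r := by
          rw [← dist_eq_norm]
          have := dist_triangle_right z y x
          rw [Metric.mem_ball] at hy hz
          linarith
        nlinarith
      simp only [Set.indicator_of_mem hz, Set.indicator_of_mem this, Pi.one_apply, one_mul]
      rw [mul_comm]
    · simp [Set.indicator_of_notMem hz]
  have hae : ∀ᵐ u : EE N, u ≠ 0 := by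
    have : Nontrivial (EE N) := by
      have : Nonempty (Fin N) := ⟨⟨0, by omega⟩⟩
      infer_instance
    exact Measure.ae_ne volume 0
  calc ∫⁻ y in Metric.ball x r, ∫⁻ z in Metric.ball x r, wt lam y * G (y + t • (z - y))
      ≤ ∫⁻ y in Metric.ball x r, ENNReal.ofReal (t ^ N)⁻¹ *
        ∫⁻ u, (Metric.ball (0:EE N) (2*r*t)).indicator 1 (u - y) * G u * wt lam y :=
        setLIntegral_mono' measurableSet_ball step1
    _ ≤ ∫⁻ y, ENNReal.ofReal (t ^ N)⁻¹ *
        ∫⁻ u, (Metric.ball (0:EE N) (2*r*t)).indicator 1 (u - y) * G u * wt lam y :=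
        setLIntegral_le_lintegral _ _
    _ = ENNReal.ofReal (t ^ N)⁻¹ * ∫⁻ y, 
        ∫⁻ u, (Metric.ball (0:EE N) (2*r*t)).indicator 1 (u - y) * G u * wt lam y := by
        rw [lintegral_const_mul']
        exact ENNReal.ofReal_ne_top
    _ = ENNReal.ofReal (t ^ N)⁻¹ * ∫⁻ u, 
        ∫⁻ y, (Metric.ball (0:EE N) (2*r*t)).indicator 1 (u - y) * G u * wt lam y := by
        rw [lintegral_lintegral_swap hJ.aemeasurable]
    _ ≤ ENNReal.ofReal (t ^ N)⁻¹ * ∫⁻ u, ENNReal.ofReal (C * (2*r*t) ^ N) * (G u * wt lam u) := by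
        refine mul_le_mul_right ?_ _
        apply lintegral_mono_ae
        filter_upwards [hae] with u hu
        have e : ∀ y, (Metric.ball (0:EE N) (2*r*t)).indicator 1 (u - y) * G u * wt lam y
            = G u * (Metric.ball u (2*r*t)).indicator (wt lam) y := by
          intro y
          by_cases hy : y ∈ Metric.ball u (2*r*t)
          · have : u - y ∈ Metric.ball (0:EE N) (2*r*t) := by
              rw [mem_ball_zero_iff, ← dist_eq_norm, dist_comm]; exact hy
            rw [Set.indicator_of_mem hy, Set.indicator_of_mem this]; simp
          · have : u - y ∉ Metric.ball (0:EE N) (2*r*t) := by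
              rw [mem_ball_zero_iff, ← dist_eq_norm, dist_comm]; exact hy
            rw [Set.indicator_of_notMem hy, Set.indicator_of_notMem this]; simp
        simp_rw [e]
        rw [lintegral_const_mul _ (hw.indicator measurableSet_ball),
          lintegral_indicator measurableSet_ball]
        calc _ ≤ G u * (ENNReal.ofReal (C * (2*r*t) ^ N) * wt lam u) := by
              gcongr; exact hC u hu _ hs
          _ = _ := by ring
    _ = _ := by
        rw [lintegral_const_mul' _ _ ENNReal.ofReal_ne_top, ← mul_assoc,
          ← ENNReal.ofReal_mul (by positivity)]
        congr 2
        rw [mul_pow]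
        field_simp

theorem cs_unit {h : ℝ → ℝ} (hc : ContinuousOn h (Set.Icc 0 1)) :
    (∫ t in (0:ℝ)..1, h t) ^ 2 ≤ ∫ t in (0:ℝ)..1, h t ^ 2 := by
  have hc' : ContinuousOn h (Set.uIcc 0 1) := by rwa [Set.uIcc_of_le zero_le_one]
  have i1 : IntervalIntegrable h volume 0 1 := hc'.intervalIntegrable
  have i2 : IntervalIntegrable (fun t => h t ^ 2) volume 0 1 := (hc'.pow 2).intervalIntegrable
  set c := ∫ t in (0:ℝ)..1, h t with hcdef
  have h0 : 0 ≤ ∫ t in (0:ℝ)..1, (h t - c) ^ 2 :=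
    intervalIntegral.integral_nonneg zero_le_one (fun t _ => sq_nonneg _)
  have h1 : ∫ t in (0:ℝ)..1, (h t - c) ^ 2 = (∫ t in (0:ℝ)..1, h t ^ 2) - 2 * c * c + c ^ 2 := by
    have e : ∀ t, (h t - c) ^ 2 = h t ^ 2 - 2 * c * h t + c ^ 2 := fun t => by ring
    simp_rw [e]
    rw [intervalIntegral.integral_add (i2.sub (i1.const_mul _)) (by simp),
      intervalIntegral.integral_sub i2 (i1.const_mul _), intervalIntegral.integral_const_mul]
    simp [← hcdef]
  nlinarith

theorem norm_gradient_eq {N : ℕ} (f : EE N → ℝ) (y : EE N) : ‖gradient f y‖ = ‖fderiv ℝ f y‖ := by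
  simp [gradient]

/-- squared gradient, cut off to the ball -/
def GG {N : ℕ} (f : EE N → ℝ) (x : EE N) (r : ℝ) : EE N → ENNReal :=
  (Metric.ball x r).indicator (fun y => ENNReal.ofReal (‖gradient f y‖ ^ 2))

theorem GG_meas {N : ℕ} (f : EE N → ℝ) (x : EE N) (r : ℝ) : Measurable (GG f x r) := by
  apply Measurable.indicator _ measurableSet_ball
  simp_rw [norm_gradient_eq]
  have := measurable_fderiv ℝ f
  fun_prop

theorem pointwise_bd {N : ℕ} {f : EE N → ℝ} {x : EE N} {r : ℝ}
    (hf : ContDiffOn ℝ 1 f (Metric.ball x r)) {y z : EE N}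
    (hy : y ∈ Metric.ball x r) (hz : z ∈ Metric.ball x r) :
    ENNReal.ofReal (|f y - f z| ^ 2) ≤ ENNReal.ofReal (4 * r ^ 2) *
      ∫⁻ t in Set.Ioc (0:ℝ) 1, GG f x r (y + t • (z - y)) := by
  have hmem : ∀ t ∈ Set.Icc (0:ℝ) 1, y + t • (z - y) ∈ Metric.ball x r := fun t ht =>
    (convex_ball x r).add_smul_sub_mem hy hz ht
  have hfd : ContinuousOn (fderiv ℝ f) (Metric.ball x r) :=
    hf.continuousOn_fderiv_of_isOpen Metric.isOpen_ball le_rfl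
  have hline : Continuous (fun t : ℝ => y + t • (z - y)) := by fun_prop
  have hcomp : ContinuousOn (fun t : ℝ => fderiv ℝ f (y + t • (z - y))) (Set.Icc 0 1) :=
    hfd.comp hline.continuousOn hmem
  have hh : ContinuousOn (fun t : ℝ => fderiv ℝ f (y + t • (z - y)) (z - y)) (Set.Icc 0 1) :=
    hcomp.clm_apply continuousOn_const
  have hder : ∀ t ∈ Set.uIcc (0:ℝ) 1, HasDerivAt (fun t : ℝ => f (y + t • (z - y)))
      (fderiv ℝ f (y + t • (z - y)) (z - y)) t := by
    intro t ht
    rw [Set.uIcc_of_le zero_le_one] at ht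
    have h1 : HasFDerivAt f (fderiv ℝ f (y + t • (z - y))) (y + t • (z - y)) :=
      ((hf.differentiableOn one_ne_zero).differentiableAt
        (Metric.isOpen_ball.mem_nhds (hmem t ht))).hasFDerivAt
    have h2 : HasDerivAt (fun t : ℝ => y + t • (z - y)) (z - y) t := by
      simpa using ((hasDerivAt_id t).smul_const (z - y)).const_add y
    exact h1.comp_hasDerivAt t h2
  have hftc := intervalIntegral.integral_eq_sub_of_hasDerivAt hder
    (ContinuousOn.intervalIntegrable (by rwa [Set.uIcc_of_le zero_le_one]))
  simp only [one_smul, add_sub_cancel, zero_smul, add_zero] at hftc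
  have hzy : ‖z - y‖ ≤ 2 * r := by
    rw [← dist_eq_norm]
    have := dist_triangle_right z y x
    rw [Metric.mem_ball] at hy hz
    linarith
  have hg2 : ContinuousOn (fun t : ℝ => ‖fderiv ℝ f (y + t • (z - y))‖ ^ 2) (Set.Icc 0 1) :=
    hcomp.norm.pow 2
  have hreal : |f y - f z| ^ 2 ≤
      4 * r ^ 2 * ∫ t in Set.Ioc (0:ℝ) 1, ‖fderiv ℝ f (y + t • (z - y))‖ ^ 2 := by
    rw [sq_abs, ← intervalIntegral.integral_of_le zero_le_one,
      ← intervalIntegral.integral_const_mul]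
    calc (f y - f z) ^ 2 = (f z - f y) ^ 2 := by ring
      _ ≤ ∫ t in (0:ℝ)..1, (fderiv ℝ f (y + t • (z - y)) (z - y)) ^ 2 := by
          rw [← hftc]; exact cs_unit hh
      _ ≤ _ := by
          apply intervalIntegral.integral_mono_on zero_le_one
          · exact ContinuousOn.intervalIntegrable
              (by rw [Set.uIcc_of_le zero_le_one]; exact hh.pow 2)
          · exact ContinuousOn.intervalIntegrable
              (by rw [Set.uIcc_of_le zero_le_one]; exact continuousOn_const.mul hg2)
          · intro t ht
            have h3 := (fderiv ℝ f (y + t • (z - y))).le_opNorm (z - y)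
            have h4 : ‖fderiv ℝ f (y + t • (z - y)) (z - y)‖ ≤
                ‖fderiv ℝ f (y + t • (z - y))‖ * (2 * r) := h3.trans (by gcongr)
            have h5 := pow_le_pow_left₀ (norm_nonneg _) h4 2
            rw [Real.norm_eq_abs, sq_abs] at h5
            calc _ ≤ _ := h5
              _ = _ := by ring
  have hint : IntegrableOn (fun t : ℝ => ‖fderiv ℝ f (y + t • (z - y))‖ ^ 2) (Set.Ioc 0 1) :=
    (hg2.integrableOn_Icc).mono_set Set.Ioc_subset_Icc_self
  calc ENNReal.ofReal (|f y - f z| ^ 2)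
      ≤ ENNReal.ofReal (4 * r ^ 2 *
        ∫ t in Set.Ioc (0:ℝ) 1, ‖fderiv ℝ f (y + t • (z - y))‖ ^ 2) :=
        ENNReal.ofReal_le_ofReal hreal
    _ = ENNReal.ofReal (4 * r ^ 2) *
        ∫⁻ t in Set.Ioc (0:ℝ) 1, ENNReal.ofReal (‖fderiv ℝ f (y + t • (z - y))‖ ^ 2) := by
        rw [ENNReal.ofReal_mul (by positivity), ofReal_integral_eq_lintegral_ofReal hint
          (Filter.Eventually.of_forall fun t => by positivity)]
    _ = _ := by
        congr 1
        apply setLIntegral_congr_fun measurableSet_Ioc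
        intro t ht
        simp only [GG]
        rw [Set.indicator_of_mem (hmem t (Set.Ioc_subset_Icc_self ht)), norm_gradient_eq]

theorem ofReal_integral_le {α : Type*} [MeasurableSpace α] {μ : Measure α} {f : α → ℝ}
    (hf : ∀ x, 0 ≤ f x) : ENNReal.ofReal (∫ x, f x ∂μ) ≤ ∫⁻ x, ENNReal.ofReal (f x) ∂μ := by
  by_cases h : Integrable f μ
  · exact (ofReal_integral_eq_lintegral_ofReal h (Filter.Eventually.of_forall hf)).le
  · rw [integral_undef h]; simp

theorem rhs_integrable {N : ℕ} (hN : 2 ≤ N) {lam : ℝ} (h1 : -(N : ℝ) < lam)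
    {f : EE N → ℝ} {x : EE N} {r : ℝ} (hr : 0 < r)
    (hf : ContDiffOn ℝ 1 f (closure (Metric.ball x r))) :
    IntegrableOn (fun y => ‖y‖ ^ lam * ‖gradient f y‖ ^ 2) (Metric.ball x r) := by
  have hcl : closure (Metric.ball x r) = Metric.closedBall x r := closure_ball x hr.ne'
  rw [hcl] at hf
  have hud : UniqueDiffOn ℝ (Metric.closedBall x r) :=
    uniqueDiffOn_convex (convex_closedBall x r)
      ⟨x, interior_mono Metric.ball_subset_closedBall
        (by rw [Metric.isOpen_ball.interior_eq]; exact Metric.mem_ball_self hr)⟩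
  have hc := hf.continuousOn_fderivWithin hud le_rfl
  obtain ⟨M, hM⟩ := (isCompact_closedBall x r).exists_bound_of_continuousOn hc
  have hw : IntegrableOn (fun y : EE N => ‖y‖ ^ lam) (Metric.ball x r) :=
    ((wt_integrable hN h1).integrableOn_isCompact
      (isCompact_closedBall x r)).mono_set Metric.ball_subset_closedBall
  have hmeas : Measurable (fun y => ‖gradient f y‖ ^ 2) := by
    simp_rw [norm_gradient_eq]
    have := measurable_fderiv ℝ f
    fun_prop
  refine Integrable.mul_bdd (c := M ^ 2) hw hmeas.aestronglyMeasurable ?_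
  filter_upwards [ae_restrict_mem measurableSet_ball] with y hy
  rw [norm_gradient_eq, norm_pow, norm_norm]
  have h3 : fderivWithin ℝ f (Metric.closedBall x r) y = fderiv ℝ f y :=
    fderivWithin_of_mem_nhds (Filter.mem_of_superset (Metric.isOpen_ball.mem_nhds hy)
      Metric.ball_subset_closedBall)
  have := hM y (Metric.ball_subset_closedBall hy)
  rw [h3] at this
  gcongr

theorem avg_bd {N : ℕ} (hN : 2 ≤ N) {lam C : ℝ}
    (hC : ∀ (u : EE N), u ≠ 0 → ∀ s : ℝ, 0 < s →
      ∫⁻ y in Metric.ball u s, wt lam y ≤ ENNReal.ofReal (C * s ^ N) * wt lam u)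
    (x : EE N) {r : ℝ} (hr : 0 < r) {G : EE N → ENNReal} (hG : Measurable G) :
    ∫⁻ z in Metric.ball x r, ∫⁻ y in Metric.ball x r,
        wt lam y * ∫⁻ t in Set.Ioc (0:ℝ) 1, G (y + t • (z - y))
      ≤ ENNReal.ofReal (C * (2 * r) ^ N) * ∫⁻ u, G u * wt lam u := by
  have hw := wt_meas (N := N) lam
  have hΦ : Measurable (fun p : (EE N × EE N) × ℝ =>
      wt lam p.1.1 * G (p.1.1 + p.2 • (p.1.2 - p.1.1))) := by
    have h1 : Measurable (fun p : (EE N × EE N) × ℝ => p.1.1 + p.2 • (p.1.2 - p.1.1)) := by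
      fun_prop
    exact (hw.comp (measurable_fst.comp measurable_fst)).mul (hG.comp h1)
  have e1 : ∀ z y : EE N, wt lam y * ∫⁻ t in Set.Ioc (0:ℝ) 1, G (y + t • (z - y))
      = ∫⁻ t in Set.Ioc (0:ℝ) 1, wt lam y * G (y + t • (z - y)) := by
    intro z y
    exact (lintegral_const_mul' _ _ ENNReal.ofReal_ne_top).symm
  simp_rw [e1]
  have hm1 : Measurable (fun p : EE N × EE N =>
      ∫⁻ t in Set.Ioc (0:ℝ) 1, wt lam p.2 * G (p.2 + t • (p.1 - p.2))) := by
    apply Measurable.lintegral_prod_right'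
      (f := fun q : (EE N × EE N) × ℝ => wt lam q.1.2 * G (q.1.2 + q.2 • (q.1.1 - q.1.2)))
    exact hΦ.comp (f := fun q : (EE N × EE N) × ℝ => ((q.1.2, q.1.1), q.2)) (by fun_prop)
  have hm2 : ∀ y : EE N, Measurable (fun p : EE N × ℝ => wt lam y * G (y + p.2 • (p.1 - y))) := by
    intro y
    exact hΦ.comp (f := fun q : EE N × ℝ => ((y, q.1), q.2)) (by fun_prop)
  have hm3 : Measurable (fun p : EE N × ℝ =>
      ∫⁻ z in Metric.ball x r, wt lam p.1 * G (p.1 + p.2 • (z - p.1))) := by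
    apply Measurable.lintegral_prod_right'
      (f := fun q : (EE N × ℝ) × EE N => wt lam q.1.1 * G (q.1.1 + q.1.2 • (q.2 - q.1.1)))
    exact hΦ.comp (f := fun q : (EE N × ℝ) × EE N => ((q.1.1, q.2), q.1.2)) (by fun_prop)
  rw [lintegral_lintegral_swap hm1.aemeasurable]
  have e2 : ∀ y : EE N, ∫⁻ z in Metric.ball x r, ∫⁻ t in Set.Ioc (0:ℝ) 1,
      wt lam y * G (y + t • (z - y)) = ∫⁻ t in Set.Ioc (0:ℝ) 1, ∫⁻ z in Metric.ball x r,
      wt lam y * G (y + t • (z - y)) := fun y =>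
    lintegral_lintegral_swap (hm2 y).aemeasurable
  simp_rw [e2]
  rw [lintegral_lintegral_swap hm3.aemeasurable]
  calc _ ≤ ∫⁻ t in Set.Ioc (0:ℝ) 1, ENNReal.ofReal (C * (2 * r) ^ N) * ∫⁻ u, G u * wt lam u :=
        setLIntegral_mono' measurableSet_Ioc (fun t ht => key_t hN hC x hr hG ht.1)
    _ = _ := by rw [setLIntegral_const]; simp

/-- Local weighted Poincaré inequality with weight `|y|^λ` on Euclidean balls. -/
theorem local_weighted_poincare
    (N : ℕ) (hN : 2 ≤ N) (lam : ℝ) (hlam₁ : -(N : ℝ) < lam) (hlam₂ : lam ≤ 0) :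
    ∃ C_P : ℝ, 0 < C_P ∧ ∀ (x : EuclideanSpace ℝ (Fin N)) (r : ℝ), 0 < r →
      ∀ f : EuclideanSpace ℝ (Fin N) → ℝ,
        ContDiffOn ℝ 1 f (closure (Metric.ball x r)) →
        (⨅ ξ : ℝ, ∫ y in Metric.ball x r, ‖y‖ ^ lam * |f y - ξ| ^ 2) ≤
          C_P * r ^ 2 * ∫ y in Metric.ball x r, ‖y‖ ^ lam * ‖gradient f y‖ ^ 2 := by
  obtain ⟨C, hCpos, hC⟩ := wt_A1 hN hlam₁ hlam₂
  have hnt : Nontrivial (EE N) := by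
    have : Nonempty (Fin N) := ⟨⟨0, by omega⟩⟩
    infer_instance
  obtain ⟨V, hV⟩ : ∃ V, V = (volume (Metric.ball (0 : EE N) 1)).toReal := ⟨_, rfl⟩
  have hVfin : volume (Metric.ball (0 : EE N) 1) ≠ ⊤ := measure_ball_lt_top.ne
  have hVpos : 0 < V := by
    rw [hV]
    exact ENNReal.toReal_pos (Metric.measure_ball_pos _ _ one_pos).ne' hVfin
  refine ⟨4 * C * 2 ^ N / V, by positivity, ?_⟩
  intro x r hr f hf
  have hfb : ContDiffOn ℝ 1 f (Metric.ball x r) := hf.mono subset_closure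
  set I := ⨅ ξ : ℝ, ∫ y in Metric.ball x r, ‖y‖ ^ lam * |f y - ξ| ^ 2 with hI
  set R := ∫ y in Metric.ball x r, ‖y‖ ^ lam * ‖gradient f y‖ ^ 2 with hR
  have hRnn : 0 ≤ R := integral_nonneg fun y => by positivity
  have hball : volume (Metric.ball x r) = ENNReal.ofReal (r ^ N * V) := by
    rw [Measure.addHaar_ball _ _ hr.le, ENNReal.ofReal_mul (by positivity), hV,
      ENNReal.ofReal_toReal hVfin]
    simp
  have hIz : ∀ z ∈ Metric.ball x r, ENNReal.ofReal I ≤ ∫⁻ y in Metric.ball x r,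
      ENNReal.ofReal (4 * r ^ 2) *
        (wt lam y * ∫⁻ t in Set.Ioc (0:ℝ) 1, GG f x r (y + t • (z - y))) := by
    intro z hz
    have h1 : I ≤ ∫ y in Metric.ball x r, ‖y‖ ^ lam * |f y - f z| ^ 2 :=
      ciInf_le ⟨0, by rintro _ ⟨ξ, rfl⟩; exact integral_nonneg fun y => by positivity⟩ (f z)
    calc ENNReal.ofReal I ≤ _ := ENNReal.ofReal_le_ofReal h1
      _ ≤ ∫⁻ y in Metric.ball x r, ENNReal.ofReal (‖y‖ ^ lam * |f y - f z| ^ 2) :=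
          ofReal_integral_le fun y => by positivity
      _ ≤ _ := by
          apply setLIntegral_mono' measurableSet_ball
          intro y hy
          rw [ENNReal.ofReal_mul (by positivity)]
          calc _ ≤ wt lam y * (ENNReal.ofReal (4 * r ^ 2) *
                ∫⁻ t in Set.Ioc (0:ℝ) 1, GG f x r (y + t • (z - y))) :=
                mul_le_mul_right (pointwise_bd hfb hy hz) _
            _ = _ := by ring
  have hGR : ∫⁻ u, GG f x r u * wt lam u = ENNReal.ofReal R := by
    rw [hR, ofReal_integral_eq_lintegral_ofReal (rhs_integrable hN hlam₁ hr hf)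
      (Filter.Eventually.of_forall fun y => by positivity),
      ← lintegral_indicator measurableSet_ball]
    congr 1
    ext u
    by_cases hu : u ∈ Metric.ball x r
    · simp only [GG, Set.indicator_of_mem hu, wt]
      rw [ENNReal.ofReal_mul (by positivity), mul_comm]
    · simp [GG, Set.indicator_of_notMem hu]
  have hmain : ENNReal.ofReal I * ENNReal.ofReal (r ^ N * V) ≤
      ENNReal.ofReal (4 * r ^ 2) * (ENNReal.ofReal (C * (2 * r) ^ N) * ENNReal.ofReal R) := by
    rw [← hball, ← setLIntegral_const, ← hGR]
    calc _ ≤ _ := setLIntegral_mono' measurableSet_ball hIz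
      _ = ENNReal.ofReal (4 * r ^ 2) * ∫⁻ z in Metric.ball x r, ∫⁻ y in Metric.ball x r,
          wt lam y * ∫⁻ t in Set.Ioc (0:ℝ) 1, GG f x r (y + t • (z - y)) := by
          simp_rw [lintegral_const_mul' _ _ (ENNReal.ofReal_ne_top (r := 4 * r ^ 2))]
      _ ≤ _ := mul_le_mul_right (avg_bd hN hC x hr (GG_meas f x r)) _
  rw [← ENNReal.ofReal_mul' (by positivity), ← ENNReal.ofReal_mul (by positivity),
    ← ENNReal.ofReal_mul (by positivity), ENNReal.ofReal_le_ofReal_iff (by positivity)] at hmain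
  have hrN : 0 < r ^ N * V := by positivity
  refine le_of_mul_le_mul_right (hmain.trans_eq ?_) hrN
  rw [mul_pow]
  field_simp
end
end

section
/- Let N ≥ 3, λ ∈ [2−N, 0), and let Ω ⊂ ℝ^N be a smooth bounded domain containing the origin. Then there exists a positive constant C_M such that for every ν ≥ N, every x ∈ Ω, every r > 0, and every f ∈ C₀^∞(B(x,r)), one has ∫_{B(x,r)} |y|^λ · |f(y)|^{2(1+2/ν)} dy ≤ C_M · r² · (r^N (|x|+r)^λ)^{−2/ν} · (∫_{B(x,r)} |y|^λ |∇f(y)|² dy) · (∫_{B(x,r)} |y|^λ |f(y)|² dy)^{2/ν}. -/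
open MeasureTheory Real

noncomputable section

/-- A set `Ω ⊆ ℝ^N` is a C² domain: it is the sublevel set of a C² function whose
differential does not vanish on the boundary. -/
def IsC2Domain {N : ℕ} (Ω : Set (EuclideanSpace ℝ (Fin N))) : Prop :=
  ∃ φ : EuclideanSpace ℝ (Fin N) → ℝ,
    ContDiff ℝ 2 φ ∧ Ω = {x | φ x < 0} ∧ ∀ x ∈ frontier Ω, fderiv ℝ φ x ≠ 0

/-- Regularised weight `(|y|² + ε)^{s/2}`. -/
def mw {N : ℕ} (ε s : ℝ) (y : EuclideanSpace ℝ (Fin N)) : ℝ := (‖y‖ ^ 2 + ε) ^ (s / 2)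

lemma mw_pos {N : ℕ} {ε : ℝ} (hε : 0 < ε) (s : ℝ) (y : EuclideanSpace ℝ (Fin N)) :
    0 < mw ε s y := by
  unfold mw; positivity

lemma mw_contDiff {N : ℕ} {ε : ℝ} (hε : 0 < ε) (s : ℝ) :
    ContDiff ℝ 1 (mw (N := N) ε s) := by
  unfold mw
  refine ContDiff.rpow_const_of_ne ?_ ?_
  · exact (contDiff_norm_sq ℝ).add contDiff_const
  · intro y; positivity

lemma mw_add {N : ℕ} {ε : ℝ} (hε : 0 < ε) (s t : ℝ) (y : EuclideanSpace ℝ (Fin N)) :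
    mw ε (s + t) y = mw ε s y * mw ε t y := by
  unfold mw
  rw [add_div, Real.rpow_add (by positivity)]

lemma mw_two {N : ℕ} (ε : ℝ) (y : EuclideanSpace ℝ (Fin N)) :
    mw ε 2 y = ‖y‖ ^ 2 + ε := by
  unfold mw; norm_num

lemma mw_rpow {N : ℕ} {ε : ℝ} (hε : 0 < ε) (s t : ℝ) (y : EuclideanSpace ℝ (Fin N)) :
    mw ε s y ^ t = mw ε (s * t) y := by
  unfold mw
  rw [← Real.rpow_mul (by positivity)]
  congr 1; ring

lemma mw_hasFDerivAt {N : ℕ} {ε : ℝ} (hε : 0 < ε) (s : ℝ) (y : EuclideanSpace ℝ (Fin N)) :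
    HasFDerivAt (mw ε s) ((s * mw ε (s - 2) y) • (innerSL ℝ y)) y := by
  have h1 : HasFDerivAt (fun y : EuclideanSpace ℝ (Fin N) => ‖y‖ ^ 2 + ε)
      (2 • (innerSL ℝ y)) y := by
    have := (hasStrictFDerivAt_norm_sq (F := EuclideanSpace ℝ (Fin N)) y).hasFDerivAt
    exact this.add_const ε
  have h2 := h1.rpow_const (p := s / 2) (Or.inl (by positivity))
  unfold mw
  refine h2.congr_fderiv ?_
  ext v
  simp
  rw [show (s - 2) / 2 = s / 2 - 1 by ring]
  ring

lemma int_of_cc {N : ℕ} {g : EuclideanSpace ℝ (Fin N) → ℝ} (hg : Continuous g)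
    {f : EuclideanSpace ℝ (Fin N) → ℝ} (hf : HasCompactSupport f)
    (h : ∀ y, y ∉ tsupport f → g y = 0) : Integrable g := by
  exact hg.integrable_of_hasCompactSupport (HasCompactSupport.intro hf h)

lemma fderiv_zero_off {N : ℕ} {f : EuclideanSpace ℝ (Fin N) → ℝ}
    {y : EuclideanSpace ℝ (Fin N)} (h : y ∉ tsupport f) : fderiv ℝ f y = 0 := by
  by_contra h'
  exact h (support_fderiv_subset ℝ h')

lemma zero_off {N : ℕ} {f : EuclideanSpace ℝ (Fin N) → ℝ}
    {y : EuclideanSpace ℝ (Fin N)} (h : y ∉ tsupport f) : f y = 0 :=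
  image_eq_zero_of_notMem_tsupport h

/-- Euler-type divergence identity. -/
lemma div_identity {N : ℕ} (x : EuclideanSpace ℝ (Fin N))
    {G : EuclideanSpace ℝ (Fin N) → ℝ} (hG : ContDiff ℝ 1 G) (hc : HasCompactSupport G) :
    ∫ y, fderiv ℝ G y (y - x) = - (N : ℝ) * ∫ y, G y := by
  have hfc : Continuous (fderiv ℝ G) := hG.continuous_fderiv one_ne_zero
  have key : ∀ i : Fin N, ∫ y, (y i - x i) * fderiv ℝ G y (EuclideanSpace.single i 1)
      = - ∫ y, G y := by
    intro i
    have hd : ∀ y, HasFDerivAt (fun y : EuclideanSpace ℝ (Fin N) => y i - x i)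
        (EuclideanSpace.proj (𝕜 := ℝ) i) y := fun y =>
      ((EuclideanSpace.proj (𝕜 := ℝ) i : EuclideanSpace ℝ (Fin N) →L[ℝ] ℝ).hasFDerivAt).sub_const _
    have h := integral_mul_fderiv_eq_neg_fderiv_mul_of_integrable (μ := volume)
      (f := fun y : EuclideanSpace ℝ (Fin N) => y i - x i) (g := G)
      (v := EuclideanSpace.single i 1) ?_ ?_ ?_ (fun y _ => (hd y).differentiableAt)
      (fun y _ => hG.differentiable one_ne_zero y)
    · rw [h]
      congr 1
      refine integral_congr_ae (Filter.Eventually.of_forall fun y => ?_)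
      simp only [(hd y).fderiv]
      simp
    · refine int_of_cc (f := G) ?_ hc ?_
      · have : ∀ y, fderiv ℝ (fun y : EuclideanSpace ℝ (Fin N) => y i - x i) y
          = EuclideanSpace.proj (𝕜 := ℝ) i := fun y => (hd y).fderiv
        simp only [this]
        exact continuous_const.mul hG.continuous
      · intro y hy; simp [zero_off hy]
    · refine int_of_cc (f := G) ?_ hc ?_
      · fun_prop
      · intro y hy; simp [fderiv_zero_off hy]
    · refine int_of_cc (f := G) ?_ hc ?_
      · have := hG.continuous
        fun_prop
      · intro y hy; simp [zero_off hy]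
  have hsum : ∀ y, fderiv ℝ G y (y - x)
      = ∑ i : Fin N, (y i - x i) * fderiv ℝ G y (EuclideanSpace.single i 1) := by
    intro y
    have : y - x = ∑ i : Fin N, (y i - x i) • EuclideanSpace.single i (1 : ℝ) := by
      ext j
      simp [Finset.sum_apply, Pi.single_apply]
    conv_lhs => rw [this]
    simp only [map_sum, map_smul, smul_eq_mul]
  simp only [hsum]
  rw [integral_finsetSum]
  · simp [key]
  · intro i _
    refine int_of_cc (f := G) ?_ hc ?_
    · fun_prop
    · intro y hy; simp [fderiv_zero_off hy]

/-- Weighted Hardy–Poincaré inequality, regularised weight. -/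
lemma hardy_poincare {N : ℕ} {ε s : ℝ} (hε : 0 < ε) (hs : s ≤ 0) (hNs : 0 < N + s)
    (x : EuclideanSpace ℝ (Fin N)) {f : EuclideanSpace ℝ (Fin N) → ℝ}
    (hf : ContDiff ℝ 1 f) (hc : HasCompactSupport f)
    (hx : ∀ y ∈ tsupport f, 0 ≤ inner ℝ y x) :
    (N + s) ^ 2 * ∫ y, mw ε s y * f y ^ 2 ≤
      4 * ∫ y, mw ε s y * ‖y - x‖ ^ 2 * ‖fderiv ℝ f y‖ ^ 2 := by
  have hwc : ∀ s, Continuous (mw (N := N) ε s) := fun s => (mw_contDiff hε s).continuous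
  have hfc := hf.continuous
  have hfdc : Continuous (fderiv ℝ f) := hf.continuous_fderiv one_ne_zero
  set G : EuclideanSpace ℝ (Fin N) → ℝ := fun y => mw ε s y * f y ^ 2 with hGdef
  have hG : ContDiff ℝ 1 G := (mw_contDiff hε s).mul (hf.pow 2)
  have hGc : HasCompactSupport G := HasCompactSupport.intro hc (fun y hy => by
    simp [hGdef, zero_off hy])
  have hGi : Integrable G := hG.continuous.integrable_of_hasCompactSupport hGc
  have hD : Integrable (fun y => mw ε s y * ‖y - x‖ ^ 2 * ‖fderiv ℝ f y‖ ^ 2) := by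
    refine int_of_cc (f := f) ?_ hc ?_
    · have := hwc s
      fun_prop
    · intro y hy; simp [fderiv_zero_off hy]
  have hGd : Integrable (fun y => fderiv ℝ G y (y - x)) := by
    have : Continuous (fderiv ℝ G) := hG.continuous_fderiv one_ne_zero
    refine int_of_cc (f := G) ?_ hGc ?_
    · fun_prop
    · intro y hy; simp [fderiv_zero_off hy]
  have hid := div_identity x hG hGc
  -- pointwise
  have hpt : ∀ y, (N + s) / 2 * G y ≤ N * G y + fderiv ℝ G y (y - x)
      + 2 / (N + s) * (mw ε s y * ‖y - x‖ ^ 2 * ‖fderiv ℝ f y‖ ^ 2) := by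
    intro y
    by_cases hy : y ∈ tsupport f
    swap
    · have h1 : y ∉ tsupport G := fun h => hy (by
        refine closure_mono ?_ h
        intro z hz hz'
        exact hz (by simp [hGdef, hz']))
      simp [fderiv_zero_off h1, zero_off h1, fderiv_zero_off hy]
    have hder : fderiv ℝ G y (y - x) = s * mw ε (s - 2) y * inner ℝ y (y - x) * f y ^ 2
        + mw ε s y * (2 * f y * fderiv ℝ f y (y - x)) := by
      have h1 := (mw_hasFDerivAt hε s y).mul
        (((hf.differentiable one_ne_zero y).hasFDerivAt).pow 2)
      have h2 : fderiv ℝ G y = _ := h1.fderiv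
      rw [h2]
      simp
      ring
    rw [hder]
    have hk := mw_pos hε s y
    have hk2 := mw_pos hε (s - 2) y
    have e1 : mw ε s y = mw ε (s - 2) y * (‖y‖ ^ 2 + ε) := by
      rw [← mw_two, ← mw_add hε]; congr 1; ring
    have e2 : inner ℝ y (y - x) ≤ ‖y‖ ^ 2 + ε := by
      rw [inner_sub_right, real_inner_self_eq_norm_sq]
      have := hx y hy
      linarith
    have e3 : s * mw ε s y ≤ s * mw ε (s - 2) y * inner ℝ y (y - x) := by
      rw [e1]
      have := mul_le_mul_of_nonneg_left e2 hk2.le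
      nlinarith
    have e4 : s * mw ε s y * f y ^ 2 ≤ s * mw ε (s - 2) y * inner ℝ y (y - x) * f y ^ 2 :=
      mul_le_mul_of_nonneg_right e3 (sq_nonneg _)
    have e5 : |fderiv ℝ f y (y - x)| ≤ ‖fderiv ℝ f y‖ * ‖y - x‖ :=
      (fderiv ℝ f y).le_opNorm _
    set c : ℝ := N + s with hcdef
    set A := fderiv ℝ f y (y - x)
    have e6 : A ^ 2 ≤ ‖y - x‖ ^ 2 * ‖fderiv ℝ f y‖ ^ 2 := by
      have := pow_le_pow_left₀ (abs_nonneg _) e5 2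
      rw [sq_abs] at this
      nlinarith
    have e7 : 0 ≤ c / 2 * f y ^ 2 + 2 * f y * A + 2 / c * A ^ 2 := by
      have : c / 2 * f y ^ 2 + 2 * f y * A + 2 / c * A ^ 2 = (c * f y + 2 * A) ^ 2 / (2 * c) := by
        field_simp; ring
      rw [this]; positivity
    have e8 : 2 / c * A ^ 2 ≤ 2 / c * (‖y - x‖ ^ 2 * ‖fderiv ℝ f y‖ ^ 2) :=
      mul_le_mul_of_nonneg_left e6 (by positivity)
    have e9 := mul_nonneg hk.le (e7.trans (add_le_add_right e8 _))
    have : G y = mw ε s y * f y ^ 2 := rfl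
    rw [this]
    have hN : (N : ℝ) = c - s := by rw [hcdef]; ring
    rw [hN]
    nlinarith
  have hGG : Integrable (fun y => N * G y + fderiv ℝ G y (y - x)) :=
    (hGi.const_mul (N : ℝ)).add hGd
  have hmono := integral_mono (hGi.const_mul ((N + s) / 2))
    (hGG.add (hD.const_mul (2 / (N + s)))) hpt
  simp only [Pi.add_apply] at hmono
  rw [integral_add hGG (hD.const_mul _),
    integral_add (hGi.const_mul (N : ℝ)) hGd, integral_const_mul, integral_const_mul,
    integral_const_mul, hid] at hmono
  have h3 : (N + s) / 2 * ∫ y, G y ≤ 2 / (N + s) *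
      ∫ y, mw ε s y * ‖y - x‖ ^ 2 * ‖fderiv ℝ f y‖ ^ 2 := by linarith
  have h4 := mul_le_mul_of_nonneg_left h3 (show 0 ≤ 2 * (N + s) by positivity)
  calc _ = 2 * (N + s) * ((N + s) / 2 * ∫ y, G y) := by ring
    _ ≤ _ := h4
    _ = _ := by field_simp; ring

lemma sobolev_real {N : ℕ} (hN : 3 ≤ N) : ∃ C : ℝ, 0 < C ∧
    ∀ g : EuclideanSpace ℝ (Fin N) → ℝ, ContDiff ℝ 1 g → HasCompactSupport g →
      (∫ y, |g y| ^ (2 * N / (N - 2) : ℝ)) ^ ((N - 2) / N : ℝ) ≤ C * ∫ y, ‖fderiv ℝ g y‖ ^ 2 := by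
  have hN3 : (3 : ℝ) ≤ N := by exact_mod_cast hN
  set p : ℝ := 2 * N / (N - 2) with hp
  have hp0 : 0 < p := by apply div_pos <;> linarith
  set K := eLpNormLESNormFDerivOfEqInnerConst (volume : Measure (EuclideanSpace ℝ (Fin N)))
    ((2 : NNReal) : ℝ) with hK
  refine ⟨(K : ℝ) ^ 2 + 1, by positivity, fun g hg hgc => ?_⟩
  have hgd : Continuous (fderiv ℝ g) := hg.continuous_fderiv one_ne_zero
  obtain ⟨q, hq⟩ : ∃ q : NNReal, (q : ℝ) = p := ⟨⟨p, hp0.le⟩, rfl⟩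
  have h := eLpNorm_le_eLpNorm_fderiv_of_eq_inner (volume : Measure (EuclideanSpace ℝ (Fin N)))
    hg hgc (p := 2) (p' := q) (by norm_num) (by simp; omega) (by
      have : (N : ℝ) - 2 ≠ 0 := by linarith
      rw [hq, hp]
      simp only [finrank_euclideanSpace, Fintype.card_fin]
      push_cast
      field_simp)
  have m1 : MemLp g (q : ENNReal) volume :=
    hg.continuous.memLp_of_hasCompactSupport hgc
  have m2 : MemLp (fderiv ℝ g) ((2 : NNReal) : ENNReal) volume :=
    hgd.memLp_of_hasCompactSupport (hgc.fderiv ℝ)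
  have hpn : q ≠ 0 := by
    intro h; rw [h] at hq; simp at hq; linarith
  rw [m1.eLpNorm_eq_integral_rpow_norm (by exact_mod_cast hpn) (by simp),
    m2.eLpNorm_eq_integral_rpow_norm (by simp) (by simp)] at h
  simp only [ENNReal.coe_toReal, hq, Real.norm_eq_abs] at h
  rw [← hK] at h
  simp only [NNReal.coe_ofNat, Real.rpow_two] at h
  have i1 : 0 ≤ ∫ y, |g y| ^ p := integral_nonneg fun y => by positivity
  have i2 : 0 ≤ ∫ y, ‖fderiv ℝ g y‖ ^ 2 := integral_nonneg fun y => by positivity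
  rw [← ENNReal.ofReal_coe_nnreal, ← ENNReal.ofReal_mul (by positivity),
    ENNReal.ofReal_le_ofReal_iff (by positivity)] at h
  have h2 := pow_le_pow_left₀ (by positivity) h 2
  rw [mul_pow, ← Real.rpow_natCast, ← Real.rpow_mul i1,
    ← Real.rpow_natCast (_ ^ (2 : ℝ)⁻¹), ← Real.rpow_mul i2] at h2
  have e1 : p⁻¹ * ((2 : ℕ) : ℝ) = (N - 2) / N := by
    have : (N : ℝ) - 2 ≠ 0 := by linarith
    rw [hp]; push_cast; field_simp
  rw [e1] at h2
  norm_num at h2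
  nlinarith

/-- Weighted Sobolev inequality, regularised weight. -/
lemma weighted_sobolev {N : ℕ} (hN : 3 ≤ N) {lam : ℝ} (hl1 : 2 - (N : ℝ) ≤ lam) (hl2 : lam < 0) :
    ∃ C : ℝ, 0 < C ∧ ∀ ε : ℝ, 0 < ε → ∀ R : ℝ, 0 < R →
    ∀ f : EuclideanSpace ℝ (Fin N) → ℝ, ContDiff ℝ 1 f → HasCompactSupport f →
      (∀ y ∈ tsupport f, ‖y‖ ≤ R) →
      (∫ y, mw ε lam y * |f y| ^ (2 * N / (N - 2) : ℝ)) ^ ((N - 2) / N : ℝ) ≤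
        C * (R ^ 2 + ε) ^ (-lam / N) * ∫ y, mw ε lam y * ‖fderiv ℝ f y‖ ^ 2 := by
  obtain ⟨C, hC, hS⟩ := sobolev_real hN
  have hN3 : (3 : ℝ) ≤ N := by exact_mod_cast hN
  have hN2 : (N : ℝ) - 2 ≠ 0 := by linarith
  set p : ℝ := 2 * N / (N - 2) with hp
  have hp0 : 0 < p := by apply div_pos <;> linarith
  set t : ℝ := lam / p with ht
  have ht0 : t ≤ 0 := div_nonpos_of_nonpos_of_nonneg hl2.le hp0.le
  have htN : 2 * t = lam - 2 * lam / N := by rw [ht, hp]; field_simp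
  set c : ℝ := N + (2 * t - 2) with hc
  have hc0 : 0 < c := by
    have h1 : 2 * lam / N < 0 := div_neg_of_neg_of_pos (by linarith) (by linarith)
    rw [hc, htN]; linarith
  refine ⟨2 * C * (1 + t ^ 2 * (4 / c ^ 2)), by positivity, fun ε hε R hR f hf hfc hfR => ?_⟩
  have hwc : ∀ s, Continuous (mw (N := N) ε s) := fun s => (mw_contDiff hε s).continuous
  have hfcont := hf.continuous
  have hfdc : Continuous (fderiv ℝ f) := hf.continuous_fderiv one_ne_zero
  set g : EuclideanSpace ℝ (Fin N) → ℝ := fun y => mw ε t y * f y with hgdef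
  have hg : ContDiff ℝ 1 g := (mw_contDiff hε t).mul hf
  have hgc : HasCompactSupport g := hfc.mul_left
  have h1 := hS g hg hgc
  have e1 : ∀ y, |g y| ^ p = mw ε lam y * |f y| ^ p := by
    intro y
    have hk := mw_pos hε t y
    rw [hgdef]; simp only
    rw [abs_mul, abs_of_pos hk, Real.mul_rpow hk.le (abs_nonneg _), mw_rpow hε]
    congr 2; rw [ht]; field_simp
  simp only [e1] at h1
  have hk2 : ∀ y, mw (N := N) ε (2 * t) y = mw ε t y ^ 2 := by
    intro y; rw [two_mul, mw_add hε]; ring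
  have I1 : Integrable (fun y => mw ε (2 * t) y * ‖fderiv ℝ f y‖ ^ 2) := by
    refine int_of_cc (f := f) ?_ hfc ?_
    · have := hwc (2 * t)
      fun_prop
    · intro y hy; simp [fderiv_zero_off hy]
  have I1' : Integrable (fun y => mw ε lam y * ‖fderiv ℝ f y‖ ^ 2) := by
    refine int_of_cc (f := f) ?_ hfc ?_
    · have := hwc lam
      fun_prop
    · intro y hy; simp [fderiv_zero_off hy]
  have I2 : Integrable (fun y => mw ε (2 * t - 2) y * f y ^ 2) := by
    refine int_of_cc (f := f) ?_ hfc ?_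
    · have := hwc (2 * t - 2)
      fun_prop
    · intro y hy; simp [zero_off hy]
  have I3 : Integrable (fun y => ‖fderiv ℝ g y‖ ^ 2) := by
    have : Continuous (fderiv ℝ g) := hg.continuous_fderiv one_ne_zero
    refine int_of_cc (f := g) ?_ hgc ?_
    · fun_prop
    · intro y hy; simp [fderiv_zero_off hy]
  have I4 : Integrable (fun y => mw ε (2 * t - 2) y * ‖y - 0‖ ^ 2 * ‖fderiv ℝ f y‖ ^ 2) := by
    refine int_of_cc (f := f) ?_ hfc ?_
    · have := hwc (2 * t - 2)
      fun_prop
    · intro y hy; simp [fderiv_zero_off hy]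
  have hpt : ∀ y, ‖fderiv ℝ g y‖ ^ 2 ≤ 2 * (mw ε (2 * t) y * ‖fderiv ℝ f y‖ ^ 2)
      + 2 * t ^ 2 * (mw ε (2 * t - 2) y * f y ^ 2) := by
    intro y
    have h2 := (mw_hasFDerivAt hε t y).mul (hf.differentiable one_ne_zero y).hasFDerivAt
    have h3 : fderiv ℝ g y = _ := h2.fderiv
    have hk := mw_pos hε t y
    have hk' := mw_pos hε (t - 2) y
    set a := mw ε t y * ‖fderiv ℝ f y‖ with ha
    set b := |t| * mw ε (t - 2) y * ‖y‖ * |f y| with hb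
    have h4 : ‖fderiv ℝ g y‖ ≤ a + b := by
      rw [h3]
      refine (norm_add_le _ _).trans (le_of_eq ?_)
      rw [norm_smul, norm_smul, norm_smul, innerSL_apply_norm]
      simp only [Real.norm_eq_abs, abs_mul, abs_of_pos hk, abs_of_pos hk']
      rw [ha, hb]; ring
    have h5 : ‖fderiv ℝ g y‖ ^ 2 ≤ 2 * a ^ 2 + 2 * b ^ 2 := by
      have := pow_le_pow_left₀ (norm_nonneg _) h4 2
      nlinarith [sq_nonneg (a - b)]
    have h6 : a ^ 2 = mw ε (2 * t) y * ‖fderiv ℝ f y‖ ^ 2 := by rw [ha, hk2]; ring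
    have h7 : b ^ 2 ≤ t ^ 2 * (mw ε (2 * t - 2) y * f y ^ 2) := by
      have e : b ^ 2 = t ^ 2 * f y ^ 2 * (mw ε (t - 2) y ^ 2 * ‖y‖ ^ 2) := by
        rw [hb, mul_pow, mul_pow, mul_pow, sq_abs, sq_abs]; ring
      have e' : mw ε (2 * t - 2) y = mw ε (t - 2) y ^ 2 * (‖y‖ ^ 2 + ε) := by
        rw [← mw_two, sq, ← mw_add hε, ← mw_add hε]; congr 1; ring
      rw [e, e']
      have : mw ε (t - 2) y ^ 2 * ‖y‖ ^ 2 ≤ mw ε (t - 2) y ^ 2 * (‖y‖ ^ 2 + ε) := by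
        gcongr; linarith
      calc _ ≤ t ^ 2 * f y ^ 2 * (mw ε (t - 2) y ^ 2 * (‖y‖ ^ 2 + ε)) := by gcongr
        _ = _ := by ring
    linarith
  have h8 := integral_mono I3 ((I1.const_mul 2).add (I2.const_mul (2 * t ^ 2))) hpt
  simp only [Pi.add_apply] at h8
  rw [integral_add (I1.const_mul 2) (I2.const_mul _), integral_const_mul,
    integral_const_mul] at h8
  have hh := hardy_poincare hε (s := 2 * t - 2) (by linarith) hc0 0 hf hfc (by simp)
  rw [← hc] at hh
  have h9 : ∫ y, mw ε (2 * t - 2) y * ‖y - 0‖ ^ 2 * ‖fderiv ℝ f y‖ ^ 2 ≤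
      ∫ y, mw ε (2 * t) y * ‖fderiv ℝ f y‖ ^ 2 := by
    refine integral_mono I4 I1 fun y => ?_
    have e' : mw ε (2 * t) y = mw ε (2 * t - 2) y * (‖y‖ ^ 2 + ε) := by
      rw [← mw_two, ← mw_add hε]; congr 1; ring
    have := mw_pos hε (2 * t - 2) y
    simp only [sub_zero]
    rw [e']
    gcongr; linarith
  have h10 : ∫ y, mw ε (2 * t - 2) y * f y ^ 2 ≤
      4 / c ^ 2 * ∫ y, mw ε (2 * t) y * ‖fderiv ℝ f y‖ ^ 2 := by
    rw [div_mul_eq_mul_div, le_div_iff₀ (by positivity)]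
    linarith
  have h11 : ∫ y, mw ε (2 * t) y * ‖fderiv ℝ f y‖ ^ 2 ≤
      (R ^ 2 + ε) ^ (-lam / N) * ∫ y, mw ε lam y * ‖fderiv ℝ f y‖ ^ 2 := by
    rw [← integral_const_mul]
    refine integral_mono I1 (I1'.const_mul _) fun y => ?_
    by_cases hy : y ∈ tsupport f
    swap
    · simp [fderiv_zero_off hy]
    have e : mw ε (2 * t) y = mw ε (-2 * lam / N) y * mw ε lam y := by
      rw [← mw_add hε, htN]; congr 1; ring
    have e2 : mw ε (-2 * lam / N) y ≤ (R ^ 2 + ε) ^ (-lam / N) := by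
      unfold mw
      rw [show -2 * lam / N / 2 = -lam / N by ring]
      have := hfR y hy
      have : 0 ≤ -lam / N := div_nonneg (by linarith) (by linarith)
      gcongr
    simp only
    rw [e, mul_assoc]
    have := mw_pos hε lam y
    gcongr
  calc _ ≤ C * ∫ y, ‖fderiv ℝ g y‖ ^ 2 := h1
    _ ≤ C * (2 * (∫ y, mw ε (2 * t) y * ‖fderiv ℝ f y‖ ^ 2) + 2 * t ^ 2 *
        (4 / c ^ 2 * ∫ y, mw ε (2 * t) y * ‖fderiv ℝ f y‖ ^ 2)) := by
        refine mul_le_mul_of_nonneg_left (h8.trans ?_) hC.le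
        gcongr
    _ = 2 * C * (1 + t ^ 2 * (4 / c ^ 2)) * ∫ y, mw ε (2 * t) y * ‖fderiv ℝ f y‖ ^ 2 := by ring
    _ ≤ 2 * C * (1 + t ^ 2 * (4 / c ^ 2)) * ((R ^ 2 + ε) ^ (-lam / N) *
        ∫ y, mw ε lam y * ‖fderiv ℝ f y‖ ^ 2) := by gcongr
    _ = _ := by ring

/-- Local Poincaré inequality, regularised weight. -/
lemma weighted_poincare {N : ℕ} {lam : ℝ} (hl1 : 2 - (N : ℝ) ≤ lam)
    (hl2 : lam < 0) {ε : ℝ} (hε : 0 < ε) {x : EuclideanSpace ℝ (Fin N)} {r : ℝ} (hr : 0 < r)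
    {f : EuclideanSpace ℝ (Fin N) → ℝ} (hf : ContDiff ℝ 1 f) (hfc : HasCompactSupport f)
    (hfs : tsupport f ⊆ Metric.ball x r) :
    ∫ y, mw ε lam y * f y ^ 2 ≤ 4 * r ^ 2 * ∫ y, mw ε lam y * ‖fderiv ℝ f y‖ ^ 2 := by
  have hwc : Continuous (mw (N := N) ε lam) := (mw_contDiff hε lam).continuous
  have hfdc : Continuous (fderiv ℝ f) := hf.continuous_fderiv one_ne_zero
  have hex : ∃ z : EuclideanSpace ℝ (Fin N), (∀ y ∈ tsupport f, 0 ≤ inner ℝ y z) ∧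
      ∀ y ∈ tsupport f, ‖y - z‖ ≤ 2 * r := by
    have hb : ∀ y ∈ tsupport f, ‖y - x‖ < r := fun y hy => by
      have := hfs hy
      rwa [mem_ball_iff_norm] at this
    rcases le_or_gt r ‖x‖ with h | h
    · refine ⟨x, fun y hy => ?_, fun y hy => by linarith [hb y hy]⟩
      have e : inner ℝ y x = inner ℝ (y - x) x + ‖x‖ ^ 2 := by
        rw [inner_sub_left, real_inner_self_eq_norm_sq]; ring
      have e2 := abs_le.1 (abs_real_inner_le_norm (y - x) x)
      have e3 := hb y hy
      rw [e]
      nlinarith [e2.1, norm_nonneg x]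
    · refine ⟨0, by simp, fun y hy => ?_⟩
      have := norm_add_le (y - x) x
      simp only [sub_add_cancel] at this
      simp only [sub_zero]
      linarith [hb y hy]
  obtain ⟨z, hz1, hz2⟩ := hex
  have h := hardy_poincare hε hl2.le (by linarith) z hf hfc hz1
  have h2 : ∫ y, mw ε lam y * ‖y - z‖ ^ 2 * ‖fderiv ℝ f y‖ ^ 2 ≤
      (4 * r ^ 2) * ∫ y, mw ε lam y * ‖fderiv ℝ f y‖ ^ 2 := by
    rw [← integral_const_mul]
    refine integral_mono ?_ (Integrable.const_mul ?_ _) fun y => ?_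
    · refine int_of_cc (f := f) (by fun_prop) hfc ?_
      intro y hy; simp [fderiv_zero_off hy]
    · refine int_of_cc (f := f) (by fun_prop) hfc ?_
      intro y hy; simp [fderiv_zero_off hy]
    by_cases hy : y ∈ tsupport f
    swap
    · simp [fderiv_zero_off hy]
    have e := pow_le_pow_left₀ (norm_nonneg _) (hz2 y hy) 2
    have := mw_pos hε lam y
    calc _ ≤ mw ε lam y * (2 * r) ^ 2 * ‖fderiv ℝ f y‖ ^ 2 := by gcongr
      _ = _ := by ring
  have h3 : 0 ≤ ∫ y, mw ε lam y * f y ^ 2 :=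
    integral_nonneg fun y => mul_nonneg (mw_pos hε _ _).le (sq_nonneg _)
  have h4 : (4 : ℝ) ≤ (N + lam) ^ 2 := by nlinarith
  nlinarith

/-- Moser inequality with regularised weight. -/
lemma reg_moser {N : ℕ} (hN : 3 ≤ N) {lam : ℝ} (hl1 : 2 - (N : ℝ) ≤ lam) (hl2 : lam < 0) :
    ∃ C : ℝ, 0 < C ∧ ∀ ε : ℝ, 0 < ε → ∀ ν : ℝ, (N : ℝ) ≤ ν →
    ∀ (x : EuclideanSpace ℝ (Fin N)) (r : ℝ), 0 < r →
    ∀ f : EuclideanSpace ℝ (Fin N) → ℝ, ContDiff ℝ 1 f → HasCompactSupport f →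
      tsupport f ⊆ Metric.ball x r →
      ∫ y, mw ε lam y * |f y| ^ (2 * (1 + 2 / ν)) ≤
        C * r ^ 2 * (r ^ (N : ℝ) * ((‖x‖ + r) ^ 2 + ε) ^ (lam / 2)) ^ (-2 / ν) *
          (∫ y, mw ε lam y * ‖fderiv ℝ f y‖ ^ 2) *
          (∫ y, mw ε lam y * f y ^ 2) ^ (2 / ν) := by
  obtain ⟨C, hC, hS⟩ := weighted_sobolev hN hl1 hl2
  have hN3 : (3 : ℝ) ≤ N := by exact_mod_cast hN
  have hN2 : (N : ℝ) - 2 ≠ 0 := by linarith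
  refine ⟨max 4 C, by positivity, fun ε hε ν hν x r hr f hf hfc hfs => ?_⟩
  have hν0 : 0 < ν := by linarith
  set R := ‖x‖ + r with hR
  have hR0 : 0 < R := by positivity
  have hfR : ∀ y ∈ tsupport f, ‖y‖ ≤ R := by
    intro y hy
    have h1 := hfs hy
    rw [mem_ball_iff_norm] at h1
    have := norm_add_le (y - x) x
    simp only [sub_add_cancel] at this
    linarith
  have hS' := hS ε hε R hR0 f hf hfc hfR
  have hP := weighted_poincare hl1 hl2 hε hr hf hfc hfs
  set p : ℝ := 2 * N / (N - 2) with hp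
  have hp0 : 0 < p := by apply div_pos <;> linarith
  set A := ∫ y, mw ε lam y * f y ^ 2 with hA
  set D := ∫ y, mw ε lam y * ‖fderiv ℝ f y‖ ^ 2 with hD
  set Q := ∫ y, mw ε lam y * |f y| ^ p with hQ
  have hA0 : 0 ≤ A := integral_nonneg fun y => mul_nonneg (mw_pos hε _ _).le (sq_nonneg _)
  have hD0 : 0 ≤ D := integral_nonneg fun y => mul_nonneg (mw_pos hε _ _).le (sq_nonneg _)
  have hQ0 : 0 ≤ Q := integral_nonneg fun y => mul_nonneg (mw_pos hε _ _).le (by positivity)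
  set b : ℝ := (N - 2) / ν with hb
  set a : ℝ := 1 - b with ha
  have hb0 : 0 < b := div_pos (by linarith) hν0
  have hb1 : b < 1 := by rw [hb, div_lt_one hν0]; linarith
  have ha0 : 0 < a := by linarith
  have haeq : a = (1 - N / ν) + 2 / ν := by rw [ha, hb]; ring
  have hθ1 : 0 ≤ 1 - N / ν := by
    rw [sub_nonneg, div_le_one hν0]; exact hν
  have hθ0 : 0 ≤ N / ν := by positivity
  have hfcont := hf.continuous
  -- Hölder
  have holder : ∫ y, mw ε lam y * |f y| ^ (2 * (1 + 2 / ν)) ≤ A ^ a * Q ^ b := by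
    have hwc : ∀ s, Continuous (mw (N := N) ε s) := fun s => (mw_contDiff hε s).continuous
    set F : EuclideanSpace ℝ (Fin N) → ℝ := fun y => mw ε (lam * a) y * |f y| ^ (2 * a) with hF
    set G : EuclideanSpace ℝ (Fin N) → ℝ := fun y => mw ε (lam * b) y * |f y| ^ (p * b) with hG
    have hFc : Continuous F := (hwc _).mul
      (hfcont.abs.rpow_const fun y => Or.inr (by positivity))
    have hGc : Continuous G := (hwc _).mul
      (hfcont.abs.rpow_const fun y => Or.inr (by positivity))
    have hFs : HasCompactSupport F := HasCompactSupport.intro hfc fun y hy => by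
      simp only [hF, zero_off hy, abs_zero]
      rw [Real.zero_rpow (by positivity), mul_zero]
    have hGs : HasCompactSupport G := HasCompactSupport.intro hfc fun y hy => by
      simp only [hG, zero_off hy, abs_zero]
      rw [Real.zero_rpow (by positivity), mul_zero]
    have hpq : (1 / a).HolderConjugate (1 / b) := by
      rw [Real.holderConjugate_iff]
      refine ⟨?_, ?_⟩
      · rw [lt_div_iff₀ ha0]; linarith
      · simp [ha]
    have h := integral_mul_le_Lp_mul_Lq_of_nonneg (μ := volume) hpq (f := F) (g := G)
      (Filter.Eventually.of_forall fun y => mul_nonneg (mw_pos hε _ _).le (by positivity))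
      (Filter.Eventually.of_forall fun y => mul_nonneg (mw_pos hε _ _).le (by positivity))
      (hFc.memLp_of_hasCompactSupport hFs) (hGc.memLp_of_hasCompactSupport hGs)
    simp only [one_div_one_div] at h
    have e1 : ∀ y, F y * G y = mw ε lam y * |f y| ^ (2 * (1 + 2 / ν)) := by
      intro y
      have h1 : mw ε lam y = mw ε (lam * a) y * mw ε (lam * b) y := by
        rw [← mw_add hε]; congr 1; rw [ha]; ring
      have h2 : |f y| ^ (2 * (1 + 2 / ν)) = |f y| ^ (2 * a) * |f y| ^ (p * b) := by
        rw [← Real.rpow_add_of_nonneg (abs_nonneg _) (by positivity) (by positivity)]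
        congr 1; rw [ha, hb, hp]; field_simp; ring
      rw [h1, h2]; simp only [hF, hG]; ring
    have e2 : ∀ y, F y ^ (1 / a) = mw ε lam y * f y ^ 2 := by
      intro y
      simp only [hF]
      rw [Real.mul_rpow (mw_pos hε _ _).le (by positivity), mw_rpow hε,
        ← Real.rpow_mul (abs_nonneg _)]
      rw [show lam * a * (1 / a) = lam by field_simp, show 2 * a * (1 / a) = 2 by field_simp,
        Real.rpow_two, sq_abs]
    have e3 : ∀ y, G y ^ (1 / b) = mw ε lam y * |f y| ^ p := by
      intro y
      simp only [hG]
      rw [Real.mul_rpow (mw_pos hε _ _).le (by positivity), mw_rpow hε,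
        ← Real.rpow_mul (abs_nonneg _)]
      rw [mul_assoc, mul_one_div_cancel hb0.ne', mul_one, mul_assoc,
        mul_one_div_cancel hb0.ne', mul_one]
    simp only [e1, e2, e3] at h
    exact h
  have hQb : Q ^ b = (Q ^ (((N : ℝ) - 2) / N)) ^ (N / ν) := by
    rw [← Real.rpow_mul hQ0]; congr 1; rw [hb]; field_simp
  set S := (R ^ 2 + ε) with hSdef
  have hS0 : 0 < S := by positivity
  set M := max 4 C with hM
  have hM0 : 0 < M := by positivity
  have k1 : A ^ (1 - N / ν) ≤ (M * r ^ 2 * D) ^ (1 - N / ν) := by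
    refine Real.rpow_le_rpow hA0 (hP.trans ?_) hθ1
    have : (4 : ℝ) ≤ M := le_max_left _ _
    gcongr
  have k2 : Q ^ b ≤ (M * S ^ (-lam / N) * D) ^ (N / ν) := by
    rw [hQb]
    refine Real.rpow_le_rpow (by positivity) (hS'.trans ?_) hθ0
    have : C ≤ M := le_max_right _ _
    gcongr
  have k3 : M ^ (1 - N / ν) * M ^ (N / ν) = M := by
    rw [← Real.rpow_add hM0]; simp
  have k4 : D ^ (1 - N / ν) * D ^ (N / ν) = D := by
    rw [← Real.rpow_add_of_nonneg hD0 hθ1 hθ0]; simp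
  have k5 : (r ^ 2) ^ (1 - N / ν) * (S ^ (-lam / N)) ^ (N / ν) =
      r ^ 2 * (r ^ (N : ℝ) * S ^ (lam / 2)) ^ (-2 / ν) := by
    rw [Real.mul_rpow (by positivity) (by positivity), ← Real.rpow_mul hr.le,
      ← Real.rpow_mul hS0.le, ← Real.rpow_mul hS0.le, ← Real.rpow_two, ← Real.rpow_mul hr.le,
      ← mul_assoc, ← Real.rpow_add hr]
    congr 2
    · ring
    · field_simp
  calc _ ≤ A ^ a * Q ^ b := holder
    _ = A ^ (1 - N / ν) * Q ^ b * A ^ (2 / ν) := by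
        rw [haeq, Real.rpow_add_of_nonneg hA0 hθ1 (by positivity)]; ring
    _ ≤ (M * r ^ 2 * D) ^ (1 - N / ν) * (M * S ^ (-lam / N) * D) ^ (N / ν) * A ^ (2 / ν) := by
        gcongr
    _ = (M ^ (1 - N / ν) * M ^ (N / ν)) * ((r ^ 2) ^ (1 - N / ν) * (S ^ (-lam / N)) ^ (N / ν))
          * (D ^ (1 - N / ν) * D ^ (N / ν)) * A ^ (2 / ν) := by
        rw [Real.mul_rpow (by positivity) hD0, Real.mul_rpow (by positivity) hD0,
          Real.mul_rpow (by positivity) (by positivity),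
          Real.mul_rpow (by positivity) (by positivity)]
        ring
    _ = _ := by rw [k3, k4, k5]; ring

lemma weight_int {N : ℕ} (hN : 3 ≤ N) {lam : ℝ} (hl1 : 2 - (N : ℝ) ≤ lam)
    {g : EuclideanSpace ℝ (Fin N) → ℝ} (hg : Continuous g) (hgc : HasCompactSupport g) :
    Integrable (fun y => ‖y‖ ^ lam * g y) := by
  have hN3 : (3 : ℝ) ≤ N := by exact_mod_cast hN
  have : Nontrivial (EuclideanSpace ℝ (Fin N)) := by
    have : NeZero N := ⟨by omega⟩
    infer_instance
  obtain ⟨R, hR⟩ := hgc.isCompact.isBounded.subset_ball 0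
  have h1 : IntegrableOn (fun y : EuclideanSpace ℝ (Fin N) => ‖y‖ ^ lam) (Metric.ball 0 R) := by
    rw [integrableOn_fun_norm_addHaar volume (f := fun t : ℝ => t ^ lam)]
    have h2 : IntegrableOn (fun t : ℝ => t ^ ((N : ℝ) - 1 + lam)) (Set.Ioo 0 R) := by
      rcases le_or_gt R 0 with h | h
      · simp [Set.Ioo_eq_empty_of_le h]
      · rw [intervalIntegral.integrableOn_Ioo_rpow_iff h]; linarith
    refine h2.congr_fun (fun t ht => ?_) measurableSet_Ioo
    simp only [finrank_euclideanSpace, Fintype.card_fin, smul_eq_mul]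
    rw [Real.rpow_add ht.1]
    congr 1
    rw [← Real.rpow_natCast, Nat.cast_sub (by omega)]
    simp
  obtain ⟨B, hB⟩ := hgc.exists_bound_of_continuous hg
  have h3 : IntegrableOn (fun y => ‖y‖ ^ lam * g y) (Metric.ball 0 R) :=
    Integrable.mul_bdd h1 hg.aestronglyMeasurable (Filter.Eventually.of_forall hB)
  rw [integrableOn_iff_integrable_of_support_subset] at h3
  · exact h3
  · intro y hy
    refine hR (subset_tsupport _ ?_)
    intro h
    exact hy (by simp [h])

lemma mw_le {N : ℕ} {lam ε : ℝ} (hl2 : lam < 0) (hε : 0 < ε)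
    {y : EuclideanSpace ℝ (Fin N)} (hy : y ≠ 0) : mw ε lam y ≤ ‖y‖ ^ lam := by
  have h0 : 0 < ‖y‖ := norm_pos_iff.2 hy
  have : ‖y‖ ^ lam = (‖y‖ ^ 2) ^ (lam / 2) := by
    rw [← Real.rpow_two, ← Real.rpow_mul h0.le]; congr 1; ring
  rw [this]
  exact Real.rpow_le_rpow_of_nonpos (by positivity) (by linarith) (by linarith)

lemma ae_ne_zero {N : ℕ} (hN : 3 ≤ N) :
    ∀ᵐ y : EuclideanSpace ℝ (Fin N), y ≠ 0 := by
  have : Nontrivial (EuclideanSpace ℝ (Fin N)) := by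
    have : NeZero N := ⟨by omega⟩
    infer_instance
  exact Measure.ae_ne volume 0

/-- Local weighted Moser inequality with weight `|y|^λ`. -/
theorem local_weighted_moser
    (N : ℕ) (hN : 3 ≤ N) (lam : ℝ) (hlam₁ : 2 - (N : ℝ) ≤ lam) (hlam₂ : lam < 0)
    (Ω : Set (EuclideanSpace ℝ (Fin N))) (hΩo : IsOpen Ω) (hΩconn : IsConnected Ω)
    (hΩb : Bornology.IsBounded Ω) (hΩsm : IsC2Domain Ω)
    (h0 : (0 : EuclideanSpace ℝ (Fin N)) ∈ Ω) :
    ∃ C_M : ℝ, 0 < C_M ∧ ∀ ν : ℝ, (N : ℝ) ≤ ν → ∀ x ∈ Ω, ∀ r : ℝ, 0 < r →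
      ∀ f : EuclideanSpace ℝ (Fin N) → ℝ,
        ContDiff ℝ (⊤ : ℕ∞) f → HasCompactSupport f → tsupport f ⊆ Metric.ball x r →
        (∫ y in Metric.ball x r, ‖y‖ ^ lam * |f y| ^ (2 * (1 + 2 / ν))) ≤
          C_M * r ^ 2 * (r ^ (N : ℝ) * (‖x‖ + r) ^ lam) ^ (-2 / ν) *
            (∫ y in Metric.ball x r, ‖y‖ ^ lam * ‖gradient f y‖ ^ 2) *
            (∫ y in Metric.ball x r, ‖y‖ ^ lam * f y ^ 2) ^ (2 / ν) := by
  obtain ⟨C, hC, hM⟩ := reg_moser hN hlam₁ hlam₂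
  refine ⟨C, hC, fun ν hν x _ r hr f hf' hfc hfs => ?_⟩
  have hN3 : (3 : ℝ) ≤ N := by exact_mod_cast hN
  have hν0 : 0 < ν := by linarith
  have hf : ContDiff ℝ 1 f := hf'.of_le (by exact_mod_cast le_top)
  have hfdc : Continuous (fderiv ℝ f) := hf.continuous_fderiv one_ne_zero
  have hfcont := hf.continuous
  have hq : 0 < 2 * (1 + 2 / ν) := by positivity
  have hgrad : ∀ y, ‖gradient f y‖ = ‖fderiv ℝ f y‖ := fun y => by
    unfold gradient; exact LinearIsometryEquiv.norm_map _ _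
  simp only [hgrad]
  have hoff : ∀ y, y ∉ Metric.ball x r → y ∉ tsupport f := fun y hy h => hy (hfs h)
  rw [setIntegral_eq_integral_of_forall_compl_eq_zero (fun y hy => by
      rw [zero_off (hoff y hy), abs_zero, Real.zero_rpow hq.ne', mul_zero]),
    setIntegral_eq_integral_of_forall_compl_eq_zero (fun y hy => by
      simp [fderiv_zero_off (hoff y hy)]),
    setIntegral_eq_integral_of_forall_compl_eq_zero (fun y hy => by
      simp [zero_off (hoff y hy)])]
  -- the three continuous compactly supported functions
  have c1 : Continuous fun y => |f y| ^ (2 * (1 + 2 / ν)) :=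
    hfcont.abs.rpow_const fun y => Or.inr hq.le
  have s1 : HasCompactSupport fun y => |f y| ^ (2 * (1 + 2 / ν)) :=
    HasCompactSupport.intro hfc fun y hy => by
      rw [zero_off hy, abs_zero, Real.zero_rpow hq.ne']
  have c2 : Continuous fun y => ‖fderiv ℝ f y‖ ^ 2 := by fun_prop
  have s2 : HasCompactSupport fun y => ‖fderiv ℝ f y‖ ^ 2 :=
    HasCompactSupport.intro hfc fun y hy => by simp [fderiv_zero_off hy]
  have c3 : Continuous fun y => f y ^ 2 := by fun_prop
  have s3 : HasCompactSupport fun y => f y ^ 2 :=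
    HasCompactSupport.intro hfc fun y hy => by simp [zero_off hy]
  have J1 := weight_int hN hlam₁ c1 s1
  have J2 := weight_int hN hlam₁ c2 s2
  have J3 := weight_int hN hlam₁ c3 s3
  have hcomp : ∀ ε : ℝ, 0 < ε → ∀ g : EuclideanSpace ℝ (Fin N) → ℝ, Continuous g →
      HasCompactSupport g → (∀ y, 0 ≤ g y) →
      ∫ y, mw ε lam y * g y ≤ ∫ y, ‖y‖ ^ lam * g y := by
    intro ε hε g hg hgc hg0
    refine integral_mono_ae ?_ (weight_int hN hlam₁ hg hgc) ?_
    · exact ((mw_contDiff hε lam).continuous.mul hg).integrable_of_hasCompactSupport hgc.mul_left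
    · filter_upwards [ae_ne_zero hN] with y hy
      exact mul_le_mul_of_nonneg_right (mw_le hlam₂ hε hy) (hg0 y)
  set R := ‖x‖ + r with hR
  have hR0 : 0 < R := by positivity
  set D := ∫ y, ‖y‖ ^ lam * ‖fderiv ℝ f y‖ ^ 2 with hD
  set A := ∫ y, ‖y‖ ^ lam * f y ^ 2 with hA
  have hA0 : 0 ≤ A := integral_nonneg fun y => by positivity
  have hD0 : 0 ≤ D := integral_nonneg fun y => by positivity
  have hbound : ∀ ε : ℝ, 0 < ε → ∫ y, mw ε lam y * |f y| ^ (2 * (1 + 2 / ν)) ≤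
      C * r ^ 2 * (r ^ (N : ℝ) * (R ^ 2 + ε) ^ (lam / 2)) ^ (-2 / ν) * D * A ^ (2 / ν) := by
    intro ε hε
    refine (hM ε hε ν hν x r hr f hf hfc hfs).trans ?_
    have i1 := hcomp ε hε _ c2 s2 (fun y => by positivity)
    have i2 := hcomp ε hε _ c3 s3 (fun y => by positivity)
    have i3 : 0 ≤ ∫ y, mw ε lam y * f y ^ 2 :=
      integral_nonneg fun y => mul_nonneg (mw_pos hε _ _).le (sq_nonneg _)
    gcongr
  have hlim1 : Filter.Tendsto (fun ε : ℝ => ∫ y, mw ε lam y * |f y| ^ (2 * (1 + 2 / ν)))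
      (nhdsWithin 0 (Set.Ioi 0)) (nhds (∫ y, ‖y‖ ^ lam * |f y| ^ (2 * (1 + 2 / ν)))) := by
    refine tendsto_integral_filter_of_dominated_convergence _ ?_ ?_ J1 ?_
    · filter_upwards [self_mem_nhdsWithin] with ε hε
      exact ((mw_contDiff hε lam).continuous.mul c1).aestronglyMeasurable
    · filter_upwards [self_mem_nhdsWithin] with ε hε
      filter_upwards [ae_ne_zero hN] with y hy
      rw [Real.norm_of_nonneg (mul_nonneg (mw_pos hε _ _).le (by positivity))]
      exact mul_le_mul_of_nonneg_right (mw_le hlam₂ hε hy) (by positivity)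
    · filter_upwards [ae_ne_zero hN] with y hy
      have h0 : 0 < ‖y‖ := norm_pos_iff.2 hy
      have e : ‖y‖ ^ lam = (‖y‖ ^ 2 + 0) ^ (lam / 2) := by
        rw [add_zero, ← Real.rpow_two, ← Real.rpow_mul h0.le]; congr 1; ring
      rw [e]
      refine Filter.Tendsto.mul_const _ ?_
      unfold mw
      refine Filter.Tendsto.rpow_const ?_ (Or.inl (by positivity))
      exact (continuous_const.add continuous_id).continuousAt.tendsto.mono_left nhdsWithin_le_nhds
  have hlim2 : Filter.Tendsto (fun ε : ℝ =>
      C * r ^ 2 * (r ^ (N : ℝ) * (R ^ 2 + ε) ^ (lam / 2)) ^ (-2 / ν) * D * A ^ (2 / ν))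
      (nhdsWithin 0 (Set.Ioi 0))
      (nhds (C * r ^ 2 * (r ^ (N : ℝ) * R ^ lam) ^ (-2 / ν) * D * A ^ (2 / ν))) := by
    have e : R ^ lam = (R ^ 2 + 0) ^ (lam / 2) := by
      rw [add_zero, ← Real.rpow_two, ← Real.rpow_mul hR0.le]; congr 1; ring
    rw [e]
    refine Filter.Tendsto.mul_const _ (Filter.Tendsto.mul_const _ (Filter.Tendsto.const_mul _ ?_))
    refine Filter.Tendsto.rpow_const (Filter.Tendsto.const_mul _ ?_) (Or.inl (by positivity))
    refine Filter.Tendsto.rpow_const ?_ (Or.inl (by positivity))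
    exact (continuous_const.add continuous_id).continuousAt.tendsto.mono_left nhdsWithin_le_nhds
  refine le_of_tendsto_of_tendsto hlim1 hlim2 ?_
  filter_upwards [self_mem_nhdsWithin] with ε hε
  exact hbound ε hε
end
end

section
/- Let N ≥ 3 and λ ∈ [2−N, 0). Then there exists a positive constant C_S such that for every x ∈ ℝ^N, every r > 0, and every f ∈ C₀^∞(B(x,r)), one has (∫_{B(x,r)} |y|^λ · |f(y)|^{2N/(N−2)} dy)^{(N−2)/N} ≤ C_S · (|x| + r)^{2|λ|/N} · ∫_{B(x,r)} |y|^λ · |∇f(y)|² dy. -/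
open MeasureTheory Real

noncomputable section

/-- Real-variable form of the Sobolev inequality with `p = 2`. -/
lemma sob_real (N : ℕ) (hN : 3 ≤ N) : ∃ C : ℝ, 0 ≤ C ∧
    ∀ g : EuclideanSpace ℝ (Fin N) → ℝ, ContDiff ℝ 1 g → HasCompactSupport g →
      (∫ y, |g y| ^ (2 * (N : ℝ) / ((N : ℝ) - 2))) ^ (((N : ℝ) - 2) / (N : ℝ)) ≤
        C * ∫ y, ‖fderiv ℝ g y‖ ^ 2 := by
  have hN' : (3 : ℝ) ≤ N := by exact_mod_cast hN
  have hpos : (0 : ℝ) < 2 * (N : ℝ) / ((N : ℝ) - 2) := by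
    apply div_pos <;> linarith
  set K : NNReal := eLpNormLESNormFDerivOfEqInnerConst
    (volume : Measure (EuclideanSpace ℝ (Fin N))) ((2 : NNReal) : ℝ) with hK
  refine ⟨(K : ℝ) ^ 2, by positivity, fun g hg hgc => ?_⟩
  set p : NNReal := ⟨2 * (N : ℝ) / ((N : ℝ) - 2), hpos.le⟩ with hp
  have hpc : (p : ℝ) = 2 * (N : ℝ) / ((N : ℝ) - 2) := rfl
  have hp0 : (p : ENNReal) ≠ 0 := by
    have : 0 < p := by rw [← NNReal.coe_pos, hpc]; exact hpos
    simpa using this.ne'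
  have key := eLpNorm_le_eLpNorm_fderiv_of_eq_inner
    (volume : Measure (EuclideanSpace ℝ (Fin N))) hg hgc (p := 2) (p' := p) (by norm_num)
    (by simp; omega) (by
      rw [hpc, finrank_euclideanSpace_fin]
      have : (N : ℝ) - 2 ≠ 0 := by linarith
      have : (N : ℝ) ≠ 0 := by linarith
      push_cast
      field_simp)
  have hm1 : MemLp g p volume := hg.continuous.memLp_of_hasCompactSupport hgc
  have hm2 : MemLp (fderiv ℝ g) ((2 : NNReal) : ENNReal) volume :=
    (hg.continuous_fderiv one_ne_zero).memLp_of_hasCompactSupport (hgc.fderiv ℝ)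
  rw [hm1.eLpNorm_eq_integral_rpow_norm hp0 ENNReal.coe_ne_top,
    hm2.eLpNorm_eq_integral_rpow_norm (by norm_num) ENNReal.coe_ne_top, ← hK,
    ← ENNReal.ofReal_coe_nnreal (p := K), ← ENNReal.ofReal_mul (by positivity),
    ENNReal.ofReal_le_ofReal_iff (by positivity)] at key
  simp only [ENNReal.coe_toReal, hpc, Real.norm_eq_abs] at key
  set A := ∫ y, |g y| ^ (2 * (N : ℝ) / ((N : ℝ) - 2))
  have hA : 0 ≤ A := by positivity
  have hB : 0 ≤ ∫ y, ‖fderiv ℝ g y‖ ^ 2 := by positivity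
  have h1 : A ^ (((N : ℝ) - 2) / (N : ℝ)) = (A ^ (2 * (N : ℝ) / ((N : ℝ) - 2))⁻¹) ^ 2 := by
    rw [← Real.rpow_natCast, ← Real.rpow_mul hA]
    congr 1
    have : (N : ℝ) - 2 ≠ 0 := by linarith
    have : (N : ℝ) ≠ 0 := by linarith
    push_cast
    field_simp
  rw [h1]
  refine (pow_le_pow_left₀ (by positivity) key 2).trans ?_
  rw [mul_pow]
  apply le_of_eq
  congr 1
  rw [← Real.rpow_natCast, ← Real.rpow_mul (by positivity)]
  norm_num

/-- The Euler field identity. -/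
lemma euler_int (N : ℕ) (u : EuclideanSpace ℝ (Fin N) → ℝ) (hu : ContDiff ℝ 1 u)
    (hc : HasCompactSupport u) :
    Integrable (fun y => (N : ℝ) * u y + fderiv ℝ u y y) ∧
    ∫ y, ((N : ℝ) * u y + fderiv ℝ u y y) = 0 := by
  have hcf := hc.fderiv (𝕜 := ℝ)
  have hdc := hu.continuous_fderiv one_ne_zero
  have hui : Integrable u := hu.continuous.integrable_of_hasCompactSupport hc
  have hci : ∀ i : Fin N, HasCompactSupport
      (fun y : EuclideanSpace ℝ (Fin N) => y i * fderiv ℝ u y (EuclideanSpace.single i 1)) := by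
    intro i
    refine hcf.mono' (fun y hy => ?_)
    by_contra h
    apply hy
    simp [image_eq_zero_of_notMem_tsupport h]
  have hint : ∀ i : Fin N, Integrable
      (fun y : EuclideanSpace ℝ (Fin N) => y i * fderiv ℝ u y (EuclideanSpace.single i 1)) := by
    intro i
    refine Continuous.integrable_of_hasCompactSupport ?_ (hci i)
    fun_prop
  have hproj : ∀ (i : Fin N) (y : EuclideanSpace ℝ (Fin N)),
      fderiv ℝ (fun z : EuclideanSpace ℝ (Fin N) => z i) y (EuclideanSpace.single i 1) = 1 := by
    intro i y
    have : (fun z : EuclideanSpace ℝ (Fin N) => z i) = EuclideanSpace.proj (𝕜 := ℝ) i := by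
      ext z; rfl
    rw [this, ContinuousLinearMap.fderiv]
    simp
  have hparts : ∀ i : Fin N,
      ∫ y : EuclideanSpace ℝ (Fin N), y i * fderiv ℝ u y (EuclideanSpace.single i 1)
        = - ∫ y, u y := by
    intro i
    have := integral_mul_fderiv_eq_neg_fderiv_mul_of_integrable (μ := volume)
      (f := fun z : EuclideanSpace ℝ (Fin N) => z i) (g := u) (v := EuclideanSpace.single i 1)
      (by simpa only [hproj, one_mul] using hui) (hint i)
      (by
        refine Continuous.integrable_of_hasCompactSupport ?_ hc.mul_left
        have := hu.continuous
        fun_prop)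
      (fun x _ => by fun_prop) (fun x _ => (hu.differentiable one_ne_zero).differentiableAt)
    simpa only [hproj, one_mul] using this
  have hsum : ∀ y : EuclideanSpace ℝ (Fin N), fderiv ℝ u y y =
      ∑ i, y i * fderiv ℝ u y (EuclideanSpace.single i 1) := by
    intro y
    have h := (EuclideanSpace.basisFun (Fin N) ℝ).sum_repr y
    generalize fderiv ℝ u y = L
    conv_lhs => rw [← h]
    simp [map_sum]
  simp only [hsum]
  refine ⟨(hui.const_mul _).add (integrable_finsetSum _ fun i _ => hint i), ?_⟩
  rw [integral_add (hui.const_mul _) (integrable_finsetSum _ fun i _ => hint i),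
    integral_finsetSum _ (fun i _ => hint i), integral_const_mul]
  simp [hparts]

lemma hasFDerivAt_w {N : ℕ} (e : ℝ) (he : 0 < e) (b : ℝ) (y : EuclideanSpace ℝ (Fin N)) :
    HasFDerivAt (fun z : EuclideanSpace ℝ (Fin N) => (‖z‖ ^ 2 + e) ^ b)
      ((b * (‖y‖ ^ 2 + e) ^ (b - 1)) • ((2 : ℝ) • innerSL ℝ y)) y := by
  have h1 : HasFDerivAt (fun z : EuclideanSpace ℝ (Fin N) => ‖z‖ ^ 2 + e)
      ((2 : ℝ) • innerSL ℝ y) y := by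
    have := (hasStrictFDerivAt_norm_sq y).hasFDerivAt.add_const e
    convert! this using 1
    ext; simp
  exact h1.rpow_const (Or.inl (by positivity))

lemma contDiff_w {N : ℕ} (e : ℝ) (he : 0 < e) (b : ℝ) :
    ContDiff ℝ 1 (fun z : EuclideanSpace ℝ (Fin N) => (‖z‖ ^ 2 + e) ^ b) := by
  refine ContDiff.rpow_const_of_ne ?_ (fun y => by positivity)
  exact (contDiff_norm_sq ℝ).add contDiff_const

lemma loc_int {N : ℕ} (hN : 3 ≤ N) (lam : ℝ) (h : -(N : ℝ) < lam)
    (u : EuclideanSpace ℝ (Fin N) → ℝ) (hu : Continuous u) (hc : HasCompactSupport u) :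
    Integrable (fun y => ‖y‖ ^ lam * u y) := by
  have h1 : LocallyIntegrable (fun y : EuclideanSpace ℝ (Fin N) => ‖y‖ ^ lam) volume := by
    refine locallyIntegrable_of_norm_le_rpow (C := 1) (α := -lam) (by simp; omega)
      (by simp; linarith) (Filter.Eventually.of_forall fun y => ?_) ?_
    · simp [abs_of_nonneg (Real.rpow_nonneg (norm_nonneg y) lam)]
    · exact (measurable_norm.pow_const lam).aestronglyMeasurable
  have := h1.integrable_smul_left_of_hasCompactSupport hu hc
  simpa [mul_comm] using this

lemma hcs_sq {N : ℕ} {g : EuclideanSpace ℝ (Fin N) → ℝ} (hg : HasCompactSupport g) :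
    HasCompactSupport (fun y => g y ^ 2) :=
  hg.comp_left (g := fun t : ℝ => t ^ 2) (by norm_num)

set_option maxHeartbeats 1000000 in
lemma reg_grad (N : ℕ) (al : ℝ) (hal : al < 0) (hk : 0 < (N : ℝ) - 2 + al)
    (e : ℝ) (he : 0 < e) (f : EuclideanSpace ℝ (Fin N) → ℝ) (hf : ContDiff ℝ 1 f)
    (hc : HasCompactSupport f) :
    ∫ y, ‖fderiv ℝ (fun z => (‖z‖ ^ 2 + e) ^ (al / 4) * f z) y‖ ^ 2 ≤
      (2 + 2 * al ^ 2 / ((N : ℝ) - 2 + al) ^ 2) *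
        ∫ y, (‖y‖ ^ 2 + e) ^ (al / 2) * ‖fderiv ℝ f y‖ ^ 2 := by
  set k := (N : ℝ) - 2 + al with hkdef
  have hw : ∀ y : EuclideanSpace ℝ (Fin N), 0 < ‖y‖ ^ 2 + e := fun y => by positivity
  have hdf := hf.continuous_fderiv one_ne_zero
  have hcd := hc.fderiv (𝕜 := ℝ)
  have hfd : ∀ y, HasFDerivAt f (fderiv ℝ f y) y :=
    fun y => (hf.differentiable one_ne_zero).differentiableAt.hasFDerivAt
  have hcw : ∀ b : ℝ, Continuous (fun z : EuclideanSpace ℝ (Fin N) => (‖z‖ ^ 2 + e) ^ b) :=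
    fun b => (contDiff_w e he b).continuous
  -- integrability
  have hI1 : Integrable (fun y => (‖y‖ ^ 2 + e) ^ (al / 2) * ‖fderiv ℝ f y‖ ^ 2) := by
    refine Continuous.integrable_of_hasCompactSupport ((hcw _).mul (by fun_prop)) ?_
    refine HasCompactSupport.mul_left ?_
    exact hcs_sq hcd.norm
  have hcf2 : HasCompactSupport (fun y => f y ^ 2) := hcs_sq hc
  have hI2 : Integrable (fun y => (‖y‖ ^ 2 + e) ^ (al / 2 - 1) * f y ^ 2) := by
    have := hf.continuous
    exact Continuous.integrable_of_hasCompactSupport ((hcw _).mul (by fun_prop)) hcf2.mul_left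
  -- Hardy
  have hardy : (k / 2) * ∫ y, (‖y‖ ^ 2 + e) ^ (al / 2 - 1) * f y ^ 2 ≤
      (2 / k) * ∫ y, (‖y‖ ^ 2 + e) ^ (al / 2) * ‖fderiv ℝ f y‖ ^ 2 := by
    obtain ⟨hE1, hE2⟩ := euler_int N (fun y => (‖y‖ ^ 2 + e) ^ (al / 2 - 1) * f y ^ 2)
      ((contDiff_w e he _).mul (hf.pow 2)) hcf2.mul_left
    rw [← integral_const_mul, ← integral_const_mul, ← zero_add (∫ y, 2 / k * _), ← hE2,
      ← integral_add hE1 (hI1.const_mul _)]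
    refine integral_mono (hI2.const_mul _) (hE1.add (hI1.const_mul _)) fun y => ?_
    have hD : HasFDerivAt (fun y => (‖y‖ ^ 2 + e) ^ (al / 2 - 1) * f y ^ 2) _ y :=
      (hasFDerivAt_w e he (al / 2 - 1) y).mul ((hfd y).pow 2)
    dsimp only
    rw [hD.fderiv]
    have e1 : (‖y‖ ^ 2 + e) ^ (al / 2 - 1 - 1) * (‖y‖ ^ 2 + e) = (‖y‖ ^ 2 + e) ^ (al / 2 - 1) := by
      rw [Real.rpow_sub_one (hw y).ne' (al / 2 - 1)]
      field_simp [(hw y).ne']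
    have e2 : (‖y‖ ^ 2 + e) ^ (al / 2 - 1) * (‖y‖ ^ 2 + e) = (‖y‖ ^ 2 + e) ^ (al / 2) := by
      rw [Real.rpow_sub_one (hw y).ne']
      field_simp [(hw y).ne']
    have hb : |fderiv ℝ f y y| ≤ ‖fderiv ℝ f y‖ * ‖y‖ := (fderiv ℝ f y).le_opNorm y
    simp only [_root_.add_apply, _root_.smul_apply, innerSL_apply_apply,
      real_inner_self_eq_norm_sq, smul_eq_mul, nsmul_eq_mul]
    rw [← e2, ← e1]
    have hv : 0 < (‖y‖ ^ 2 + e) ^ (al / 2 - 1 - 1) := Real.rpow_pos_of_pos (hw y) _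
    set v := (‖y‖ ^ 2 + e) ^ (al / 2 - 1 - 1)
    set D := ‖fderiv ℝ f y‖
    set d := fderiv ℝ f y y
    set F := f y
    set t := ‖y‖
    have ht : 0 ≤ t := norm_nonneg y
    have hNk : (N : ℝ) = k + 2 - al := by rw [hkdef]; ring
    rw [hNk]
    -- Young
    have hY : -(2 * F * d) ≤ k / 2 * F ^ 2 + 2 / k * (t ^ 2 + e) * D ^ 2 := by
      have h1 : d ^ 2 ≤ (t ^ 2 + e) * D ^ 2 := by
        have : d ^ 2 ≤ (D * t) ^ 2 := sq_le_sq' (by linarith [abs_le.1 hb]) (abs_le.1 hb).2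
        nlinarith [sq_nonneg D]
      have h2 : 0 ≤ k / 2 * (F + 2 / k * d) ^ 2 := by positivity
      have h3 : k / 2 * (F + 2 / k * d) ^ 2 = k / 2 * F ^ 2 + 2 * F * d + 2 / k * d ^ 2 := by
        field_simp
        ring
      have h4 : 2 / k * d ^ 2 ≤ 2 / k * ((t ^ 2 + e) * D ^ 2) := by gcongr
      linarith
    have hfin : k / 2 * ((t ^ 2 + e) * F ^ 2) ≤
        (k + 2 - al) * ((t ^ 2 + e) * F ^ 2) + ((t ^ 2 + e) * (2 * F * d)
          + F ^ 2 * ((al / 2 - 1) * (2 * t ^ 2)))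
          + 2 / k * ((t ^ 2 + e) * (t ^ 2 + e) * D ^ 2) := by
      have h5 := mul_le_mul_of_nonneg_left hY (hw y).le
      have h6 : 0 ≤ (2 - al) * (e * F ^ 2) := by
        apply mul_nonneg <;> [linarith; positivity]
      change (t ^ 2 + e) * _ ≤ (t ^ 2 + e) * _ at h5
      nlinarith
    have := mul_le_mul_of_nonneg_left hfin hv.le
    norm_num
    linarith
  -- gradient bound
  have hI3 : Integrable (fun y => ‖fderiv ℝ (fun z => (‖z‖ ^ 2 + e) ^ (al / 4) * f z) y‖ ^ 2) := by
    have hg : ContDiff ℝ 1 (fun z => (‖z‖ ^ 2 + e) ^ (al / 4) * f z) := (contDiff_w e he _).mul hf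
    have hgc : HasCompactSupport (fun z => (‖z‖ ^ 2 + e) ^ (al / 4) * f z) := hc.mul_left
    have := hg.continuous_fderiv one_ne_zero
    refine Continuous.integrable_of_hasCompactSupport (by fun_prop) ?_
    exact hcs_sq (hgc.fderiv (𝕜 := ℝ)).norm
  have hle : ∫ y, ‖fderiv ℝ (fun z => (‖z‖ ^ 2 + e) ^ (al / 4) * f z) y‖ ^ 2 ≤
      ∫ y, (2 * ((‖y‖ ^ 2 + e) ^ (al / 2) * ‖fderiv ℝ f y‖ ^ 2) +
        al ^ 2 / 2 * ((‖y‖ ^ 2 + e) ^ (al / 2 - 1) * f y ^ 2)) := by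
    refine integral_mono hI3 ((hI1.const_mul _).add (hI2.const_mul _)) fun y => ?_
    have hD : HasFDerivAt (fun y => (‖y‖ ^ 2 + e) ^ (al / 4) * f y) _ y :=
      (hasFDerivAt_w e he (al / 4) y).mul (hfd y)
    dsimp only
    rw [hD.fderiv]
    have e1 : (‖y‖ ^ 2 + e) ^ (al / 2) = ((‖y‖ ^ 2 + e) ^ (al / 4)) ^ 2 := by
      rw [← Real.rpow_natCast ((‖y‖ ^ 2 + e) ^ (al / 4)), ← Real.rpow_mul (hw y).le]
      congr 1
      push_cast
      ring
    have e2 : (‖y‖ ^ 2 + e) ^ (al / 2 - 1) =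
        ((‖y‖ ^ 2 + e) ^ (al / 4 - 1)) ^ 2 * (‖y‖ ^ 2 + e) := by
      rw [Real.rpow_sub_one (hw y).ne', Real.rpow_sub_one (hw y).ne', e1]
      field_simp [(hw y).ne']
    rw [e1, e2]
    have hv : 0 < (‖y‖ ^ 2 + e) ^ (al / 4 - 1) := Real.rpow_pos_of_pos (hw y) _
    have hz : 0 < (‖y‖ ^ 2 + e) ^ (al / 4) := Real.rpow_pos_of_pos (hw y) _
    set v := (‖y‖ ^ 2 + e) ^ (al / 4 - 1)
    set z := (‖y‖ ^ 2 + e) ^ (al / 4)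
    have hn : ‖z • fderiv ℝ f y + f y • (al / 4 * v) • (2 : ℝ) • innerSL ℝ y‖ ≤
        z * ‖fderiv ℝ f y‖ + |f y| * (|al| / 4 * v) * 2 * ‖y‖ := by
      refine (norm_add_le _ _).trans (le_of_eq ?_)
      simp only [norm_smul, Real.norm_eq_abs, abs_mul, abs_of_pos hv, abs_of_pos hz, abs_div,
        innerSL_apply_norm]
      norm_num
      ring
    refine (pow_le_pow_left₀ (norm_nonneg _) hn 2).trans ?_
    have h1 : (|f y| * (|al| / 4 * v) * 2 * ‖y‖) ^ 2 ≤ al ^ 2 / 4 * (v ^ 2 * (‖y‖ ^ 2 + e) * f y ^ 2) := by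
      have : (|f y| * (|al| / 4 * v) * 2 * ‖y‖) ^ 2 = al ^ 2 / 4 * (v ^ 2 * ‖y‖ ^ 2 * f y ^ 2) := by
        rw [← sq_abs al, ← sq_abs (f y)]; ring
      rw [this]
      gcongr
      linarith
    have h2 := add_sq_le (a := z * ‖fderiv ℝ f y‖) (b := |f y| * (|al| / 4 * v) * 2 * ‖y‖)
    nlinarith
  refine hle.trans ?_
  rw [integral_add (hI1.const_mul _) (hI2.const_mul _), integral_const_mul, integral_const_mul]
  set A := ∫ y, (‖y‖ ^ 2 + e) ^ (al / 2 - 1) * f y ^ 2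
  set B := ∫ y, (‖y‖ ^ 2 + e) ^ (al / 2) * ‖fderiv ℝ f y‖ ^ 2
  have hA : A ≤ 4 / k ^ 2 * B := by
    have := mul_le_mul_of_nonneg_left hardy (a := 2 / k) (by positivity)
    have h1 : 2 / k * (k / 2 * A) = A := by field_simp
    have h2 : 2 / k * (2 / k * B) = 4 / k ^ 2 * B := by ring
    linarith
  have := mul_le_mul_of_nonneg_left hA (a := al ^ 2 / 2) (by positivity)
  have h3 : al ^ 2 / 2 * (4 / k ^ 2 * B) = 2 * al ^ 2 / k ^ 2 * B := by ring
  linarith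

/-- Local weighted Sobolev inequality with weight `|y|^λ` on Euclidean balls. -/
theorem local_weighted_sobolev
    (N : ℕ) (hN : 3 ≤ N) (lam : ℝ) (hlam₁ : 2 - (N : ℝ) ≤ lam) (hlam₂ : lam < 0) :
    ∃ C_S : ℝ, 0 < C_S ∧ ∀ (x : EuclideanSpace ℝ (Fin N)) (r : ℝ), 0 < r →
      ∀ f : EuclideanSpace ℝ (Fin N) → ℝ,
        ContDiff ℝ (⊤ : ℕ∞) f → HasCompactSupport f → tsupport f ⊆ Metric.ball x r →
        (∫ y in Metric.ball x r, ‖y‖ ^ lam * |f y| ^ (2 * (N : ℝ) / ((N : ℝ) - 2))) ^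
            (((N : ℝ) - 2) / (N : ℝ)) ≤
          C_S * (‖x‖ + r) ^ (2 * |lam| / (N : ℝ)) *
            ∫ y in Metric.ball x r, ‖y‖ ^ lam * ‖gradient f y‖ ^ 2 := by
  have hN' : (3 : ℝ) ≤ N := by exact_mod_cast hN
  have hN0 : (N : ℝ) ≠ 0 := by linarith
  have hN2 : (N : ℝ) - 2 ≠ 0 := by linarith
  obtain ⟨C0, hC0, hsob⟩ := sob_real N hN
  set al : ℝ := lam * (((N : ℝ) - 2) / N) with hal
  have hq : 0 < ((N : ℝ) - 2) / N := by apply div_pos <;> linarith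
  have hal0 : al < 0 := mul_neg_of_neg_of_pos hlam₂ hq
  have hk : 0 < (N : ℝ) - 2 + al := by
    have : (N : ℝ) - 2 + al = (((N : ℝ) - 2) / N) * (N + lam) := by
      rw [hal]; field_simp
    rw [this]
    apply mul_pos hq; linarith
  set K : ℝ := 2 + 2 * al ^ 2 / ((N : ℝ) - 2 + al) ^ 2 with hK
  have hK0 : 0 < K := by positivity
  refine ⟨C0 * K + 1, by positivity, fun x r hr f hf' hc hs => ?_⟩
  have hf : ContDiff ℝ 1 f := hf'.of_le (by exact_mod_cast le_top)
  set p : ℝ := 2 * (N : ℝ) / ((N : ℝ) - 2) with hp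
  have hp0 : 0 < p := by apply div_pos <;> linarith
  have hgrad : ∀ y, ‖gradient f y‖ = ‖fderiv ℝ f y‖ := fun y => by simp [gradient]
  simp only [hgrad]
  have hdf := hf.continuous_fderiv one_ne_zero
  have hcd := hc.fderiv (𝕜 := ℝ)
  have hz1 : ∀ y, y ∉ Metric.ball x r → f y = 0 :=
    fun y hy => image_eq_zero_of_notMem_tsupport fun h => hy (hs h)
  have hz2 : ∀ y, y ∉ Metric.ball x r → fderiv ℝ f y = 0 :=
    fun y hy => image_eq_zero_of_notMem_tsupport fun h => hy (hs (tsupport_fderiv_subset ℝ h))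
  rw [setIntegral_eq_integral_of_forall_compl_eq_zero (fun y hy => by
      rw [hz1 y hy, abs_zero, Real.zero_rpow hp0.ne', mul_zero]),
    setIntegral_eq_integral_of_forall_compl_eq_zero (fun y hy => by simp [hz2 y hy])]
  have hlamN : -(N : ℝ) < lam := by linarith
  have hfp : Continuous fun y => |f y| ^ p :=
    (hf.continuous.abs).rpow_const fun _ => Or.inr hp0.le
  have hfpc : HasCompactSupport fun y => |f y| ^ p :=
    hc.comp_left (g := fun t : ℝ => |t| ^ p) (by simp [hp0.ne'])
  have hIl : Integrable (fun y => ‖y‖ ^ lam * |f y| ^ p) := loc_int hN lam hlamN _ hfp hfpc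
  have hIr : Integrable (fun y => ‖y‖ ^ lam * ‖fderiv ℝ f y‖ ^ 2) :=
    loc_int hN lam hlamN _ (by fun_prop) (hcs_sq hcd.norm)
  set R : ℝ := ‖x‖ + r with hR
  have hR0 : 0 < R := by positivity
  set T := ∫ y, ‖y‖ ^ lam * ‖fderiv ℝ f y‖ ^ 2 with hT
  have hT0 : 0 ≤ T := integral_nonneg fun y => by positivity
  have hne : ∀ᵐ y : EuclideanSpace ℝ (Fin N), y ≠ 0 := by
    have : Nonempty (Fin N) := ⟨⟨0, by omega⟩⟩
    exact Measure.ae_ne volume 0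
  -- comparison of weights
  have hcmp : ∀ (e b : ℝ), 0 < e → b ≤ 0 → ∀ y : EuclideanSpace ℝ (Fin N), y ≠ 0 →
      (‖y‖ ^ 2 + e) ^ (b / 2) ≤ ‖y‖ ^ b := by
    intro e b he hb y hy
    have hy' : 0 < ‖y‖ := norm_pos_iff.2 hy
    calc (‖y‖ ^ 2 + e) ^ (b / 2) ≤ (‖y‖ ^ 2) ^ (b / 2) :=
          Real.rpow_le_rpow_of_nonpos (by positivity) (by linarith) (by linarith)
      _ = ‖y‖ ^ b := by
          rw [← Real.rpow_natCast, ← Real.rpow_mul hy'.le]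
          congr 1
          push_cast
          ring
  have hreg : ∀ e : ℝ, 0 < e → (∫ y, (‖y‖ ^ 2 + e) ^ (lam / 2) * |f y| ^ p) ^
      (((N : ℝ) - 2) / (N : ℝ)) ≤ C0 * (K * (R ^ (2 * |lam| / (N : ℝ)) * T)) := by
    intro e he
    have h1 := hsob (fun z => (‖z‖ ^ 2 + e) ^ (al / 4) * f z) ((contDiff_w e he _).mul hf)
      hc.mul_left
    have h2 := reg_grad N al hal0 hk e he f hf hc
    have h3 : ∫ y, (‖y‖ ^ 2 + e) ^ (al / 2) * ‖fderiv ℝ f y‖ ^ 2 ≤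
        R ^ (2 * |lam| / (N : ℝ)) * T := by
      rw [hT, ← integral_const_mul]
      refine integral_mono_of_nonneg (Filter.Eventually.of_forall fun y => by positivity)
        (hIr.const_mul _) ?_
      filter_upwards [hne] with y hy
      have hy' : 0 < ‖y‖ := norm_pos_iff.2 hy
      by_cases hyb : y ∈ Metric.ball x r
      · have hyR : ‖y‖ ≤ R := by
          have h := norm_le_norm_add_norm_sub x y
          rw [Metric.mem_ball, dist_eq_norm, norm_sub_rev] at hyb
          linarith
        have h4 : ‖y‖ ^ al ≤ R ^ (2 * |lam| / (N : ℝ)) * ‖y‖ ^ lam := by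
          have : al = 2 * |lam| / (N : ℝ) + lam := by
            rw [hal, abs_of_neg hlam₂]; field_simp; ring
          rw [this, Real.rpow_add hy']
          gcongr
        calc _ ≤ (R ^ (2 * |lam| / (N : ℝ)) * ‖y‖ ^ lam) * ‖fderiv ℝ f y‖ ^ 2 := by
              gcongr
              exact (hcmp e al he hal0.le y hy).trans h4
          _ = _ := by ring
      · simp [hz2 y hyb]
    have h5 : ∀ y, |(‖y‖ ^ 2 + e) ^ (al / 4) * f y| ^ p =
        (‖y‖ ^ 2 + e) ^ (lam / 2) * |f y| ^ p := by
      intro y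
      have hw : 0 < ‖y‖ ^ 2 + e := by positivity
      rw [abs_mul, Real.mul_rpow (abs_nonneg _) (abs_nonneg _),
        abs_of_pos (Real.rpow_pos_of_pos hw _), ← Real.rpow_mul hw.le]
      congr 2
      rw [hal, hp]
      field_simp
      norm_num
    simp only [h5] at h1
    refine h1.trans (mul_le_mul_of_nonneg_left (h2.trans ?_) hC0)
    exact mul_le_mul_of_nonneg_left h3 hK0.le
  -- limit
  have hlim : Filter.Tendsto
      (fun n : ℕ => ∫ y, (‖y‖ ^ 2 + 1 / ((n : ℝ) + 1)) ^ (lam / 2) * |f y| ^ p)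
      Filter.atTop (nhds (∫ y, ‖y‖ ^ lam * |f y| ^ p)) := by
    refine tendsto_integral_of_dominated_convergence (fun y => ‖y‖ ^ lam * |f y| ^ p)
      (fun n => ?_) hIl (fun n => ?_) ?_
    · exact ((contDiff_w _ (by positivity) _).continuous.mul hfp).aestronglyMeasurable
    · filter_upwards [hne] with y hy
      rw [Real.norm_of_nonneg (by positivity)]
      gcongr
      exact hcmp _ lam (by positivity) hlam₂.le y hy
    · filter_upwards [hne] with y hy
      have hy' : 0 < ‖y‖ := norm_pos_iff.2 hy
      refine Filter.Tendsto.mul_const _ ?_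
      have h1 : Filter.Tendsto (fun n : ℕ => ‖y‖ ^ 2 + 1 / ((n : ℝ) + 1)) Filter.atTop
          (nhds (‖y‖ ^ 2 + 0)) := tendsto_one_div_add_atTop_nhds_zero_nat.const_add _
      have h2 := h1.rpow_const (p := lam / 2) (Or.inl (by positivity))
      convert! h2 using 2
      rw [add_zero, ← Real.rpow_natCast, ← Real.rpow_mul hy'.le]
      congr 1
      push_cast
      ring
  have hfinal := le_of_tendsto' (hlim.rpow_const (p := ((N : ℝ) - 2) / (N : ℝ)) (Or.inr hq.le))
    (fun n => hreg (1 / ((n : ℝ) + 1)) (by positivity))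
  refine hfinal.trans ?_
  have : 0 ≤ R ^ (2 * |lam| / (N : ℝ)) * T := by positivity
  nlinarith
end
end

section
/- Let N ≥ 2 and let Ω ⊂ ℝ^N be a smooth bounded domain. For every function w that is smooth on an open neighborhood of the closure of Ω and every ε > 0, there exists a Lipschitz function u : ℝ^N → ℝ whose support is a compact subset of Ω such that ∫_Ω d(y) · ( |w(y) − u(y)|² + |∇w(y) − ∇u(y)|² ) dy ≤ ε, where ∇u denotes the almost-everywhere defined gradient of the Lipschitz function u. -/
open MeasureTheory Real

noncomputable section

/-- Distance to the boundary of `Ω`. -/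
def bdist {N : ℕ} (Ω : Set (EuclideanSpace ℝ (Fin N))) (x : EuclideanSpace ℝ (Fin N)) : ℝ :=
  Metric.infDist x (frontier Ω)



open Topology ENNReal in
lemma vol_box {N : ℕ} (i : Fin N) (R : ℝ) :
    ∃ C : ℝ≥0∞, C ≠ ⊤ ∧ ∀ s : ℝ, volume {x : EuclideanSpace ℝ (Fin N) |
      ∀ j, x j ∈ Set.Icc (if j = i then -s else -R) (if j = i then 0 else R)} ≤ C * ENNReal.ofReal s := by
  refine ⟨∏ j ∈ Finset.univ.erase i, ENNReal.ofReal (R + R), ?_, ?_⟩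
  · exact (ENNReal.prod_lt_top (fun _ _ => ENNReal.ofReal_lt_top)).ne
  intro s
  have h := (PiLp.volume_preserving_ofLp (Fin N)).measure_preimage
    (s := Set.pi Set.univ fun j => Set.Icc (if j = i then -s else -R) (if j = i then 0 else R))
    (MeasurableSet.univ_pi fun _ => measurableSet_Icc).nullMeasurableSet
  have h2 : {x : EuclideanSpace ℝ (Fin N) |
      ∀ j, x j ∈ Set.Icc (if j = i then -s else -R) (if j = i then 0 else R)} = WithLp.ofLp ⁻¹' (Set.pi Set.univ fun j => Set.Icc (if j = i then -s else -R) (if j = i then 0 else R)) := by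
    ext x; simp only [Set.mem_ofPred_eq, Set.mem_preimage, Set.mem_univ_pi]
  rw [h2, h, volume_pi, Measure.pi_pi, ← Finset.mul_prod_erase _ _ (Finset.mem_univ i), mul_comm]
  simp only [Real.volume_Icc]
  apply le_of_eq
  congr 1
  · apply Finset.prod_congr rfl
    intro j hj
    have := Finset.ne_of_mem_erase hj
    simp [this]
  · simp

open Topology ENNReal in
lemma local_vol {N : ℕ} (φ : EuclideanSpace ℝ (Fin N) → ℝ) (hφ : ContDiff ℝ 2 φ)
    (p : EuclideanSpace ℝ (Fin N)) (hp : fderiv ℝ φ p ≠ 0) :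
    ∃ r : ℝ, 0 < r ∧ ∃ C : ℝ≥0∞, C ≠ ⊤ ∧ ∀ s : ℝ,
      volume (Metric.ball p r ∩ {x | -s < φ x ∧ φ x < 0}) ≤ C * ENNReal.ofReal s := by
  obtain ⟨i, hi⟩ : ∃ i, fderiv ℝ φ p (EuclideanSpace.single i 1) ≠ 0 := by
    by_contra! h
    apply hp
    apply ContinuousLinearMap.coe_injective
    apply (EuclideanSpace.basisFun (Fin N) ℝ).toBasis.ext
    intro i
    simpa using h i
  set e : EuclideanSpace ℝ (Fin N) := EuclideanSpace.single i 1 with he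
  let F : EuclideanSpace ℝ (Fin N) → EuclideanSpace ℝ (Fin N) :=
    fun x => x + (φ x - EuclideanSpace.proj (𝕜 := ℝ) i x) • e
  let A : EuclideanSpace ℝ (Fin N) →L[ℝ] EuclideanSpace ℝ (Fin N) :=
    ContinuousLinearMap.id ℝ _ + (fderiv ℝ φ p - EuclideanSpace.proj (𝕜 := ℝ) i).smulRight e
  have hF : HasStrictFDerivAt F A p := by
    have h1 : HasStrictFDerivAt φ (fderiv ℝ φ p) p :=
      hφ.contDiffAt.hasStrictFDerivAt (by norm_num)
    exact (hasStrictFDerivAt_id p).add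
      ((h1.sub (EuclideanSpace.proj (𝕜 := ℝ) i).hasStrictFDerivAt).smul_const e)
  have hdet : A.det ≠ 0 := by
    have hinj : Function.Injective (A : EuclideanSpace ℝ (Fin N) →ₗ[ℝ] EuclideanSpace ℝ (Fin N)) := by
      rw [← LinearMap.ker_eq_bot, LinearMap.ker_eq_bot']
      intro v hv
      have hv' : v + (fderiv ℝ φ p v - v i) • e = 0 := by simpa [A] using hv
      have h1 : v = (v i - fderiv ℝ φ p v) • e := by
        have := eq_neg_of_add_eq_zero_left hv'
        rw [← neg_smul, neg_sub] at this
        exact this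
      have h2 : v i = v i - fderiv ℝ φ p v := by
        have := congrArg (fun z : EuclideanSpace ℝ (Fin N) => z i) h1
        simpa [he] using this
      have h3 : fderiv ℝ φ p v = 0 := by linarith
      rw [h1, map_smul, smul_eq_mul] at h3
      rcases mul_eq_zero.1 h3 with h | h
      · rw [h1, h, zero_smul]
      · exact absurd h hi
    exact fun h => (LinearMap.bot_lt_ker_of_det_eq_zero h).ne' (LinearMap.ker_eq_bot.2 hinj)
  have hm : ((Real.toNNReal (|A.det| / 2) : NNReal) : ℝ≥0∞) < ENNReal.ofReal |A.det| := by
    have : 0 < |A.det| := abs_pos.2 hdet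
    change ENNReal.ofReal _ < _
    exact (ENNReal.ofReal_lt_ofReal_iff this).2 (by linarith)
  have hm0 : ((Real.toNNReal (|A.det| / 2) : NNReal) : ℝ≥0∞) ≠ 0 := by
    have : 0 < |A.det| := abs_pos.2 hdet
    simpa using this
  obtain ⟨δ, hδ, hδ0⟩ := ((mul_le_addHaar_image_of_lt_det volume A hm).and
    (self_mem_nhdsWithin)).exists
  obtain ⟨S, hS, hSA⟩ := hF.approximates_deriv_on_nhds (c := δ) (Or.inr hδ0)
  obtain ⟨r, hr, hrS⟩ := Metric.mem_nhds_iff.1 hS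
  obtain ⟨C, hC, hbox⟩ := vol_box i (‖p‖ + r)
  refine ⟨r, hr, (((Real.toNNReal (|A.det| / 2) : NNReal) : ℝ≥0∞))⁻¹ * C,
    ENNReal.mul_ne_top (ENNReal.inv_ne_top.2 hm0) hC, fun s => ?_⟩
  have h1 := hδ (Metric.ball p r ∩ {x | -s < φ x ∧ φ x < 0}) F
    (hSA.mono_set (Set.inter_subset_left.trans hrS))
  rw [mul_assoc, ← ENNReal.mul_le_iff_le_inv hm0 ENNReal.coe_ne_top]
  refine h1.trans ((measure_mono ?_).trans (hbox s))
  rintro _ ⟨x, ⟨hx, hx1, hx2⟩, rfl⟩ j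
  by_cases hj : j = i
  · subst hj
    simp [F, he]
    constructor <;> linarith
  · have : |x j| ≤ ‖p‖ + r := by
      have h1 : ‖x j‖ ≤ ‖x‖ := PiLp.norm_apply_le x j
      have h2 : ‖x - p‖ < r := by simpa [dist_eq_norm] using hx
      have h3 : ‖x‖ ≤ ‖x - p‖ + ‖p‖ := by simpa using norm_add_le (x - p) p
      rw [Real.norm_eq_abs] at h1
      linarith
    have := abs_le.1 this
    simp [F, he, hj]
    constructor <;> linarith



lemma infDist_frontier_le {N : ℕ} (Ω : Set (EuclideanSpace ℝ (Fin N)))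
    (x : EuclideanSpace ℝ (Fin N)) (hx : x ∈ Ω) (hne : Ωᶜ.Nonempty) :
    Metric.infDist x (frontier Ω) ≤ Metric.infDist x Ωᶜ := by
  rw [Metric.le_infDist hne]
  intro z hz
  have hpre : IsPreconnected (segment ℝ x z) := (convex_segment x z).isPreconnected
  obtain ⟨y, hy, hyf⟩ : (segment ℝ x z ∩ frontier Ω).Nonempty := by
    by_contra hcon
    rw [Set.not_nonempty_iff_eq_empty] at hcon
    have hsub : segment ℝ x z ⊆ interior Ω ∪ interior Ωᶜ := by
      intro y hy
      by_contra h
      have : y ∈ frontier Ω := by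
        rw [frontier_eq_closure_inter_closure, closure_eq_compl_interior_compl,
          closure_eq_compl_interior_compl, compl_compl]
        simp only [Set.mem_union, not_or] at h
        exact ⟨h.2, h.1⟩
      have : y ∈ segment ℝ x z ∩ frontier Ω := ⟨hy, this⟩
      rw [hcon] at this
      exact this
    have hx1 : x ∈ interior Ω := by
      rcases hsub (left_mem_segment ℝ x z) with h | h
      · exact h
      · exact absurd hx (interior_subset h)
    have hz1 : z ∈ interior Ωᶜ := by
      rcases hsub (right_mem_segment ℝ x z) with h | h
      · exact absurd (interior_subset h) hz
      · exact h
    obtain ⟨y, _, hy1, hy2⟩ := hpre _ _ isOpen_interior isOpen_interior hsub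
      ⟨x, left_mem_segment ℝ x z, hx1⟩ ⟨z, right_mem_segment ℝ x z, hz1⟩
    exact interior_subset hy2 (interior_subset hy1)
  refine (Metric.infDist_le_dist_of_mem hyf).trans ?_
  have := dist_add_dist_of_mem_segment hy
  have := dist_nonneg (x := y) (y := z)
  linarith

open ENNReal in
lemma cutoff {N : ℕ} (g : EuclideanSpace ℝ (Fin N) → ℝ) (hg : LipschitzWith 1 g)
    (hg0 : ∀ x, 0 ≤ g x) (m k : ℕ) (hk : 0 < k) :
    ∃ η : EuclideanSpace ℝ (Fin N) → ℝ, (∃ K : NNReal, LipschitzWith K η) ∧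
      (∀ x, 0 ≤ η x ∧ η x ≤ 1) ∧ (∀ x, g x ≤ (1/2 : ℝ)^(m+k) → η x = 0) ∧
      (∀ x, (1/2 : ℝ)^m ≤ g x → η x = 1) ∧
      ∀ᵐ x, DifferentiableAt ℝ η x ∧
        g x * ‖fderiv ℝ η x‖^2 ≤ 4 / (k:ℝ)^2 * ∑ j ∈ Finset.range k,
          2^(m+j) * Set.indicator {y | g y < (1/2 : ℝ)^(m+j)} (fun _ => (1:ℝ)) x := by
  have hk' : (0:ℝ) < k := by exact_mod_cast hk
  let ψ : ℕ → EuclideanSpace ℝ (Fin N) → ℝ := fun j x =>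
    max 0 (min 1 (2^(m+j+1) * g x - 1))
  have hψL : ∀ j, LipschitzWith (2^(m+j+1)) (ψ j) := by
    intro j
    refine LipschitzWith.const_max (LipschitzWith.const_min ?_ 1) 0
    refine LipschitzWith.of_dist_le_mul fun x y => ?_
    have := hg.dist_le_mul x y
    rw [Real.dist_eq] at this ⊢
    rw [sub_sub_sub_cancel_right, ← mul_sub, abs_mul, abs_of_pos (by positivity)]
    push_cast
    gcongr
    simpa using this
  have hψ0 : ∀ j x, 0 ≤ ψ j x := fun j x => le_max_left _ _
  have hψ1 : ∀ j x, ψ j x ≤ 1 := fun j x => max_le zero_le_one (min_le_left _ _)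
  have hpow : ∀ n : ℕ, (2:ℝ)^n * (1/2)^n = 1 := fun n => by
    rw [← mul_pow]; norm_num
  have hψz : ∀ j x, g x ≤ (1/2:ℝ)^(m+j+1) → ψ j x = 0 := by
    intro j x hx
    apply max_eq_left
    refine (min_le_right _ _).trans ?_
    have h1 := hpow (m+j+1)
    have : (2:ℝ)^(m+j+1) * g x ≤ 2^(m+j+1) * (1/2)^(m+j+1) := by gcongr
    linarith
  have hψo : ∀ j x, (1/2:ℝ)^(m+j) ≤ g x → ψ j x = 1 := by
    intro j x hx
    have h1 := hpow (m+j)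
    have h2 : (2:ℝ)^(m+j+1) * (1/2)^(m+j) ≤ 2^(m+j+1) * g x := by gcongr
    have h3 : (2:ℝ)^(m+j+1) * (1/2)^(m+j) = 2 := by
      rw [pow_succ, mul_right_comm, h1]; norm_num
    have h4 : min 1 ((2:ℝ)^(m+j+1) * g x - 1) = 1 := min_eq_left (by linarith)
    simp only [ψ, h4]; norm_num
  have hderiv0 : ∀ j x, (g x ≤ (1/2:ℝ)^(m+j+1) ∨ (1/2:ℝ)^(m+j) ≤ g x) → fderiv ℝ (ψ j) x = 0 := by
    rintro j x (h | h)
    · apply IsLocalMin.fderiv_eq_zero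
      refine Filter.Eventually.of_forall fun y => ?_
      rw [hψz j x h]; exact hψ0 j y
    · apply IsLocalMax.fderiv_eq_zero
      refine Filter.Eventually.of_forall fun y => ?_
      rw [hψo j x h]; exact hψ1 j y
  let η : EuclideanSpace ℝ (Fin N) → ℝ := fun x => (k:ℝ)⁻¹ * ∑ j ∈ Finset.range k, ψ j x
  refine ⟨η, ?_, ?_, ?_, ?_, ?_⟩
  · refine ⟨‖(k:ℝ)⁻¹‖₊ * ∑ j ∈ Finset.range k, 2^(m+j+1), ?_⟩
    refine LipschitzWith.of_dist_le_mul fun x y => ?_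
    rw [Real.dist_eq]
    simp only [η]
    rw [← mul_sub, ← Finset.sum_sub_distrib, abs_mul]
    push_cast
    rw [mul_assoc, Real.norm_eq_abs, Finset.sum_mul]
    gcongr
    refine (Finset.abs_sum_le_sum_abs _ _).trans (Finset.sum_le_sum fun j _ => ?_)
    simpa [Real.dist_eq] using (hψL j).dist_le_mul x y
  · intro x
    refine ⟨mul_nonneg (by positivity) (Finset.sum_nonneg fun j _ => hψ0 j x), ?_⟩
    have : ∑ j ∈ Finset.range k, ψ j x ≤ ∑ j ∈ Finset.range k, 1 :=
      Finset.sum_le_sum fun j _ => hψ1 j x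
    simp only [η]
    rw [inv_mul_le_iff₀ hk']
    simpa using this
  · intro x hx
    simp only [η]
    rw [Finset.sum_eq_zero, mul_zero]
    intro j hj
    apply hψz
    refine hx.trans (pow_le_pow_of_le_one (by norm_num) (by norm_num) ?_)
    have := Finset.mem_range.1 hj
    omega
  · intro x hx
    simp only [η]
    rw [Finset.sum_congr rfl (g := fun _ => (1:ℝ))]
    · simp; field_simp
    intro j hj
    apply hψo
    exact (pow_le_pow_of_le_one (by norm_num) (by norm_num) (by omega)).trans hx
  · have hae : ∀ᵐ x, ∀ j, DifferentiableAt ℝ (ψ j) x :=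
      ae_all_iff.2 fun j => (hψL j).ae_differentiableAt
    filter_upwards [hae] with x hx
    have hd : HasFDerivAt η ((k:ℝ)⁻¹ • ∑ j ∈ Finset.range k, fderiv ℝ (ψ j) x) x := by
      have := HasFDerivAt.fun_sum (u := Finset.range k) (fun j _ => (hx j).hasFDerivAt)
      exact this.const_mul _
    refine ⟨hd.differentiableAt, ?_⟩
    rw [hd.fderiv]
    have hRnn : ∀ j ∈ Finset.range k, 0 ≤
        2^(m+j) * Set.indicator {y | g y < (1/2 : ℝ)^(m+j)} (fun _ => (1:ℝ)) x := fun j _ =>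
      mul_nonneg (by positivity) (Set.indicator_nonneg (fun _ _ => zero_le_one) _)
    by_cases hex : ∃ j ∈ Finset.range k, (1/2:ℝ)^(m+j+1) < g x ∧ g x < (1/2:ℝ)^(m+j)
    · obtain ⟨j, hj, hj1, hj2⟩ := hex
      have hsum : ∑ i ∈ Finset.range k, fderiv ℝ (ψ i) x = fderiv ℝ (ψ j) x := by
        apply Finset.sum_eq_single_of_mem j hj
        intro i _ hij
        apply hderiv0
        rcases lt_or_gt_of_ne hij with h | h
        · left
          exact hj2.le.trans (pow_le_pow_of_le_one (by norm_num) (by norm_num) (by omega))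
        · right
          exact (pow_le_pow_of_le_one (by norm_num) (by norm_num) (by omega)).trans hj1.le
      rw [hsum]
      have hn : ‖fderiv ℝ (ψ j) x‖ ≤ 2^(m+j+1) := by
        simpa using norm_fderiv_le_of_lipschitz ℝ (hψL j) (x₀ := x)
      have hle := Finset.single_le_sum hRnn hj
      rw [Set.indicator_of_mem (show x ∈ {y | g y < (1/2 : ℝ)^(m+j)} from hj2), mul_one] at hle
      refine le_trans ?_ (mul_le_mul_of_nonneg_left hle (by positivity))
      rw [norm_smul, mul_pow, norm_inv, Real.norm_natCast]
      have h1 := hpow (m+j)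
      calc g x * ((k:ℝ)⁻¹^2 * ‖fderiv ℝ (ψ j) x‖^2)
          ≤ (1/2:ℝ)^(m+j) * ((k:ℝ)⁻¹^2 * (2^(m+j+1))^2) := by gcongr
        _ = 4 / (k:ℝ)^2 * 2^(m+j) * ((2:ℝ)^(m+j) * (1/2)^(m+j)) := by
            rw [pow_succ 2 (m+j)]; field_simp; ring
        _ = _ := by rw [h1, mul_one]
    · have hsum : ∑ i ∈ Finset.range k, fderiv ℝ (ψ i) x = 0 := by
        apply Finset.sum_eq_zero
        intro i hi
        apply hderiv0
        by_contra! h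
        exact hex ⟨i, hi, h⟩
      rw [hsum]
      simp only [smul_zero, norm_zero]
      have := Finset.sum_nonneg hRnn
      norm_num
      positivity


open Topology in
open scoped Manifold ContDiff in
lemma globalize {N : ℕ} (Ω U : Set (EuclideanSpace ℝ (Fin N)))
    (hΩb : Bornology.IsBounded Ω) (w : EuclideanSpace ℝ (Fin N) → ℝ)
    (hU : IsOpen U) (hclo : closure Ω ⊆ U) (hw : ContDiffOn ℝ (⊤ : ℕ∞) w U) :
    ∃ W : EuclideanSpace ℝ (Fin N) → ℝ, ContDiff ℝ 1 W ∧ HasCompactSupport W ∧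
      ∀ x ∈ Ω, W x = w x := by
  have hK : IsCompact (closure Ω) := hΩb.isCompact_closure
  obtain ⟨δ, hδ, hsub⟩ := hK.exists_cthickening_subset_open hU hclo
  obtain ⟨χ, hχ, -, hχs, hχ1⟩ := exists_contMDiff_support_eq_eq_one_iff
    (n := 1) 𝓘(ℝ, EuclideanSpace ℝ (Fin N))
    (Metric.isOpen_thickening (δ := δ) (E := closure Ω)) isClosed_closure
    (Metric.self_subset_thickening hδ _)
  have hχ' : ContDiff ℝ 1 χ := contMDiff_iff_contDiff.1 hχ
  have hts : tsupport χ ⊆ Metric.cthickening δ (closure Ω) := by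
    rw [tsupport, hχs]
    exact Metric.closure_thickening_subset_cthickening _ _
  have hcs : HasCompactSupport χ :=
    HasCompactSupport.of_support_subset_isCompact hK.cthickening (subset_closure.trans hts)
  refine ⟨fun x => χ x * w x, ?_, hcs.mul_right, ?_⟩
  · rw [contDiff_iff_contDiffAt]
    intro x
    by_cases hx : x ∈ U
    · exact hχ'.contDiffAt.mul (((hw.of_le (by simp)).contDiffAt (hU.mem_nhds hx)))
    · have : x ∉ tsupport χ := fun h => hx (hsub (hts h))
      have h0 : χ =ᶠ[𝓝 x] 0 := notMem_tsupport_iff_eventuallyEq.1 this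
      refine (contDiffAt_const (c := (0:ℝ))).congr_of_eventuallyEq ?_
      filter_upwards [h0] with y hy
      simp [hy]
  · intro x hx
    simp [(hχ1 x).1 (subset_closure hx)]


open Topology ENNReal in
lemma tube_vol {N : ℕ} (Ω : Set (EuclideanSpace ℝ (Fin N)))
    (hΩb : Bornology.IsBounded Ω) (hne : Ωᶜ.Nonempty) (hfne : (frontier Ω).Nonempty)
    (φ : EuclideanSpace ℝ (Fin N) → ℝ)
    (hφ : ContDiff ℝ 2 φ) (hΩ : Ω = {x | φ x < 0}) (hreg : ∀ x ∈ frontier Ω, fderiv ℝ φ x ≠ 0) :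
    ∃ δ : ℝ, 0 < δ ∧ ∃ C : ℝ, 0 ≤ C ∧ ∀ t : ℝ, 0 < t → t < δ →
      (volume.restrict Ω).real {x | Metric.infDist x Ωᶜ < t} ≤ C * t := by
  have hfc : IsCompact (frontier Ω) :=
    hΩb.isCompact_closure.of_isClosed_subset isClosed_frontier frontier_subset_closure
  choose! r hr C hC hvol using fun p hp => local_vol φ hφ p (hreg p hp)
  obtain ⟨T, hTf, hT⟩ := hfc.elim_nhds_subcover (fun p => Metric.ball p (r p))
    (fun p hp => Metric.ball_mem_nhds p (hr p hp))
  obtain ⟨δ, hδ, hδsub⟩ := hfc.exists_thickening_subset_open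
    (isOpen_biUnion fun p _ => Metric.isOpen_ball) hT
  obtain ⟨R, hR⟩ := hΩb.subset_closedBall 0
  obtain ⟨L, hL⟩ := (isCompact_closedBall (0 : EuclideanSpace ℝ (Fin N)) (R+1)).exists_bound_of_continuousOn
    (hφ.continuous_fderiv (by norm_num)).continuousOn
  have hsum : (∑ p ∈ T, C p) ≠ ⊤ := ENNReal.sum_ne_top.2 fun p hp => hC p (hTf p hp)
  refine ⟨min δ 1, by positivity, (∑ p ∈ T, C p).toReal * max L 0, by positivity, ?_⟩
  intro t ht htδ
  have key : volume.restrict Ω {x | Metric.infDist x Ωᶜ < t} ≤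
      (∑ p ∈ T, C p) * ENNReal.ofReal (max L 0 * t) := by
    have hmeas : MeasurableSet {x : EuclideanSpace ℝ (Fin N) | Metric.infDist x Ωᶜ < t} :=
      (isOpen_lt (Metric.continuous_infDist_pt _) continuous_const).measurableSet
    rw [Measure.restrict_apply hmeas, Finset.sum_mul]
    refine le_trans (measure_mono ?_) ((measure_biUnion_finset_le T _).trans
      (Finset.sum_le_sum fun p hp => hvol p (hTf p hp) (max L 0 * t)))
    rintro x ⟨hxt, hx⟩
    replace hxt : Metric.infDist x Ωᶜ < t := hxt
    have h1 : x ∈ Metric.thickening δ (frontier Ω) := by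
      rw [Metric.mem_thickening_iff_infDist_lt hfne]
      have := infDist_frontier_le Ω x hx hne
      have := min_le_left δ 1
      linarith
    obtain ⟨p, hp, hxp⟩ := Set.mem_iUnion₂.1 (hδsub h1)
    refine Set.mem_iUnion₂.2 ⟨p, hp, hxp, ?_⟩
    have hφx : φ x < 0 := by rw [hΩ] at hx; exact hx
    refine ⟨?_, hφx⟩
    obtain ⟨z, hz, hxz⟩ := (Metric.infDist_lt_iff hne).1 hxt
    have hφz : 0 ≤ φ z := by
      by_contra h
      apply hz
      rw [hΩ]
      exact not_le.1 h
    have hxR : ‖x‖ ≤ R := by simpa using hR hx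
    have hzR : ‖z‖ ≤ R + 1 := by
      have h2 : ‖z‖ ≤ ‖x‖ + ‖x - z‖ := by
        simpa [norm_sub_rev] using norm_add_le x (z - x)
      rw [dist_eq_norm] at hxz
      have := min_le_right δ 1
      linarith
    have h3 := (convex_closedBall (0 : EuclideanSpace ℝ (Fin N)) (R+1)).norm_image_sub_le_of_norm_fderiv_le
      (𝕜 := ℝ) (f := φ) (C := max L 0) (x := x) (y := z)
      (fun y _ => (hφ.differentiable (by norm_num)) y) (fun y hy => (hL y hy).trans (le_max_left _ _))
      (by simp; linarith) (by simpa using hzR)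
    have h4 := le_abs_self (φ z - φ x)
    rw [Real.norm_eq_abs, norm_sub_rev, ← dist_eq_norm] at h3
    have h5 : 0 < φ z - φ x := by linarith
    have hpos : 0 < max L 0 := by
      rcases (le_max_right L 0).eq_or_lt with h | h
      · rw [← h, zero_mul] at h3; linarith
      · exact h
    have h6 : max L 0 * dist x z < max L 0 * t := by gcongr
    linarith
  have h7 := ENNReal.toReal_mono (ENNReal.mul_ne_top hsum ENNReal.ofReal_ne_top) key
  rw [ENNReal.toReal_mul, ENNReal.toReal_ofReal (by positivity), ← mul_assoc] at h7
  exact h7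


open scoped Topology

/-- Density of compactly supported (Lipschitz) functions in the weighted Sobolev space
`H¹(Ω, d(y) dy)`: any function smooth in a neighborhood of the closure of `Ω` can be
approximated by Lipschitz functions compactly supported in `Ω`. -/
theorem density_compact_support_weighted_H1
    (N : ℕ) (hN : 2 ≤ N)
    (Ω : Set (EuclideanSpace ℝ (Fin N))) (hΩo : IsOpen Ω) (hΩconn : IsConnected Ω)
    (hΩb : Bornology.IsBounded Ω) (hΩsm : IsC2Domain Ω)
    (w : EuclideanSpace ℝ (Fin N) → ℝ) (U : Set (EuclideanSpace ℝ (Fin N)))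
    (hU : IsOpen U) (hclo : closure Ω ⊆ U) (hw : ContDiffOn ℝ (⊤ : ℕ∞) w U)
    (ε : ℝ) (hε : 0 < ε) :
    ∃ u : EuclideanSpace ℝ (Fin N) → ℝ,
      (∃ K : NNReal, LipschitzWith K u) ∧ HasCompactSupport u ∧ tsupport u ⊆ Ω ∧
      ∫ y in Ω, bdist Ω y *
          (|w y - u y| ^ 2 + ‖gradient w y - gradient u y‖ ^ 2) ≤ ε := by
  obtain ⟨φ, hφ, hΩφ, hreg⟩ := hΩsm
  have : Nonempty (Fin N) := ⟨⟨0, by omega⟩⟩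
  have hne : Ωᶜ.Nonempty := by
    rw [Set.nonempty_compl]
    rintro rfl
    exact NormedSpace.unbounded_univ ℝ (EuclideanSpace ℝ (Fin N)) hΩb
  have hfne : (frontier Ω).Nonempty :=
    nonempty_frontier_iff.2 ⟨hΩconn.nonempty, Set.nonempty_compl.1 hne⟩
  obtain ⟨δ, hδ, C, hC, hvol⟩ := tube_vol Ω hΩb hne hfne φ hφ hΩφ hreg
  obtain ⟨W, hW, hWc, hWw⟩ := globalize Ω U hΩb w hU hclo hw
  obtain ⟨M1, hM1⟩ := hWc.exists_bound_of_continuous hW.continuous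
  obtain ⟨M2, hM2⟩ := (hWc.fderiv ℝ).exists_bound_of_continuous (hW.continuous_fderiv (by norm_num))
  obtain ⟨M, hM0, hMa, hMb⟩ : ∃ M : ℝ, 0 ≤ M ∧ (∀ x, |W x| ≤ M) ∧ ∀ x, ‖fderiv ℝ W x‖ ≤ M :=
    ⟨max 0 (max M1 M2), le_max_left _ _,
      fun x => (hM1 x).trans ((le_max_left _ _).trans (le_max_right _ _)),
      fun x => (hM2 x).trans ((le_max_right _ _).trans (le_max_right _ _))⟩
  obtain ⟨KW, hKW⟩ := hW.lipschitzWith_of_hasCompactSupport hWc (by norm_num)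
  set g : EuclideanSpace ℝ (Fin N) → ℝ := fun x => Metric.infDist x Ωᶜ with hg
  have hgL : LipschitzWith 1 g := Metric.lipschitz_infDist_pt _
  have hg0 : ∀ x, 0 ≤ g x := fun x => Metric.infDist_nonneg
  have hVfin : volume Ω ≠ ⊤ := hΩb.measure_lt_top.ne
  have : IsFiniteMeasure (volume.restrict Ω) := ⟨by simpa using hVfin.lt_top⟩
  set V : ℝ := (volume.restrict Ω).real Set.univ with hV
  -- choice of the parameters
  obtain ⟨m, hm1, hm2⟩ : ∃ m : ℕ, (1/2:ℝ)^m < δ ∧ 3 * M^2 * (1/2:ℝ)^m * V ≤ ε / 2 := by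
    have ht : Filter.Tendsto (fun m : ℕ => (1/2:ℝ)^m) Filter.atTop (𝓝 0) :=
      tendsto_pow_atTop_nhds_zero_of_lt_one (by norm_num) (by norm_num)
    have ht2 : Filter.Tendsto (fun m : ℕ => 3 * M^2 * (1/2:ℝ)^m * V) Filter.atTop (𝓝 0) := by
      simpa using (ht.const_mul (3 * M^2)).mul_const V
    exact ((ht.eventually_lt_const hδ).and (ht2.eventually_le_const (by positivity))).exists
  obtain ⟨k, hk0, hk⟩ : ∃ k : ℕ, 0 < k ∧ 8 * M^2 * C / k ≤ ε / 2 :=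
    ((Filter.eventually_gt_atTop 0).and
      ((tendsto_const_div_atTop_nhds_zero_nat (8 * M^2 * C)).eventually_le_const
        (by positivity))).exists
  have hk' : (0:ℝ) < k := by exact_mod_cast hk0
  obtain ⟨η, ⟨K, hK⟩, hη01, hηz, hηo, hηd⟩ := cutoff g hgL hg0 m k hk0
  have hclosed : IsClosed {x | (1/2:ℝ)^(m+k) ≤ g x} :=
    isClosed_le continuous_const hgL.continuous
  have hsubΩ : {x | (1/2:ℝ)^(m+k) ≤ g x} ⊆ Ω := by
    intro x hx
    by_contra h
    have h0 : g x = 0 := Metric.infDist_zero_of_mem h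
    have h1 : (1/2:ℝ)^(m+k) ≤ g x := hx
    have : (0:ℝ) < (1/2:ℝ)^(m+k) := by positivity
    linarith
  have hts : tsupport (fun x => η x * W x) ⊆ {x | (1/2:ℝ)^(m+k) ≤ g x} := by
    apply closure_minimal _ hclosed
    intro x hx
    by_contra h
    apply hx
    have h' : g x < (1/2:ℝ)^(m+k) := not_le.1 h
    simp [hηz x h'.le]
  refine ⟨fun x => η x * W x, ⟨KW + M.toNNReal * K, ?_⟩, ?_, hts.trans hsubΩ, ?_⟩
  · refine LipschitzWith.of_dist_le_mul fun x y => ?_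
    have h1 := hKW.dist_le_mul x y
    have h2 := hK.dist_le_mul x y
    rw [Real.dist_eq] at h1 h2 ⊢
    push_cast
    rw [Real.coe_toNNReal _ hM0]
    have h3 : η x * W x - η y * W y = η x * (W x - W y) + W y * (η x - η y) := by ring
    rw [h3]
    refine (abs_add_le _ _).trans ?_
    rw [abs_mul, abs_mul, abs_of_nonneg (hη01 x).1]
    have h4 : η x * |W x - W y| ≤ 1 * (KW * dist x y) := by
      gcongr
      exact (hη01 x).2
    have h5 : |W y| * |η x - η y| ≤ M * (K * dist x y) := by
      gcongr
      exact hMa y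
    linarith
  · exact (hΩb.isCompact_closure).of_isClosed_subset (isClosed_tsupport _)
      ((hts.trans hsubΩ).trans subset_closure)
  · have hmeas : ∀ j : ℕ, MeasurableSet {y | g y < (1/2 : ℝ)^(m+j)} := fun j =>
      (isOpen_lt hgL.continuous continuous_const).measurableSet
    have hintj : ∀ j : ℕ, Integrable (fun x => (2:ℝ)^(m+j) *
        Set.indicator {y | g y < (1/2 : ℝ)^(m+j)} (fun _ => (1:ℝ)) x) (volume.restrict Ω) :=
      fun j => ((integrable_const (1:ℝ)).indicator (hmeas j)).const_mul _
    have hintS := integrable_finsetSum (Finset.range k) (fun j _ => hintj j)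
    have hint2 := (hintS.const_mul (4 / (k:ℝ)^2)).const_mul (2 * M^2)
    have hle : ∫ y in Ω, bdist Ω y *
          (|w y - η y * W y| ^ 2 + ‖gradient w y - gradient (fun x => η x * W x) y‖ ^ 2) ≤
        ∫ y in Ω, (3 * M^2 * (1/2:ℝ)^m + 2 * M^2 * (4 / (k:ℝ)^2 * ∑ j ∈ Finset.range k,
          2^(m+j) * Set.indicator {y | g y < (1/2 : ℝ)^(m+j)} (fun _ => (1:ℝ)) y)) := by
      apply integral_mono_of_nonneg
      · refine Filter.Eventually.of_forall fun y => ?_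
        exact mul_nonneg Metric.infDist_nonneg (by positivity)
      · exact (integrable_const _).add hint2
      · filter_upwards [ae_restrict_mem hΩo.measurableSet, ae_restrict_of_ae hηd]
          with y hy ⟨hyd, hyB⟩
        have hev : w =ᶠ[𝓝 y] W := by
          filter_upwards [hΩo.mem_nhds hy] with z hz using (hWw z hz).symm
        have hWd : DifferentiableAt ℝ W y := hW.differentiable (by norm_num) y
        have hfd : fderiv ℝ (fun x => η x * W x) y = η y • fderiv ℝ W y + W y • fderiv ℝ η y :=
          fderiv_fun_mul hyd hWd
        have hgrad : ‖gradient w y - gradient (fun x => η x * W x) y‖ ≤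
            (1 - η y) * M + M * ‖fderiv ℝ η y‖ := by
          rw [gradient, gradient, ← map_sub, LinearIsometryEquiv.norm_map, hev.fderiv_eq, hfd]
          have : fderiv ℝ W y - (η y • fderiv ℝ W y + W y • fderiv ℝ η y) =
              (1 - η y) • fderiv ℝ W y - W y • fderiv ℝ η y := by
            rw [sub_smul, one_smul]; abel
          rw [this]
          refine (norm_sub_le _ _).trans ?_
          rw [norm_smul, norm_smul, Real.norm_eq_abs, Real.norm_eq_abs,
            abs_of_nonneg (sub_nonneg.2 (hη01 y).2)]
          have := (hη01 y).2
          have := hMa y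
          have := hMb y
          gcongr
        have hval : |w y - η y * W y| ≤ (1 - η y) * M := by
          rw [← hWw y hy, ← one_sub_mul, abs_mul, abs_of_nonneg (sub_nonneg.2 (hη01 y).2)]
          have := (hη01 y).2
          exact mul_le_mul_of_nonneg_left (hMa y) (by linarith)
        have hbd : bdist Ω y ≤ g y := infDist_frontier_le Ω y hy hne
        have hgm : g y * (1 - η y)^2 ≤ (1/2:ℝ)^m := by
          rcases le_or_gt ((1/2:ℝ)^m) (g y) with h | h
          · rw [hηo y h]; simp
          · have h1 : (1 - η y)^2 ≤ 1 := by
              have := hη01 y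
              exact pow_le_one₀ (by linarith) (by linarith)
            have := mul_le_mul_of_nonneg_left h1 (hg0 y)
            linarith
        have h1 : |w y - η y * W y|^2 ≤ ((1 - η y) * M)^2 := by gcongr
        have h2 : ‖gradient w y - gradient (fun x => η x * W x) y‖^2 ≤
            ((1 - η y) * M + M * ‖fderiv ℝ η y‖)^2 := by gcongr
        have h3 : ((1 - η y) * M + M * ‖fderiv ℝ η y‖)^2 ≤
            2 * ((1 - η y) * M)^2 + 2 * (M * ‖fderiv ℝ η y‖)^2 := by
          nlinarith [sq_nonneg ((1 - η y) * M - M * ‖fderiv ℝ η y‖)]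
        calc bdist Ω y * (|w y - η y * W y| ^ 2 +
              ‖gradient w y - gradient (fun x => η x * W x) y‖ ^ 2)
            ≤ g y * (3 * ((1 - η y) * M)^2 + 2 * (M * ‖fderiv ℝ η y‖)^2) := by
              apply mul_le_mul hbd (by linarith) (by positivity) (hg0 y)
          _ = 3 * M^2 * (g y * (1 - η y)^2) + 2 * M^2 * (g y * ‖fderiv ℝ η y‖^2) := by ring
          _ ≤ _ := by gcongr
    refine hle.trans ?_
    rw [integral_add (integrable_const _) hint2, integral_const, integral_const_mul, integral_const_mul,
      integral_finsetSum _ (fun j _ => hintj j)]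
    have hsum : ∑ j ∈ Finset.range k, ∫ x in Ω, (2:ℝ)^(m+j) *
        Set.indicator {y | g y < (1/2 : ℝ)^(m+j)} (fun _ => (1:ℝ)) x ≤ ∑ j ∈ Finset.range k, C := by
      refine Finset.sum_le_sum fun j _ => ?_
      rw [integral_const_mul, integral_indicator (hmeas j), setIntegral_const, smul_eq_mul, mul_one]
      have h1 := hvol ((1/2:ℝ)^(m+j)) (by positivity)
        ((pow_le_pow_of_le_one (by norm_num) (by norm_num) (by omega)).trans_lt hm1)
      have h2 : (2:ℝ)^(m+j) * (1/2)^(m+j) = 1 := by rw [← mul_pow]; norm_num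
      calc _ ≤ (2:ℝ)^(m+j) * (C * (1/2:ℝ)^(m+j)) := by gcongr
        _ = C * ((2:ℝ)^(m+j) * (1/2)^(m+j)) := by ring
        _ = C := by rw [h2, mul_one]
    have h5 : 2 * M^2 * (4 / (k:ℝ)^2 * ∑ j ∈ Finset.range k, ∫ x in Ω, (2:ℝ)^(m+j) *
        Set.indicator {y | g y < (1/2 : ℝ)^(m+j)} (fun _ => (1:ℝ)) x) ≤ ε / 2 := by
      refine le_trans ?_ hk
      calc _ ≤ 2 * M^2 * (4 / (k:ℝ)^2 * ∑ j ∈ Finset.range k, C) := by gcongr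
        _ = _ := by simp; field_simp; ring
    rw [smul_eq_mul, ← hV]
    linarith
end
end

section
/- Let N ≥ 3 and let Ω ⊂ ℝ^N be a smooth bounded domain containing the origin. Then there exists a constant C ∈ (0, 1/4] such that for every u ∈ C₀^∞(Ω), ∫_Ω ( |∇u(x)|² − ((N−2)²/(4|x|²)) · u(x)² ) dx ≥ C · ∫_Ω u(x)²/d(x)² dx. -/
open MeasureTheory Real

noncomputable section

open Filter Topology in
lemma fatou_real {α : Type*} [MeasurableSpace α] {μ : Measure α} {f : ℕ → α → ℝ} {g : α → ℝ} {B : ℝ}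
    (hf : ∀ n, Integrable (f n) μ) (h0 : ∀ n x, 0 ≤ f n x) (hB : ∀ n, ∫ x, f n x ∂μ ≤ B)
    (ht : ∀ᵐ x ∂μ, Tendsto (fun n => f n x) atTop (𝓝 (g x))) :
    Integrable g μ ∧ ∫ x, g x ∂μ ≤ B := by
  have hg0 : 0 ≤ᵐ[μ] g := by
    filter_upwards [ht] with x hx
    exact ge_of_tendsto' hx (fun n => h0 n x)
  have hm : AEStronglyMeasurable g μ :=
    aestronglyMeasurable_of_tendsto_ae _ (fun n => (hf n).aestronglyMeasurable) ht
  have hB0 : 0 ≤ B := (integral_nonneg (h0 0)).trans (hB 0)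
  have key : ∫⁻ x, ENNReal.ofReal (g x) ∂μ ≤ ENNReal.ofReal B := by
    calc ∫⁻ x, ENNReal.ofReal (g x) ∂μ
        = ∫⁻ x, liminf (fun n => ENNReal.ofReal (f n x)) atTop ∂μ := by
          apply lintegral_congr_ae
          filter_upwards [ht] with x hx
          exact ((ENNReal.tendsto_ofReal hx).liminf_eq).symm
      _ ≤ liminf (fun n => ∫⁻ x, ENNReal.ofReal (f n x) ∂μ) atTop :=
          lintegral_liminf_le' (fun n => (hf n).aestronglyMeasurable.aemeasurable.ennreal_ofReal)
      _ ≤ ENNReal.ofReal B := by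
          apply liminf_le_of_le
          · isBoundedDefault
          · intro b hb
            obtain ⟨n, hn⟩ := hb.exists
            refine hn.trans ?_
            rw [← ofReal_integral_eq_lintegral_ofReal (hf n) (Eventually.of_forall (h0 n))]
            exact ENNReal.ofReal_le_ofReal (hB n)
  constructor
  · refine ⟨hm, ?_⟩
    rw [hasFiniteIntegral_iff_ofReal hg0]
    exact key.trans_lt ENNReal.ofReal_lt_top
  · rw [integral_eq_lintegral_of_nonneg_ae hg0 hm]
    exact ENNReal.toReal_le_of_le_ofReal hB0 key

abbrev bv {N : ℕ} (i : Fin N) : EuclideanSpace ℝ (Fin N) := EuclideanSpace.single i 1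

lemma norm_gradient_sq {N : ℕ} (u : EuclideanSpace ℝ (Fin N) → ℝ) (x : EuclideanSpace ℝ (Fin N)) :
    ‖gradient u x‖ ^ 2 = ∑ i, (fderiv ℝ u x (bv i)) ^ 2 := by
  rw [EuclideanSpace.real_norm_sq_eq]
  refine Finset.sum_congr rfl fun i _ => ?_
  have := inner_gradient_left (𝕜 := ℝ) (f := u) (x := x) (y := bv i)
  rw [← this]
  generalize gradient u x = y
  simp [bv, EuclideanSpace.inner_single_right]

lemma cont_mul_of_tsupport {E : Type*} [TopologicalSpace E] {Ω : Set E} (hΩ : IsOpen Ω)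
    {u W : E → ℝ} (hu : Continuous u) (hs : tsupport u ⊆ Ω) (hW : ContinuousOn W Ω) :
    Continuous (fun x => u x * W x) := by
  apply continuous_of_tsupport
  intro x hx
  have hx' : x ∈ Ω := hs (tsupport_mul_subset_left hx)
  exact hu.continuousAt.mul (hW.continuousAt (hΩ.mem_nhds hx'))

lemma integrable_mul_of_tsupport {N : ℕ} {Ω : Set (EuclideanSpace ℝ (Fin N))} (hΩ : IsOpen Ω)
    {u W : EuclideanSpace ℝ (Fin N) → ℝ} (hu : Continuous u) (hc : HasCompactSupport u)
    (hs : tsupport u ⊆ Ω) (hW : ContinuousOn W Ω) :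
    Integrable (fun x => W x * u x ^ 2) := by
  have h1 := cont_mul_of_tsupport hΩ hu hs hW
  have h2 : Continuous (fun x => u x * W x * u x) := h1.mul hu
  have h3 : HasCompactSupport (fun x => u x * W x * u x) := hc.mul_left
  refine (h2.integrable_of_hasCompactSupport h3).congr (Filter.Eventually.of_forall fun x => ?_)
  simp only; ring

lemma basic_ineq {N : ℕ} {Ω : Set (EuclideanSpace ℝ (Fin N))} (hΩ : IsOpen Ω)
    {u W : EuclideanSpace ℝ (Fin N) → ℝ} (hu : ContDiff ℝ 1 u) (hc : HasCompactSupport u)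
    (hs : tsupport u ⊆ Ω) (hW : ContinuousOn W Ω)
    {F : Fin N → EuclideanSpace ℝ (Fin N) → ℝ} (hF : ∀ i, ∀ x ∈ Ω, ContDiffAt ℝ 1 (F i) x)
    (hWF : ∀ x ∈ Ω, W x ≤ ∑ i, (fderiv ℝ (F i) x (bv i) - F i x ^ 2)) :
    Integrable (fun x => ‖gradient u x‖ ^ 2) ∧
    ∫ x, W x * u x ^ 2 ≤ ∫ x, ‖gradient u x‖ ^ 2 := by
  have hd : ∀ i : Fin N, Continuous (fun x => fderiv ℝ u x (bv i)) := fun i =>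
    (hu.continuous_fderiv one_ne_zero).clm_apply continuous_const
  have hdc : ∀ i : Fin N, HasCompactSupport (fun x => fderiv ℝ u x (bv i)) := fun i =>
    hc.fderiv_apply (𝕜 := ℝ) _
  have hgi : Integrable (fun x => ‖gradient u x‖ ^ 2) := by
    simp_rw [norm_gradient_sq]
    refine integrable_finsetSum _ fun i _ => ?_
    refine Continuous.integrable_of_hasCompactSupport ((hd i).pow 2) ?_
    have h2 : (fun x => fderiv ℝ u x (bv i) ^ 2) =
        (fun x => fderiv ℝ u x (bv i)) * (fun x => fderiv ℝ u x (bv i)) := by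
      ext x; simp [sq]
    rw [h2]
    exact (hdc i).mul_left
  refine ⟨hgi, ?_⟩
  set v : Fin N → EuclideanSpace ℝ (Fin N) → ℝ := fun i x => u x * F i x with hv
  have hvs : ∀ i, ContDiff ℝ 1 (v i) := by
    intro i
    rw [contDiff_iff_contDiffAt]
    intro x
    by_cases hx : x ∈ tsupport u
    · exact hu.contDiffAt.mul (hF i x (hs hx))
    · have h0 := notMem_tsupport_iff_eventuallyEq.mp hx
      refine (contDiffAt_const (c := (0 : ℝ))).congr_of_eventuallyEq ?_
      filter_upwards [h0] with y hy
      simp [hv, hy]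
  have hvd : ∀ i : Fin N, Continuous (fun x => fderiv ℝ (v i) x (bv i)) := fun i =>
    ((hvs i).continuous_fderiv one_ne_zero).clm_apply continuous_const
  have i1 : ∀ i, Integrable (fun x => fderiv ℝ u x (bv i) * v i x) := fun i =>
    ((hd i).mul (hvs i).continuous).integrable_of_hasCompactSupport (hdc i).mul_right
  have i2 : ∀ i, Integrable (fun x => u x * fderiv ℝ (v i) x (bv i)) := fun i =>
    (hu.continuous.mul (hvd i)).integrable_of_hasCompactSupport hc.mul_right
  have i3 : ∀ i, Integrable (fun x => u x * v i x) := fun i =>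
    (hu.continuous.mul (hvs i).continuous).integrable_of_hasCompactSupport hc.mul_right
  have ibp : ∀ i, ∫ x, (u x * fderiv ℝ (v i) x (bv i) + fderiv ℝ u x (bv i) * v i x) = 0 := by
    intro i
    rw [integral_add (i2 i) (i1 i), integral_mul_fderiv_eq_neg_fderiv_mul_of_integrable (i1 i) (i2 i) (i3 i)
      (fun x _ => hu.differentiable one_ne_zero x) (fun x _ => (hvs i).differentiable one_ne_zero x)]
    ring
  have i4 : ∀ i, Integrable (fun x => u x * fderiv ℝ (v i) x (bv i) + fderiv ℝ u x (bv i) * v i x) :=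
    fun i => (i2 i).add (i1 i)
  have hsum : ∫ x, (∑ i, (u x * fderiv ℝ (v i) x (bv i) + fderiv ℝ u x (bv i) * v i x) + ‖gradient u x‖ ^ 2)
      = ∫ x, ‖gradient u x‖ ^ 2 := by
    rw [integral_add (integrable_finsetSum _ fun i _ => i4 i) hgi,
      integral_finsetSum _ fun i _ => i4 i]
    simp [ibp]
  rw [← hsum]
  refine integral_mono (integrable_mul_of_tsupport hΩ hu.continuous hc hs hW)
    ((integrable_finsetSum _ fun i _ => i4 i).add hgi) fun x => ?_
  simp only
  by_cases hx : x ∈ tsupport u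
  · have hxΩ := hs hx
    have h1 : ∀ i, fderiv ℝ (v i) x (bv i) = u x * fderiv ℝ (F i) x (bv i) + F i x * fderiv ℝ u x (bv i) := by
      intro i
      have := fderiv_fun_mul (𝕜 := ℝ) (hu.differentiable one_ne_zero x) ((hF i x hxΩ).differentiableAt one_ne_zero)
      simp only [hv]
      rw [this]; simp
    rw [norm_gradient_sq, ← Finset.sum_add_distrib]
    calc W x * u x ^ 2 ≤ (∑ i, (fderiv ℝ (F i) x (bv i) - F i x ^ 2)) * u x ^ 2 := by
          gcongr; exact hWF x hxΩ
      _ = ∑ i, (fderiv ℝ (F i) x (bv i) - F i x ^ 2) * u x ^ 2 := Finset.sum_mul _ _ _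
      _ ≤ _ := by
          refine Finset.sum_le_sum fun i _ => ?_
          rw [h1]
          simp only [hv]
          nlinarith [sq_nonneg (fderiv ℝ u x (bv i) + u x * F i x)]
  · have : u x = 0 := image_eq_zero_of_notMem_tsupport hx
    simp [this, hv]

/-- First partial derivatives. -/
def pd {N : ℕ} (φ : EuclideanSpace ℝ (Fin N) → ℝ) (i : Fin N) (x : EuclideanSpace ℝ (Fin N)) : ℝ :=
  fderiv ℝ φ x (bv i)

lemma pd_contDiff {N : ℕ} {φ : EuclideanSpace ℝ (Fin N) → ℝ} (hφ : ContDiff ℝ 2 φ) (i : Fin N) :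
    ContDiff ℝ 1 (pd φ i) :=
  (hφ.fderiv_right (m := 1) (by norm_num)).clm_apply contDiff_const

/-- The vector field. -/
def vf {N : ℕ} (k ε α β : ℝ) (φ : EuclideanSpace ℝ (Fin N) → ℝ) (i : Fin N)
    (x : EuclideanSpace ℝ (Fin N)) : ℝ :=
  x i * (k / (‖x‖ ^ 2 + ε) + α) + β * ‖x‖ ^ 2 * pd φ i x / (-φ x)

lemma vf_contDiffAt {N : ℕ} {φ : EuclideanSpace ℝ (Fin N) → ℝ} (hφ : ContDiff ℝ 2 φ)
    {k ε α β : ℝ} (hε : 0 < ε) (i : Fin N) {x : EuclideanSpace ℝ (Fin N)} (hx : φ x < 0) :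
    ContDiffAt ℝ 1 (vf k ε α β φ i) x := by
  have h1 : ContDiffAt ℝ 1 (fun y : EuclideanSpace ℝ (Fin N) => ‖y‖ ^ 2) x :=
    (contDiff_norm_sq ℝ).contDiffAt
  have h2 : ContDiffAt ℝ 1 (fun y : EuclideanSpace ℝ (Fin N) => y i) x :=
    ((EuclideanSpace.proj (𝕜 := ℝ) i).contDiff).contDiffAt
  have h3 : ContDiffAt ℝ 1 φ x := (hφ.of_le (by norm_num)).contDiffAt
  have h4 := (pd_contDiff hφ i).contDiffAt (x := x)
  unfold vf
  refine (h2.mul ((contDiffAt_const.div (h1.add contDiffAt_const) ?_).add contDiffAt_const)).add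
    (((contDiffAt_const.mul h1).mul h4).div h3.neg ?_)
  · positivity
  · linarith

lemma vf_fderiv {N : ℕ} {φ : EuclideanSpace ℝ (Fin N) → ℝ} (hφ : ContDiff ℝ 2 φ)
    {k ε α β : ℝ} (hε : 0 < ε) (i : Fin N) {x : EuclideanSpace ℝ (Fin N)} (hx : φ x < 0) :
    fderiv ℝ (vf k ε α β φ i) x (bv i) =
      k / (‖x‖ ^ 2 + ε) + α - 2 * k * x i ^ 2 / (‖x‖ ^ 2 + ε) ^ 2
      + β * (2 * x i * pd φ i x / (-φ x) + ‖x‖ ^ 2 * pd (pd φ i) i x / (-φ x)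
        + ‖x‖ ^ 2 * pd φ i x ^ 2 / (-φ x) ^ 2) := by
  have hd := (vf_contDiffAt (k := k) (α := α) (β := β) hφ hε i hx).differentiableAt one_ne_zero
  have hl : HasDerivAt (fun t : ℝ => x + t • bv i) (bv i) 0 := by
    simpa using ((hasDerivAt_id (0 : ℝ)).smul_const (bv i)).const_add x
  have gen : ∀ f : EuclideanSpace ℝ (Fin N) → ℝ, DifferentiableAt ℝ f x →
      HasDerivAt (fun t : ℝ => f (x + t • bv i)) (fderiv ℝ f x (bv i)) 0 := by
    intro f hf
    have hf' : HasFDerivAt f (fderiv ℝ f x) (x + (0 : ℝ) • bv i) := by simpa using hf.hasFDerivAt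
    exact hf'.comp_hasDerivAt 0 hl
  have h0 := gen _ hd
  have h1 := gen φ ((hφ.differentiable (by norm_num)) x)
  have h2 := gen (pd φ i) ((pd_contDiff hφ i).differentiable one_ne_zero x)
  have h3 : HasDerivAt (fun t : ℝ => (x + t • bv i) i) 1 0 := by
    simpa [bv] using (hasDerivAt_id (0 : ℝ)).const_add (x i)
  have h4 : HasDerivAt (fun t : ℝ => ‖x + t • bv i‖ ^ 2) (2 * x i) 0 := by
    have := hl.norm_sq
    convert this using 1
    simp [bv, EuclideanSpace.inner_single_right]
  have hρ : ‖x + (0 : ℝ) • bv i‖ ^ 2 + ε ≠ 0 := by positivity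
  have hψ : -φ (x + (0 : ℝ) • bv i) ≠ 0 := by simp; linarith
  have h5 := (h3.mul (((hasDerivAt_const (0 : ℝ) k).div (h4.add_const ε) hρ).add_const α)).add
    (((h4.const_mul β).mul h2).div h1.neg hψ)
  have h6 := h0.unique h5
  rw [h6]
  have hρ' : ‖x‖ ^ 2 + ε ≠ 0 := by positivity
  have hψ' : φ x ≠ 0 := hx.ne
  simp only [zero_smul, add_zero, Pi.div_apply, Pi.neg_apply, Pi.mul_apply]
  change _ = _ + β * (2 * x i * (fderiv ℝ φ x (bv i)) / _ + ‖x‖ ^ 2 * (fderiv ℝ (pd φ i) x (bv i)) / _ +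
     ‖x‖ ^ 2 * (fderiv ℝ φ x (bv i)) ^ 2 / _)
  have : pd φ i x = fderiv ℝ φ x (bv i) := rfl
  rw [this]
  field_simp
  ring

lemma vf_sum {N : ℕ} {φ : EuclideanSpace ℝ (Fin N) → ℝ} (hφ : ContDiff ℝ 2 φ)
    {k ε α β : ℝ} (hε : 0 < ε) {x : EuclideanSpace ℝ (Fin N)} (hx : φ x < 0) :
    ∑ i, (fderiv ℝ (vf k ε α β φ i) x (bv i) - vf k ε α β φ i x ^ 2) =
      N * (k / (‖x‖ ^ 2 + ε) + α) - 2 * k * ‖x‖ ^ 2 / (‖x‖ ^ 2 + ε) ^ 2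
      + β * (2 * (∑ i, x i * pd φ i x) / (-φ x) + ‖x‖ ^ 2 * (∑ i, pd (pd φ i) i x) / (-φ x)
        + ‖x‖ ^ 2 * (∑ i, pd φ i x ^ 2) / (-φ x) ^ 2)
      - (‖x‖ ^ 2 * (k / (‖x‖ ^ 2 + ε) + α) ^ 2
        + 2 * (k / (‖x‖ ^ 2 + ε) + α) * β * ‖x‖ ^ 2 * (∑ i, x i * pd φ i x) / (-φ x)
        + β ^ 2 * ‖x‖ ^ 4 * (∑ i, pd φ i x ^ 2) / (-φ x) ^ 2) := by
  have key : ∀ i, fderiv ℝ (vf k ε α β φ i) x (bv i) - vf k ε α β φ i x ^ 2 =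
      (k / (‖x‖ ^ 2 + ε) + α)
      + (- 2 * k / (‖x‖ ^ 2 + ε) ^ 2 - (k / (‖x‖ ^ 2 + ε) + α) ^ 2) * x i ^ 2
      + (β * 2 / (-φ x) - 2 * (k / (‖x‖ ^ 2 + ε) + α) * β * ‖x‖ ^ 2 / (-φ x)) * (x i * pd φ i x)
      + (β * ‖x‖ ^ 2 / (-φ x)) * pd (pd φ i) i x
      + (β * ‖x‖ ^ 2 / (-φ x) ^ 2 - β ^ 2 * ‖x‖ ^ 4 / (-φ x) ^ 2) * pd φ i x ^ 2 := by
    intro i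
    rw [vf_fderiv hφ hε i hx]
    unfold vf
    ring
  simp_rw [key]
  simp only [Finset.sum_add_distrib, ← Finset.mul_sum, Finset.sum_const, Finset.card_univ,
    Fintype.card_fin, nsmul_eq_mul]
  rw [← EuclideanSpace.real_norm_sq_eq]
  ring

lemma alg_A {n k q ε a : ℝ} (hn : n = 2 * k + 2) (hk : 0 ≤ k) (hq : 0 ≤ q) (hε : 0 < ε)
    (ha : 0 ≤ a) (haq : a * q ≤ 1) :
    k ^ 2 / (q + ε) + a ≤ n * (k / (q + ε) + a) - 2 * k * q / (q + ε) ^ 2 - q * (k / (q + ε) + a) ^ 2 := by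
  have hr : 0 < q + ε := by linarith
  obtain ⟨w, hwd⟩ : ∃ w, w = (q + ε)⁻¹ := ⟨_, rfl⟩
  have hw : 0 < w := by rw [hwd]; positivity
  have hw1 : w * (q + ε) = 1 := by rw [hwd]; field_simp
  have e1 : k / (q + ε) = k * w := by rw [div_eq_mul_inv, hwd]
  have e2 : k ^ 2 / (q + ε) = k ^ 2 * w := by rw [div_eq_mul_inv, hwd]
  have e3 : 2 * k * q / (q + ε) ^ 2 = 2 * k * q * w ^ 2 := by
    rw [div_eq_mul_inv, ← inv_pow, hwd]
  rw [e1, e2, e3, hn]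
  have hwq : w * q ≤ 1 := by nlinarith
  have h1 : 0 ≤ k * w * (1 - w * q) := by
    apply mul_nonneg (by positivity); linarith
  have h2 : 0 ≤ k * a * (1 - w * q) := by
    apply mul_nonneg (by positivity); linarith
  have h3 : 0 ≤ a * (1 - a * q) := mul_nonneg ha (by linarith)
  have h4 : 0 ≤ k ^ 2 * w * (1 - w * q) := by
    apply mul_nonneg (by positivity); linarith
  nlinarith

lemma alg_B {n k q ε s D T S ψ M : ℝ} (hn : n = 2 * k + 2) (hk : 0 ≤ k) (hq : 0 ≤ q) (hε : 0 < ε)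
    (hs : 0 ≤ s) (hsq : s * q ≤ 1 / 2) (hψ : 0 < ψ) (hS : 0 ≤ S)
    (hM : s * (2 * |D| + q * |T| + 2 * k * |D|) ≤ M) :
    k ^ 2 / (q + ε) + (s / 2 * q * S - M * ψ) / ψ ^ 2 ≤
      n * (k / (q + ε) + 0) - 2 * k * q / (q + ε) ^ 2
      + s * (2 * D / ψ + q * T / ψ + q * S / ψ ^ 2)
      - (q * (k / (q + ε) + 0) ^ 2 + 2 * (k / (q + ε) + 0) * s * q * D / ψ
        + s ^ 2 * q ^ 2 * S / ψ ^ 2) := by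
  have hA := alg_A (a := 0) hn hk hq hε le_rfl (by linarith)
  have hr : 0 < q + ε := by linarith
  obtain ⟨θ, hθ, hθ0, hθ1⟩ : ∃ θ, q / (q + ε) = θ ∧ 0 ≤ θ ∧ θ ≤ 1 :=
    ⟨_, rfl, by positivity, by rw [div_le_one hr]; linarith⟩
  have h1 : 0 ≤ M * ψ + ψ * (s * (2 * D + q * T - 2 * k * θ * D)) := by
    have hD : -(2 * k * |D|) ≤ -(2 * k * θ * D) := by
      have : θ * D ≤ |D| := by
        calc θ * D ≤ θ * |D| := by gcongr; exact le_abs_self D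
          _ ≤ 1 * |D| := by gcongr
          _ = |D| := one_mul _
      nlinarith
    have hT : -(q * |T|) ≤ q * T := by nlinarith [neg_abs_le T]
    have : -M ≤ s * (2 * D + q * T - 2 * k * θ * D) := by
      have : s * (-(2 * |D| + q * |T| + 2 * k * |D|)) ≤ s * (2 * D + q * T - 2 * k * θ * D) := by
        apply mul_le_mul_of_nonneg_left _ hs
        nlinarith [neg_abs_le D]
      linarith
    nlinarith
  have h2 : 0 ≤ s * q * S * (1 / 2 - s * q) := by
    apply mul_nonneg (by positivity); linarith
  have h3 : s * (2 * D / ψ + q * T / ψ + q * S / ψ ^ 2) - 2 * (k / (q + ε) + 0) * s * q * D / ψ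
      - s ^ 2 * q ^ 2 * S / ψ ^ 2 - (s / 2 * q * S - M * ψ) / ψ ^ 2
      = (M * ψ + ψ * (s * (2 * D + q * T - 2 * k * θ * D)) + s * q * S * (1 / 2 - s * q)) / ψ ^ 2 := by
    rw [← hθ]; field_simp; ring
  have h4 : 0 ≤ (M * ψ + ψ * (s * (2 * D + q * T - 2 * k * θ * D)) + s * q * S * (1 / 2 - s * q)) / ψ ^ 2 := by
    positivity
  linarith

lemma fderiv_eq_zero_of_pd {N : ℕ} {φ : EuclideanSpace ℝ (Fin N) → ℝ} {x : EuclideanSpace ℝ (Fin N)}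
    (h : ∑ i, pd φ i x ^ 2 = 0) : fderiv ℝ φ x = 0 := by
  have h1 : ∀ i, pd φ i x = 0 := by
    intro i
    have := (Finset.sum_eq_zero_iff_of_nonneg (fun i _ => sq_nonneg (pd φ i x))).mp h i (Finset.mem_univ i)
    simpa using this
  have h2 : ‖gradient φ x‖ ^ 2 = 0 := by
    rw [norm_gradient_sq]; exact h
  have h3 : gradient φ x = 0 := by simpa using h2
  have h4 := toDual_gradient (𝕜 := ℝ) (f := φ) (x := x)
  rw [← h4, h3]; simp

lemma bdist_lip {N : ℕ} {Ω : Set (EuclideanSpace ℝ (Fin N))} (hΩo : IsOpen Ω)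
    {R : ℝ} (hR : Ω ⊆ Metric.closedBall 0 R) {φ : EuclideanSpace ℝ (Fin N) → ℝ}
    (hφ : ContDiff ℝ 2 φ) (hΩ : Ω = {x | φ x < 0}) :
    ∃ L : ℝ, 0 < L ∧ ∀ x ∈ Ω, 1 / bdist Ω x ^ 2 ≤ L ^ 2 / (-φ x) ^ 2 := by
  have hcl : closure Ω ⊆ Metric.closedBall 0 R := closure_minimal hR Metric.isClosed_closedBall
  obtain ⟨L, hL⟩ := (isCompact_closedBall (0 : EuclideanSpace ℝ (Fin N)) R).exists_bound_of_continuousOn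
    (hφ.continuous_fderiv (by norm_num)).continuousOn
  refine ⟨max L 1, by positivity, fun x hx => ?_⟩
  have hφx : φ x < 0 := by rw [hΩ] at hx; exact hx
  by_cases hne : (frontier Ω).Nonempty
  · obtain ⟨y, hy, hxy⟩ := isClosed_frontier.exists_infDist_eq_dist hne x
    have hyb := hcl (frontier_subset_closure hy)
    have hyn : y ∉ Ω := by
      rw [hΩo.frontier_eq] at hy; exact hy.2
    have hφy : 0 ≤ φ y := by
      rw [hΩ] at hyn; simpa using hyn
    have h1 : ‖φ y - φ x‖ ≤ max L 1 * ‖y - x‖ :=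
      (convex_closedBall _ _).norm_image_sub_le_of_norm_fderiv_le
        (fun z _ => hφ.differentiable (by norm_num) z)
        (fun z hz => (hL z hz).trans (le_max_left _ _)) (hR hx) hyb
    have h2 : -φ x ≤ max L 1 * bdist Ω x := by
      unfold bdist
      rw [hxy, dist_comm, dist_eq_norm]
      have := le_abs_self (φ y - φ x)
      rw [Real.norm_eq_abs] at h1
      linarith
    have hd : 0 < bdist Ω x := by
      by_contra hcon
      push Not at hcon
      have : max L 1 * bdist Ω x ≤ 0 := mul_nonpos_of_nonneg_of_nonpos (by positivity) hcon
      linarith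
    rw [div_le_div_iff₀ (by positivity) (by nlinarith), one_mul, ← mul_pow]
    exact pow_le_pow_left₀ (by linarith) h2 2
  · rw [Set.not_nonempty_iff_eq_empty] at hne
    unfold bdist
    rw [hne]
    simp only [Metric.infDist_empty]
    norm_num
    positivity

lemma compact_consts {N : ℕ} {Ω : Set (EuclideanSpace ℝ (Fin N))} (hΩo : IsOpen Ω)
    (hb : Bornology.IsBounded Ω) {φ : EuclideanSpace ℝ (Fin N) → ℝ}
    (hφ : ContDiff ℝ 2 φ) (hΩ : Ω = {x | φ x < 0})
    (hfr : ∀ x ∈ frontier Ω, fderiv ℝ φ x ≠ 0) (h0 : (0 : EuclideanSpace ℝ (Fin N)) ∈ Ω)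
    {s k : ℝ} (hs : 0 < s) :
    ∃ M m : ℝ, 0 < m ∧ ∀ x ∈ Ω,
      s * (2 * |∑ i, x i * pd φ i x| + ‖x‖ ^ 2 * |∑ i, pd (pd φ i) i x| + 2 * k * |∑ i, x i * pd φ i x|) ≤ M ∧
      m ≤ s / 2 * ‖x‖ ^ 2 * (∑ i, pd φ i x ^ 2) + φ x ^ 2 := by
  have hK : IsCompact (closure Ω) := hb.isCompact_closure
  have c1 : ∀ i, Continuous (pd φ i) := fun i => (pd_contDiff hφ i).continuous
  have c2 : ∀ i, Continuous (pd (pd φ i) i) := fun i =>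
    ((pd_contDiff hφ i).continuous_fderiv one_ne_zero).clm_apply continuous_const
  have c3 : ∀ i : Fin N, Continuous (fun x : EuclideanSpace ℝ (Fin N) => x i) := fun i =>
    (EuclideanSpace.proj (𝕜 := ℝ) i).continuous
  have c4 : Continuous φ := hφ.continuous
  obtain ⟨M, hM⟩ := hK.exists_bound_of_continuousOn (f := fun x : EuclideanSpace ℝ (Fin N) =>
      s * (2 * |∑ i, x i * pd φ i x| + ‖x‖ ^ 2 * |∑ i, pd (pd φ i) i x| + 2 * k * |∑ i, x i * pd φ i x|))
    (by fun_prop)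
  obtain ⟨z, hz, hmin⟩ := hK.exists_isMinOn ⟨0, subset_closure h0⟩
    (f := fun x : EuclideanSpace ℝ (Fin N) => s / 2 * ‖x‖ ^ 2 * (∑ i, pd φ i x ^ 2) + φ x ^ 2)
    (by fun_prop)
  refine ⟨M, s / 2 * ‖z‖ ^ 2 * (∑ i, pd φ i z ^ 2) + φ z ^ 2, ?_, fun x hx =>
    ⟨(le_abs_self _).trans (hM x (subset_closure hx)), hmin (subset_closure hx)⟩⟩
  have hS : 0 ≤ ∑ i, pd φ i z ^ 2 := Finset.sum_nonneg fun i _ => sq_nonneg _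
  by_cases hφz : φ z = 0
  · have hzn : z ∉ Ω := by rw [hΩ]; simp [hφz]
    have hzf : z ∈ frontier Ω := by rw [hΩo.frontier_eq]; exact ⟨hz, hzn⟩
    have hz0 : z ≠ 0 := fun h => hzn (h ▸ h0)
    have hS' : 0 < ∑ i, pd φ i z ^ 2 := by
      refine lt_of_le_of_ne hS fun h => hfr z hzf (fderiv_eq_zero_of_pd h.symm)
    have : 0 < ‖z‖ := norm_pos_iff.mpr hz0
    positivity
  · positivity

lemma alg_C {P ψ m M : ℝ} (hm : 0 < m) (hψ : 0 < ψ) (h : m ≤ P + ψ ^ 2) :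
    m / 2 / ψ ^ 2 - (1 + M ^ 2 / (2 * m)) ≤ (P - M * ψ) / ψ ^ 2 := by
  rw [le_div_iff₀ (by positivity)]
  have : (m / 2 / ψ ^ 2 - (1 + M ^ 2 / (2 * m))) * ψ ^ 2 = m / 2 - ψ ^ 2 - M ^ 2 * ψ ^ 2 / (2 * m) := by
    field_simp; ring
  rw [this]
  have h2 : M * ψ ≤ m / 2 + M ^ 2 * ψ ^ 2 / (2 * m) := by
    have : m / 2 + M ^ 2 * ψ ^ 2 / (2 * m) - M * ψ = (m - M * ψ) ^ 2 / (2 * m) := by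
      field_simp; ring
    have h3 : 0 ≤ (m - M * ψ) ^ 2 / (2 * m) := by positivity
    linarith
  linarith

/-- The regularised inequality. -/
lemma reg_ineq {N : ℕ} (hN : 3 ≤ N) {Ω : Set (EuclideanSpace ℝ (Fin N))} (hΩo : IsOpen Ω)
    (hb : Bornology.IsBounded Ω) {φ : EuclideanSpace ℝ (Fin N) → ℝ}
    (hφ : ContDiff ℝ 2 φ) (hΩ : Ω = {x | φ x < 0})
    (hfr : ∀ x ∈ frontier Ω, fderiv ℝ φ x ≠ 0) (h0 : (0 : EuclideanSpace ℝ (Fin N)) ∈ Ω) :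
    ∃ c : ℝ, 0 < c ∧ ∀ u : EuclideanSpace ℝ (Fin N) → ℝ, ContDiff ℝ 1 u → HasCompactSupport u →
      tsupport u ⊆ Ω → Integrable (fun x => ‖gradient u x‖ ^ 2) ∧
        Integrable (fun x => 1 / (-φ x) ^ 2 * u x ^ 2) ∧ ∀ ε : ℝ, 0 < ε →
        Integrable (fun x => (((N : ℝ) - 2) / 2) ^ 2 / (‖x‖ ^ 2 + ε) * u x ^ 2) ∧
        ∫ x, (((N : ℝ) - 2) / 2) ^ 2 / (‖x‖ ^ 2 + ε) * u x ^ 2 ≤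
          (∫ x, ‖gradient u x‖ ^ 2) - c * ∫ x, 1 / (-φ x) ^ 2 * u x ^ 2 := by
  obtain ⟨R, hR0, hR⟩ := hb.subset_closedBall_lt 0 0
  obtain ⟨k, hk⟩ : ∃ k : ℝ, k = ((N : ℝ) - 2) / 2 := ⟨_, rfl⟩
  rw [← hk]
  have hNk : (N : ℝ) = 2 * k + 2 := by rw [hk]; ring
  have hk0 : 0 ≤ k := by
    have : (3 : ℝ) ≤ N := by exact_mod_cast hN
    linarith
  obtain ⟨M, m, hm, hMm⟩ := compact_consts (s := 1 / (2 * R ^ 2)) (k := k) hΩo hb hφ hΩ hfr h0 (by positivity)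
  have hq : ∀ x ∈ Ω, ‖x‖ ^ 2 ≤ R ^ 2 := fun x hx => by
    have := hR hx
    rw [mem_closedBall_zero_iff] at this
    exact pow_le_pow_left₀ (norm_nonneg _) this 2
  have hneg : ∀ x ∈ Ω, φ x < 0 := fun x hx => by rw [hΩ] at hx; exact hx
  obtain ⟨a, ha⟩ : ∃ a : ℝ, a = 1 / R ^ 2 := ⟨_, rfl⟩
  have ha0 : 0 < a := by rw [ha]; positivity
  obtain ⟨K, hKd⟩ : ∃ K : ℝ, K = 1 + M ^ 2 / (2 * m) := ⟨_, rfl⟩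
  have hK0 : 0 < K := by rw [hKd]; positivity
  refine ⟨a / (K + a) * (m / 2), by positivity, fun u hu hc hs => ?_⟩
  have hψc : ContinuousOn (fun x => 1 / (-φ x) ^ 2) Ω := by
    refine continuousOn_const.div (hφ.continuous.neg.pow 2).continuousOn fun x hx => ?_
    have := hneg x hx
    have : -φ x ≠ 0 := by linarith
    positivity
  have hρc : ∀ ε : ℝ, 0 < ε → ContinuousOn (fun x : EuclideanSpace ℝ (Fin N) => k ^ 2 / (‖x‖ ^ 2 + ε)) Ω := by
    intro ε hε
    refine continuousOn_const.div (by fun_prop) fun x _ => by positivity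
  have hA : ∀ ε : ℝ, 0 < ε → _ := fun ε hε => basic_ineq (W := fun x => k ^ 2 / (‖x‖ ^ 2 + ε) + a) hΩo hu hc hs
    ((hρc ε hε).add continuousOn_const) (F := vf k ε a 0 φ)
    (fun i x hx => vf_contDiffAt hφ hε i (hneg x hx)) (fun x hx => by
      rw [vf_sum hφ hε (hneg x hx)]
      have := alg_A hNk hk0 (sq_nonneg ‖x‖) hε ha0.le (by
        rw [ha]
        have := hq x hx
        rw [one_div, inv_mul_le_iff₀ (by positivity)]; linarith)
      simp only [zero_mul, mul_zero, add_zero, zero_div, zero_pow, ne_eq, OfNat.ofNat_ne_zero, not_false_eq_true]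
      exact this)
  have hB : ∀ ε : ℝ, 0 < ε → _ := fun ε hε => basic_ineq
    (W := fun x => k ^ 2 / (‖x‖ ^ 2 + ε) + (m / 2 * (1 / (-φ x) ^ 2) - K)) hΩo hu hc hs
    ((hρc ε hε).add ((continuousOn_const.mul hψc).sub continuousOn_const)) (F := vf k ε 0 (1 / (2 * R ^ 2)) φ)
    (fun i x hx => vf_contDiffAt hφ hε i (hneg x hx)) (fun x hx => by
      rw [vf_sum hφ hε (hneg x hx)]
      have hψ : 0 < -φ x := by linarith [hneg x hx]
      obtain ⟨h1, h2⟩ := hMm x hx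
      have e1 := alg_B hNk hk0 (sq_nonneg ‖x‖) hε (s := 1 / (2 * R ^ 2))
        (S := ∑ i, pd φ i x ^ 2) (by positivity) (by
        have := hq x hx
        rw [one_div, inv_mul_le_iff₀ (by positivity)]; linarith) hψ
        (Finset.sum_nonneg fun i _ => sq_nonneg (pd φ i x)) h1
      have e2 := alg_C (M := M) hm hψ (by rw [neg_sq]; exact h2)
      rw [← hKd] at e2
      rw [show m / 2 * (1 / (-φ x) ^ 2) = m / 2 / (-φ x) ^ 2 by ring]
      rw [show ‖x‖ ^ 4 = (‖x‖ ^ 2) ^ 2 by ring]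
      linarith)
  have iP := integrable_mul_of_tsupport hΩo hu.continuous hc hs hψc
  have iU := integrable_mul_of_tsupport (W := fun _ => (1 : ℝ)) hΩo hu.continuous hc hs continuousOn_const
  refine ⟨(hA 1 one_pos).1, iP, fun ε hε => ?_⟩
  have iQ := integrable_mul_of_tsupport hΩo hu.continuous hc hs (hρc ε hε)
  refine ⟨iQ, ?_⟩
  have hA' := (hA ε hε).2
  have hB' := (hB ε hε).2
  have eA : ∫ x, (k ^ 2 / (‖x‖ ^ 2 + ε) + a) * u x ^ 2 =
      (∫ x, k ^ 2 / (‖x‖ ^ 2 + ε) * u x ^ 2) + a * ∫ x, 1 * u x ^ 2 := by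
    rw [← integral_const_mul, ← integral_add iQ (iU.const_mul a)]
    congr 1; ext x; ring
  have eB : ∫ x, (k ^ 2 / (‖x‖ ^ 2 + ε) + (m / 2 * (1 / (-φ x) ^ 2) - K)) * u x ^ 2 =
      (∫ x, k ^ 2 / (‖x‖ ^ 2 + ε) * u x ^ 2) + (m / 2 * (∫ x, 1 / (-φ x) ^ 2 * u x ^ 2) - K * ∫ x, 1 * u x ^ 2) := by
    have iPU : Integrable (fun x => m / 2 * (1 / (-φ x) ^ 2 * u x ^ 2) - K * (1 * u x ^ 2)) :=
      (iP.const_mul _).sub (iU.const_mul K)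
    rw [← integral_const_mul, ← integral_const_mul, ← integral_sub (iP.const_mul _) (iU.const_mul K),
      ← integral_add iQ (iPU)]
    congr 1; ext x; ring
  rw [eA] at hA'
  rw [eB] at hB'
  generalize (∫ x, k ^ 2 / (‖x‖ ^ 2 + ε) * u x ^ 2) = Q at *
  generalize (∫ x, 1 / (-φ x) ^ 2 * u x ^ 2) = P at *
  generalize (∫ x, 1 * u x ^ 2) = U at *
  generalize (∫ x, ‖gradient u x‖ ^ 2) = G at *
  have hKa : 0 < K + a := by positivity
  have h1 : K * (Q + a * U) ≤ K * G := mul_le_mul_of_nonneg_left hA' hK0.le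
  have h2 : a * (Q + (m / 2 * P - K * U)) ≤ a * G := mul_le_mul_of_nonneg_left hB' ha0.le
  have h3 : a / (K + a) * (m / 2) * P = a * (m / 2 * P) / (K + a) := by ring
  rw [h3, le_sub_iff_add_le, ← sub_nonneg]
  have : G - (Q + a * (m / 2 * P) / (K + a)) = ((K + a) * (G - Q) - a * (m / 2 * P)) / (K + a) := by
    field_simp
    ring
  rw [this]
  apply div_nonneg _ hKa.le
  nlinarith

/-- Improved Hardy inequality: the Hardy difference with the critical inverse-square
potential at the origin controls the inverse-square boundary-distance potential. -/
theorem improved_hardy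
    (N : ℕ) (hN : 3 ≤ N)
    (Ω : Set (EuclideanSpace ℝ (Fin N))) (hΩo : IsOpen Ω) (hΩconn : IsConnected Ω)
    (hΩb : Bornology.IsBounded Ω) (hΩsm : IsC2Domain Ω)
    (h0 : (0 : EuclideanSpace ℝ (Fin N)) ∈ Ω) :
    ∃ C : ℝ, 0 < C ∧ C ≤ 1 / 4 ∧
      ∀ u : EuclideanSpace ℝ (Fin N) → ℝ,
        ContDiff ℝ (⊤ : ℕ∞) u → HasCompactSupport u → tsupport u ⊆ Ω →
        C * ∫ x in Ω, u x ^ 2 / bdist Ω x ^ 2 ≤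
          ∫ x in Ω, (‖gradient u x‖ ^ 2 -
            ((N : ℝ) - 2) ^ 2 / (4 * ‖x‖ ^ 2) * u x ^ 2) := by
  obtain ⟨φ, hφ, hΩ, hfr⟩ := hΩsm
  obtain ⟨R, hR⟩ := hΩb.subset_closedBall (0 : EuclideanSpace ℝ (Fin N))
  obtain ⟨L, hL0, hL⟩ := bdist_lip hΩo hR hφ hΩ
  obtain ⟨c, hc0, hc⟩ := reg_ineq hN hΩo hΩb hφ hΩ hfr h0
  refine ⟨min (1 / 4) (c / L ^ 2), by positivity, min_le_left _ _, fun u hu hcs hs => ?_⟩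
  obtain ⟨iG, iP, hreg⟩ := hc u (hu.of_le (by exact_mod_cast le_top)) hcs hs
  have hu0 : ∀ x, x ∉ Ω → u x = 0 := fun x hx =>
    image_eq_zero_of_notMem_tsupport fun h => hx (hs h)
  have hg0 : ∀ x, x ∉ Ω → ‖gradient u x‖ ^ 2 = 0 := fun x hx => by
    rw [norm_gradient_sq, fderiv_of_notMem_tsupport (𝕜 := ℝ) (fun h => hx (hs h))]
    simp
  have hN1 : Nontrivial (EuclideanSpace ℝ (Fin N)) := by
    have : Nonempty (Fin N) := ⟨⟨0, by omega⟩⟩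
    infer_instance
  obtain ⟨iH, hH⟩ := fatou_real (μ := (volume : Measure (EuclideanSpace ℝ (Fin N))))
    (f := fun n x => (((N : ℝ) - 2) / 2) ^ 2 / (‖x‖ ^ 2 + 1 / ((n : ℝ) + 1)) * u x ^ 2)
    (g := fun x => ((N : ℝ) - 2) ^ 2 / (4 * ‖x‖ ^ 2) * u x ^ 2)
    (fun n => (hreg (1 / ((n : ℝ) + 1)) (by positivity)).1) (fun n x => by positivity)
    (fun n => (hreg (1 / ((n : ℝ) + 1)) (by positivity)).2) (by
      have hne : ∀ᵐ x : EuclideanSpace ℝ (Fin N), x ≠ 0 := by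
        simp [ae_iff]
      filter_upwards [hne] with x hx
      have hx' : ‖x‖ ^ 2 + 0 ≠ 0 := by
        have := norm_pos_iff.mpr hx
        positivity
      have := ((tendsto_const_nhds (x := (((N : ℝ) - 2) / 2) ^ 2)).div
        ((tendsto_const_nhds (x := ‖x‖ ^ 2)).add (tendsto_one_div_add_atTop_nhds_zero_nat (𝕜 := ℝ))) hx').mul_const
          (u x ^ 2)
      have e : ((N : ℝ) - 2) ^ 2 / (4 * ‖x‖ ^ 2) * u x ^ 2 =
          (((N : ℝ) - 2) / 2) ^ 2 / (‖x‖ ^ 2 + 0) * u x ^ 2 := by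
        rw [add_zero] at hx' ⊢
        field_simp
        ring
      rw [e]
      exact this)
  rw [setIntegral_eq_integral_of_forall_compl_eq_zero (f := fun x => ‖gradient u x‖ ^ 2 -
            ((N : ℝ) - 2) ^ 2 / (4 * ‖x‖ ^ 2) * u x ^ 2) (fun x hx => by simp [hg0 x hx, hu0 x hx]),
    integral_sub iG iH]
  have hQ : ∫ x in Ω, u x ^ 2 / bdist Ω x ^ 2 ≤ L ^ 2 * ∫ x, 1 / (-φ x) ^ 2 * u x ^ 2 := by
    rw [← integral_const_mul,
      ← setIntegral_eq_integral_of_forall_compl_eq_zero (s := Ω)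
        (f := fun x => L ^ 2 * (1 / (-φ x) ^ 2 * u x ^ 2)) (fun x hx => by simp [hu0 x hx])]
    refine integral_mono_of_nonneg (Filter.Eventually.of_forall fun x => by positivity)
      (iP.const_mul _).integrableOn ?_
    filter_upwards [ae_restrict_mem hΩo.measurableSet] with x hx
    calc u x ^ 2 / bdist Ω x ^ 2 = 1 / bdist Ω x ^ 2 * u x ^ 2 := by ring
      _ ≤ L ^ 2 / (-φ x) ^ 2 * u x ^ 2 := mul_le_mul_of_nonneg_right (hL x hx) (sq_nonneg _)
      _ = _ := by ring
  have hP0 : 0 ≤ ∫ x, 1 / (-φ x) ^ 2 * u x ^ 2 := integral_nonneg fun x => by positivity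
  have hQ0 : 0 ≤ ∫ x in Ω, u x ^ 2 / bdist Ω x ^ 2 := integral_nonneg fun x => by positivity
  have : min (1 / 4) (c / L ^ 2) * ∫ x in Ω, u x ^ 2 / bdist Ω x ^ 2 ≤ c * ∫ x, 1 / (-φ x) ^ 2 * u x ^ 2 := by
    calc _ ≤ c / L ^ 2 * ∫ x in Ω, u x ^ 2 / bdist Ω x ^ 2 := by gcongr; exact min_le_right _ _
      _ ≤ c / L ^ 2 * (L ^ 2 * ∫ x, 1 / (-φ x) ^ 2 * u x ^ 2) := by gcongr
      _ = _ := by field_simp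
  linarith
end
end

section
/- Let N ≥ 3 and R > 0, and let Ω = B(0,R) be the open Euclidean ball of radius R centered at the origin in ℝ^N. Then for every u ∈ C₀^∞(B(0,R)), ∫_{B(0,R)} ( |∇u(x)|² − ((N−2)²/(4|x|²)) · u(x)² ) dx ≥ (1/4) · ∫_{B(0,R)} u(x)²/(R − |x|)² dx. -/
open MeasureTheory Real

noncomputable section

/-- Nonnegativity of an integral from nonnegativity along rays (polar coordinates). -/
theorem polar_nonneg {E : Type*} [NormedAddCommGroup E] [NormedSpace ℝ E]
    [MeasurableSpace E] [BorelSpace E] [FiniteDimensional ℝ E] [Nontrivial E]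
    (μ : Measure E) [μ.IsAddHaarMeasure] (G : E → ℝ)
    (h : ∀ w : E, ‖w‖ = 1 →
      0 ≤ ∫ r in Set.Ioi (0 : ℝ), r ^ (Module.finrank ℝ E - 1) * G (r • w)) :
    0 ≤ ∫ x, G x ∂μ := by
  have e1 : ∫ x, G x ∂μ = ∫ x : ({(0 : E)}ᶜ : Set E), G x.1 ∂(μ.comap (↑)) := by
    rw [integral_subtype_comap (measurableSet_singleton _).compl fun x ↦ G x,
      restrict_compl_singleton]
  have e2 : ∫ x : ({(0 : E)}ᶜ : Set E), G x.1 ∂(μ.comap (↑)) =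
      ∫ p, G (((homeomorphUnitSphereProd E).symm p).1)
        ∂μ.toSphere.prod (.volumeIoiPow (Module.finrank ℝ E - 1)) := by
    simpa using μ.measurePreserving_homeomorphUnitSphereProd.integral_comp
        (Homeomorph.measurableEmbedding _)
        (fun p => G (((homeomorphUnitSphereProd E).symm p).1))
  rw [e1, e2]
  by_cases hi : Integrable (fun p => G (((homeomorphUnitSphereProd E).symm p).1))
      (μ.toSphere.prod (.volumeIoiPow (Module.finrank ℝ E - 1)))
  swap
  · rw [integral_undef hi]
  rw [integral_prod _ hi]
  refine integral_nonneg fun w => ?_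
  simp only [Measure.volumeIoiPow, ENNReal.ofReal, homeomorphUnitSphereProd_symm_apply_coe]
  rw [integral_withDensity_eq_integral_smul,
    integral_subtype_comap measurableSet_Ioi
      fun a ↦ Real.toNNReal (a ^ (Module.finrank ℝ E - 1)) • G (a • w.1),
    setIntegral_congr_fun measurableSet_Ioi
      (g := fun r => r ^ (Module.finrank ℝ E - 1) * G (r • w.1)) fun x hx ↦ ?_]
  · exact h w.1 (by simp)
  · simp only [NNReal.smul_def, Real.coe_toNNReal _ (pow_nonneg (Set.mem_Ioi.1 hx).le _),
      smul_eq_mul]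
  · exact (measurable_subtype_coe.pow_const _).real_toNNReal

/-- One dimensional estimate. -/
theorem one_dim (m : ℕ) (R ρ : ℝ) (hρ : 0 < ρ) (hρR : ρ < R) (v v' g : ℝ → ℝ)
    (hv : ∀ r, HasDerivAt v (v' r) r) (hv' : Continuous v')
    (hz : ∀ r, ρ ≤ r → v r = 0)
    (hg : ∀ r, 0 < r → v' r ^ 2 - ((m : ℝ) + 1) ^ 2 / (4 * r ^ 2) * v r ^ 2
      - 1 / 4 * (v r ^ 2 / (R - r) ^ 2) ≤ g r) :
    0 ≤ ∫ r in Set.Ioi (0 : ℝ), r ^ (m + 2) * g r := by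
  by_cases hi : IntegrableOn (fun r => r ^ (m + 2) * g r) (Set.Ioi (0 : ℝ))
  swap
  · rw [integral_undef hi]
  have hvc : Continuous v := continuous_iff_continuousAt.2 fun r => (hv r).continuousAt
  set H : ℝ → ℝ := fun r =>
    (((m : ℝ) + 1) / 2 * r ^ (m + 1) + r ^ (m + 2) / (2 * (R - r))) * v r ^ 2 with hH
  set H' : ℝ → ℝ := fun r =>
    (((m : ℝ) + 1) ^ 2 / 2 * r ^ m + (m + 2) * r ^ (m + 1) / (2 * (R - r))
      + r ^ (m + 2) / (2 * (R - r) ^ 2)) * v r ^ 2 +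
    (((m : ℝ) + 1) / 2 * r ^ (m + 1) + r ^ (m + 2) / (2 * (R - r))) * (2 * v r * v' r) with hH'
  have hd : ∀ r ∈ Set.uIcc 0 ρ, HasDerivAt H (H' r) r := by
    intro r hr
    rw [Set.uIcc_of_le hρ.le] at hr
    have hne : R - r ≠ 0 := by linarith [hr.2]
    have h1 : HasDerivAt (fun r : ℝ => ((m : ℝ) + 1) / 2 * r ^ (m + 1))
        (((m : ℝ) + 1) / 2 * (((m + 1 : ℕ) : ℝ) * r ^ m)) r := by
      simpa using (hasDerivAt_pow (m + 1) r).const_mul (((m : ℝ) + 1) / 2)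
    have h2 : HasDerivAt (fun r : ℝ => 2 * (R - r)) (2 * (0 - 1)) r :=
      ((hasDerivAt_const r R).sub (hasDerivAt_id r)).const_mul 2
    have h3 : HasDerivAt (fun r : ℝ => r ^ (m + 2)) (((m + 2 : ℕ) : ℝ) * r ^ (m + 1)) r := by
      simpa using (hasDerivAt_pow (m + 2) r)
    have h4 := h3.div h2 (by positivity)
    have h5 := (h1.add h4).mul ((hv r).pow 2)
    refine h5.congr_deriv ?_
    simp only [hH', Pi.add_apply, Pi.div_apply, Pi.pow_apply]
    push_cast
    field_simp
    ring
  have hc : ContinuousOn H' (Set.uIcc 0 ρ) := by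
    rw [Set.uIcc_of_le hρ.le]
    have hne : ∀ r ∈ Set.Icc 0 ρ, 2 * (R - r) ≠ 0 := fun r hr => by
      have : 0 < R - r := by linarith [hr.2]
      positivity
    have hne2 : ∀ r ∈ Set.Icc 0 ρ, 2 * (R - r) ^ 2 ≠ 0 := fun r hr => by
      have : 0 < R - r := by linarith [hr.2]
      positivity
    simp only [hH']
    refine ContinuousOn.add (ContinuousOn.mul (ContinuousOn.add (ContinuousOn.add ?_ ?_) ?_) ?_)
      (ContinuousOn.mul (ContinuousOn.add ?_ ?_) ?_)
    · fun_prop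
    · exact ContinuousOn.div (by fun_prop) (by fun_prop) hne
    · exact ContinuousOn.div (by fun_prop) (by fun_prop) hne2
    · fun_prop
    · fun_prop
    · exact ContinuousOn.div (by fun_prop) (by fun_prop) hne
    · fun_prop
  have hint := hc.intervalIntegrable (μ := volume)
  have hftc := intervalIntegral.integral_eq_sub_of_hasDerivAt hd hint
  have hH0 : H 0 = 0 := by simp [hH]
  have hHρ : H ρ = 0 := by simp [hH, hz ρ le_rfl]
  rw [hH0, hHρ, sub_zero, intervalIntegral.integral_of_le hρ.le] at hftc
  have hiH : IntegrableOn H' (Set.Ioc 0 ρ) := (intervalIntegrable_iff_integrableOn_Ioc_of_le hρ.le).1 hint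
  rw [← Set.Ioc_union_Ioi_eq_Ioi hρ.le, setIntegral_union (Set.Ioc_disjoint_Ioi le_rfl)
    measurableSet_Ioi (hi.mono_set Set.Ioc_subset_Ioi_self)
    (hi.mono_set (Set.Ioi_subset_Ioi hρ.le))]
  refine add_nonneg ?_ ?_
  · have : ∫ r in Set.Ioc 0 ρ, -H' r ≤ ∫ r in Set.Ioc 0 ρ, r ^ (m + 2) * g r := by
      refine setIntegral_mono_on hiH.neg (hi.mono_set Set.Ioc_subset_Ioi_self)
        measurableSet_Ioc fun r hr => ?_
      have hr0 : 0 < r := hr.1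
      have hs : 0 < R - r := by linarith [hr.2]
      have hgr := mul_le_mul_of_nonneg_left (hg r hr0) (pow_nonneg hr0.le (m + 2))
      refine le_trans ?_ hgr
      rw [← sub_nonneg]
      have : r ^ (m + 2) * (v' r ^ 2 - ((m : ℝ) + 1) ^ 2 / (4 * r ^ 2) * v r ^ 2
          - 1 / 4 * (v r ^ 2 / (R - r) ^ 2)) - -H' r
          = r ^ (m + 2) * ((v' r + (((m : ℝ) + 1) / (2 * r) + 1 / (2 * (R - r))) * v r) ^ 2
            + 1 / (2 * r * (R - r)) * v r ^ 2) := by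
        simp only [hH']
        field_simp
        ring
      rw [this]
      positivity
    rw [integral_neg, hftc] at this
    simpa using this
  · refine setIntegral_nonneg measurableSet_Ioi fun r hr => ?_
    have hr0 : 0 < r := hρ.trans hr
    have := hg r hr0
    rw [hz r (le_of_lt hr)] at this
    refine mul_nonneg (pow_nonneg hr0.le _) (le_trans ?_ this)
    simp
    positivity

/-- Improved Hardy inequality on a ball with the sharp constant `1/4`:
for `Ω = B(0,R)` the distance to the boundary is `R - |x|`. -/
theorem improved_hardy_ball
    (N : ℕ) (hN : 3 ≤ N) (R : ℝ) (hR : 0 < R)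
    (u : EuclideanSpace ℝ (Fin N) → ℝ)
    (hu : ContDiff ℝ (⊤ : ℕ∞) u) (hcs : HasCompactSupport u)
    (hsupp : tsupport u ⊆ Metric.ball (0 : EuclideanSpace ℝ (Fin N)) R) :
    (1 / 4) * ∫ x in Metric.ball (0 : EuclideanSpace ℝ (Fin N)) R,
        u x ^ 2 / (R - ‖x‖) ^ 2 ≤
      ∫ x in Metric.ball (0 : EuclideanSpace ℝ (Fin N)) R,
        (‖gradient u x‖ ^ 2 - ((N : ℝ) - 2) ^ 2 / (4 * ‖x‖ ^ 2) * u x ^ 2) := by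
  obtain ⟨m, rfl⟩ : ∃ m, N = m + 3 := ⟨N - 3, by omega⟩
  have hdim : Module.finrank ℝ (EuclideanSpace ℝ (Fin (m + 3))) = m + 3 := by simp
  have hnt : Nontrivial (EuclideanSpace ℝ (Fin (m + 3))) := Module.nontrivial_of_finrank_pos (R := ℝ) (by omega)
  have huc : Continuous u := hu.continuous
  have hfd : Continuous (fderiv ℝ u) := hu.continuous_fderiv (by simp)
  have hgn : ∀ x, ‖gradient u x‖ = ‖fderiv ℝ u x‖ := fun x => by
    rw [gradient, LinearIsometryEquiv.norm_map]
  -- the support lies in a smaller ball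
  obtain ⟨ρ, hρ, hρR, hz⟩ : ∃ ρ, 0 < ρ ∧ ρ < R ∧ ∀ x, ρ ≤ ‖x‖ → u x = 0 := by
    obtain ⟨ρ, hρ, hsub⟩ := exists_pos_lt_subset_ball hR (isClosed_tsupport u) hsupp
    refine ⟨ρ, hρ.1, hρ.2, fun x hx => ?_⟩
    by_contra hne
    have := hsub (subset_tsupport u hne)
    rw [mem_ball_zero_iff] at this
    linarith
  -- integrability
  have hfi : Integrable (fun x => ‖gradient u x‖ ^ 2) := by
    simp only [hgn]
    refine Continuous.integrable_of_hasCompactSupport (by fun_prop) ?_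
    exact (hcs.fderiv (𝕜 := ℝ)).norm.comp_left (g := fun t : ℝ => t ^ 2) (by simp)
  have hdi : Integrable (fun x : (EuclideanSpace ℝ (Fin (m + 3))) => u x ^ 2 / (R - ‖x‖) ^ 2) := by
    have heq : (fun x : (EuclideanSpace ℝ (Fin (m + 3))) => u x ^ 2 / (R - ‖x‖) ^ 2)
        = fun x => u x ^ 2 / (max (R - ‖x‖) (R - ρ)) ^ 2 := by
      funext x
      rcases le_total ρ ‖x‖ with h | h
      · simp [hz x h]
      · rw [max_eq_left (by linarith)]
    rw [heq]
    have hp : ∀ x : (EuclideanSpace ℝ (Fin (m + 3))), (max (R - ‖x‖) (R - ρ)) ^ 2 ≠ 0 := fun x => by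
      have : 0 < max (R - ‖x‖) (R - ρ) := lt_max_of_lt_right (by linarith)
      positivity
    refine Continuous.integrable_of_hasCompactSupport
      (Continuous.div (by fun_prop) (by fun_prop) hp) ?_
    refine hcs.mono fun x hx => ?_
    contrapose! hx
    simp_all
  have hinv : IntegrableOn (fun x : (EuclideanSpace ℝ (Fin (m + 3))) => (fun t : ℝ => 1 / t ^ 2) ‖x‖) (Metric.ball 0 R) := by
    refine (integrableOn_fun_norm_addHaar (f := fun t : ℝ => 1 / t ^ 2) volume).2 ?_
    rw [hdim]
    have : IntegrableOn (fun y : ℝ => y ^ m) (Set.Ioo 0 R) :=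
      ((continuous_pow m).integrableOn_Icc (a := 0) (b := R)).mono_set Set.Ioo_subset_Icc_self
    refine this.congr_fun (fun y hy => ?_) measurableSet_Ioo
    have := hy.1.ne'
    simp only [smul_eq_mul, Nat.add_sub_cancel]
    show y ^ m = y ^ (m + 2) * (1 / y ^ 2)
    field_simp
    ring
  have hhi : IntegrableOn (fun x : (EuclideanSpace ℝ (Fin (m + 3))) => (((m + 3 : ℕ) : ℝ) - 2) ^ 2 / (4 * ‖x‖ ^ 2) * u x ^ 2)
      (Metric.ball 0 R) := by
    obtain ⟨C, hC⟩ := hcs.exists_bound_of_continuous huc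
    have h1 := Integrable.mul_bdd (hf := hinv) (g := fun x : (EuclideanSpace ℝ (Fin (m + 3))) => (((m + 3 : ℕ) : ℝ) - 2) ^ 2 / 4 * u x ^ 2)
      (c := (((m + 3 : ℕ) : ℝ) - 2) ^ 2 / 4 * C ^ 2)
      (Continuous.aestronglyMeasurable (by fun_prop))
      (Filter.Eventually.of_forall fun x => by
        rw [norm_mul, norm_pow, Real.norm_of_nonneg (by positivity)]
        have := hC x
        gcongr)
    refine h1.congr (Filter.Eventually.of_forall fun x => ?_)
    simp only
    ring
  have hsub : IntegrableOn (fun x : (EuclideanSpace ℝ (Fin (m + 3))) =>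
      ‖gradient u x‖ ^ 2 - (((m + 3 : ℕ) : ℝ) - 2) ^ 2 / (4 * ‖x‖ ^ 2) * u x ^ 2)
      (Metric.ball 0 R) := hfi.integrableOn.sub hhi
  rw [← sub_nonneg, ← integral_const_mul, ← integral_sub hsub
    (hdi.integrableOn.const_mul _)]
  rw [setIntegral_eq_integral_of_forall_compl_eq_zero]
  swap
  · intro x hx
    have h1 : x ∉ tsupport u := fun h => hx (hsupp h)
    have h2 : fderiv ℝ u x = 0 := by
      by_contra h
      exact h1 (support_fderiv_subset ℝ h)
    rw [hgn, h2, image_eq_zero_of_notMem_tsupport h1]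
    simp
  refine polar_nonneg volume _ fun w hw => ?_
  rw [hdim]
  refine one_dim m R ρ hρ hρR (fun r => u (r • w)) (fun r => fderiv ℝ u (r • w) w) _
    (fun r => ?_) (by fun_prop) (fun r hr => hz _ ?_) (fun r hr => ?_)
  · have h1 : HasDerivAt (fun r : ℝ => r • w) w r := by
      simpa using (hasDerivAt_id r).smul_const w
    exact ((hu.differentiable (by simp)) (r • w)).hasFDerivAt.comp_hasDerivAt r h1
  · rw [norm_smul, hw, mul_one]
    exact hr.trans (le_abs_self r)
  · have hn : ‖r • w‖ = r := by rw [norm_smul, hw, mul_one, Real.norm_of_nonneg hr.le]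
    have h1 : (fderiv ℝ u (r • w) w) ^ 2 ≤ ‖gradient u (r • w)‖ ^ 2 := by
      rw [hgn, ← sq_abs]
      have := (fderiv ℝ u (r • w)).le_opNorm w
      rw [hw, mul_one] at this
      gcongr
      exact this
    have h2 : (((m + 3 : ℕ) : ℝ) - 2) = (m : ℝ) + 1 := by push_cast; ring
    rw [hn, h2]
    linarith
end
end
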